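/- There exist a nonempty open set U ⊂ ℝ⁴, constants C > 0 and μ₀ > 0, all independent of μ, such that for every μ ∈ (0, μ₀) and every point P ∈ U there is a point Q ∈ ℝ⁴ with |Q − P| ≤ C·μ^{1/20} such that the solution of the restricted planar circular three-body problem with mass parameter μ and initial condition Q is a collision orbit. In other words, in U the set of initial conditions leading to collision is O(μ^{1/20})-dense as μ → 0. -/

import Mathlib

/-- Euclidean norm of a planar vector given by its two components. -/
noncomputable def norm2 (a b : ℝ) : ℝ := Real.sqrt (a ^ 2 + b ^ 2)

/-- Euclidean distance between two points of `ℝ⁴ = ℝ × ℝ × ℝ × ℝ`. -/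
noncomputable def dist4 (P Q : ℝ × ℝ × ℝ × ℝ) : ℝ :=
  Real.sqrt ((P.1 - Q.1) ^ 2 + (P.2.1 - Q.2.1) ^ 2 +
    (P.2.2.1 - Q.2.2.1) ^ 2 + (P.2.2.2 - Q.2.2.2) ^ 2)

/-- `(x1, x2, y1, y2)` is a solution of the restricted planar circular three body
problem with mass parameter `μ` on the set of times `s`, i.e. it solves
`ẋ = ∂H_μ/∂y`, `ẏ = -∂H_μ/∂x` for the Hamiltonian
`H_μ(x,y) = |y|²/2 − xᵗJy − μ/|x−(1−μ,0)| − (1−μ)/|x−(−μ,0)|`. -/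
def IsRCP3BPSol (μ : ℝ) (s : Set ℝ) (x1 x2 y1 y2 : ℝ → ℝ) : Prop :=
  ∀ t ∈ s,
    HasDerivAt x1 (y1 t + x2 t) t ∧
    HasDerivAt x2 (y2 t - x1 t) t ∧
    HasDerivAt y1 (y2 t
      - μ * (x1 t - (1 - μ)) / (norm2 (x1 t - (1 - μ)) (x2 t)) ^ 3
      - (1 - μ) * (x1 t + μ) / (norm2 (x1 t + μ) (x2 t)) ^ 3) t ∧
    HasDerivAt y2 (- y1 t
      - μ * x2 t / (norm2 (x1 t - (1 - μ)) (x2 t)) ^ 3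
      - (1 - μ) * x2 t / (norm2 (x1 t + μ) (x2 t)) ^ 3) t

/-- The initial condition `Q` leads to a collision orbit: the corresponding solution is
defined on a finite interval `[0,T)` and the position tends to one of the primaries,
`(1-μ,0)` or `(-μ,0)`, as `t → T⁻`. -/
def IsCollisionOrbit (μ : ℝ) (Q : ℝ × ℝ × ℝ × ℝ) : Prop :=
  ∃ (T : ℝ) (x1 x2 y1 y2 : ℝ → ℝ), 0 < T ∧
    IsRCP3BPSol μ (Set.Ico 0 T) x1 x2 y1 y2 ∧
    (x1 0, x2 0, y1 0, y2 0) = Q ∧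
    (Filter.Tendsto (fun t => (x1 t, x2 t)) (nhdsWithin T (Set.Iio T))
        (nhds (1 - μ, 0)) ∨
     Filter.Tendsto (fun t => (x1 t, x2 t)) (nhdsWithin T (Set.Iio T))
        (nhds (-μ, 0)))

namespace RC3
open Set Filter Topology

lemma inv_fun_exists (I : Set ℝ) (hI : IsOpen I) (hc : OrdConnected I) (τ r : ℝ → ℝ)
    (h : ∀ s ∈ I, HasDerivAt τ (r s) s) (hr : ∀ s ∈ I, 0 < r s) :
    ∃ θ : ℝ → ℝ, ∀ s ∈ I, θ (τ s) = s ∧ HasDerivAt θ (r s)⁻¹ (τ s) ∧ τ '' I ∈ 𝓝 (τ s) := by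
  have hcont : ContinuousOn τ I := fun s hs => (h s hs).continuousAt.continuousWithinAt
  have hmono : StrictMonoOn τ I := by
    apply strictMonoOn_of_deriv_pos hc.convex hcont
    intro x hx
    rw [hI.interior_eq] at hx
    rw [(h x hx).deriv]; exact hr x hx
  have hinv : LeftInvOn (Function.invFunOn τ I) τ I := hmono.injOn.leftInvOn_invFunOn
  refine ⟨Function.invFunOn τ I, fun s hs => ?_⟩
  set θ := Function.invFunOn τ I
  have hnh : τ '' I ∈ 𝓝 (τ s) := by
    obtain ⟨a, b, hab, hsub⟩ : ∃ a b, s ∈ Ioo a b ∧ Icc a b ⊆ I := by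
      obtain ⟨ε, hε, hball⟩ := Metric.isOpen_iff.1 hI s hs
      refine ⟨s - ε/2, s + ε/2, ⟨by linarith, by linarith⟩, fun x hx => hball ?_⟩
      rw [Metric.mem_ball, Real.dist_eq, abs_lt]
      constructor <;> linarith [hx.1, hx.2]
    have h1 : Icc (τ a) (τ b) ⊆ τ '' Icc a b :=
      intermediate_value_Icc (hab.1.trans hab.2).le (hcont.mono hsub)
    have ha : a ∈ I := hsub ⟨le_rfl, (hab.1.trans hab.2).le⟩
    have hb : b ∈ I := hsub ⟨(hab.1.trans hab.2).le, le_rfl⟩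
    exact mem_of_superset (Icc_mem_nhds (hmono ha hs hab.1) (hmono hs hb hab.2))
      (h1.trans (image_mono hsub))
  have hcθ : ContinuousAt θ (τ s) := by
    have hm : MonotoneOn θ (τ '' I) := by
      rintro _ ⟨x, hx, rfl⟩ _ ⟨y, hy, rfl⟩ hxy
      rw [hinv hx, hinv hy]
      exact (hmono.le_iff_le hx hy).1 hxy
    apply continuousAt_of_monotoneOn_of_image_mem_nhds hm hnh
    rw [hinv.image_image, hinv hs]
    exact hI.mem_nhds hs
  refine ⟨hinv hs, ?_, hnh⟩
  have h2 := h s hs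
  rw [← hinv hs] at h2
  have := HasDerivAt.of_local_left_inverse (f := τ) (g := θ) (a := τ s) (f' := r s) hcθ
    (by simpa [hinv hs] using h2) (hr s hs).ne' ?_
  · exact this
  · filter_upwards [hnh] with y hy
    obtain ⟨x, hx, rfl⟩ := hy
    rw [hinv hx]

lemma boot (f : ℝ → ℝ) (a b : ℝ) (hf : ContinuousOn f (Icc a b)) (ha : f a ≤ 0)
    (h : ∀ t ∈ Icc a b, (∀ s ∈ Icc a t, f s ≤ 0) → f t < 0) : ∀ t ∈ Icc a b, f t ≤ 0 := by
  by_contra hcon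
  push Not at hcon
  obtain ⟨t0, ht0, hpos⟩ := hcon
  have hsub : Icc a t0 ⊆ Icc a b := Icc_subset_Icc_right ht0.2
  have hK : IsCompact (Icc a t0 ∩ f ⁻¹' Ici 0) := by
    apply IsCompact.of_isClosed_subset isCompact_Icc _ inter_subset_left
    exact (hf.mono hsub).preimage_isClosed_of_isClosed isClosed_Icc isClosed_Ici
  obtain ⟨t1, ⟨ht1, hft1⟩, hmin⟩ := hK.exists_isLeast ⟨t0, ⟨ht0.1, le_rfl⟩, hpos.le⟩
  have hz : f t1 ≤ 0 := by
    by_contra hp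
    push Not at hp
    obtain ⟨c, hc, hc0⟩ := intermediate_value_Icc ht1.1
      (hf.mono (Icc_subset_Icc_right (ht1.2.trans ht0.2))) ⟨ha, hp.le⟩
    have := hmin ⟨⟨hc.1, hc.2.trans ht1.2⟩, by simp [hc0]⟩
    have : c = t1 := le_antisymm hc.2 this
    rw [this] at hc0; linarith
  have := h t1 (hsub ht1) (fun s hs => by
    by_contra hp
    push Not at hp
    have h3 := hmin ⟨⟨hs.1, hs.2.trans ht1.2⟩, hp.le⟩
    have : s = t1 := le_antisymm hs.2 h3
    rw [this] at hp; linarith)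
  have h5 : 0 ≤ f t1 := hft1
  linarith

lemma glue {E : Type*} [NormedAddCommGroup E] [NormedSpace ℝ E] (f g : ℝ → E) (t0 : ℝ) (d : E)
    (hf : HasDerivAt f d t0) (hg : HasDerivAt g d t0) (h : f t0 = g t0) :
    HasDerivAt (fun t => if t < t0 then f t else g t) d t0 := by
  have h1 : HasDerivWithinAt (fun t => if t < t0 then f t else g t) d (Iio t0) t0 := by
    apply hf.hasDerivWithinAt.congr
    · intro x hx; simp only [mem_Iio] at hx; simp [hx]
    · simp [h]
  have h2 : HasDerivWithinAt (fun t => if t < t0 then f t else g t) d (Ici t0) t0 := by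
    apply hg.hasDerivWithinAt.congr
    · intro x hx; simp only [mem_Ici] at hx; simp [hx.not_gt]
    · simp
  have := h1.union h2
  rw [Iio_union_Ici] at this
  exact this.hasDerivAt univ_mem

lemma glue' {E : Type*} [NormedAddCommGroup E] [NormedSpace ℝ E] (f g : ℝ → E) (t0 t : ℝ) (d : E)
    (hf : t ≤ t0 → HasDerivAt f d t) (hg : t0 ≤ t → HasDerivAt g d t) (h : f t0 = g t0) :
    HasDerivAt (fun t => if t < t0 then f t else g t) d t := by
  rcases lt_trichotomy t t0 with h1 | h1 | h1
  · apply (hf h1.le).congr_of_eventuallyEq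
    filter_upwards [Iio_mem_nhds h1] with x hx
    simp only [mem_Iio] at hx; simp [hx]
  · subst h1
    exact glue f g _ d (hf le_rfl) (hg le_rfl) h
  · apply (hg h1.le).congr_of_eventuallyEq
    filter_upwards [Ioi_mem_nhds h1] with x hx
    simp only [mem_Ioi] at hx; simp [hx.le]

/-- softened inverse-square direction field -/
noncomputable def gs (r : ℝ) (a : ℂ) : ℂ := ((max ‖a‖ r) ^ 3)⁻¹ • a

lemma gs_eq (r : ℝ) (a : ℂ) (h : r ≤ ‖a‖) : gs r a = (‖a‖ ^ 3)⁻¹ • a := by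
  rw [gs, max_eq_left h]

lemma gs_bound (r : ℝ) (hr : 0 < r) (a : ℂ) : ‖gs r a‖ ≤ (r ^ 2)⁻¹ := by
  rw [gs, norm_smul, norm_inv, norm_pow, Real.norm_eq_abs]
  set A := max ‖a‖ r
  have h1 : ‖a‖ ≤ A := le_max_left _ _
  have h2 : r ≤ A := le_max_right _ _
  have hA : 0 < A := hr.trans_le h2
  rw [abs_of_pos hA]
  calc (A ^ 3)⁻¹ * ‖a‖ ≤ (A ^ 3)⁻¹ * A := by gcongr
    _ = (A ^ 2)⁻¹ := by field_simp
    _ ≤ _ := by gcongr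

lemma gs_lip (r : ℝ) (hr : 0 < r) (a b : ℂ) : ‖gs r a - gs r b‖ ≤ 4 * (r ^ 3)⁻¹ * ‖a - b‖ := by
  simp only [gs]
  set A := max ‖a‖ r with hAd
  set B := max ‖b‖ r with hBd
  have h2 : r ≤ A := le_max_right _ _
  have h3 : ‖b‖ ≤ B := le_max_left _ _
  have h4 : r ≤ B := le_max_right _ _
  have hA : 0 < A := hr.trans_le h2
  have hB : 0 < B := hr.trans_le h4
  have hAB : |B - A| ≤ ‖a - b‖ := by
    rw [hAd, hBd]
    calc _ ≤ |‖b‖ - ‖a‖| := by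
          simpa using abs_max_sub_max_le_abs ‖b‖ ‖a‖ r
      _ ≤ ‖b - a‖ := abs_norm_sub_norm_le b a
      _ = _ := norm_sub_rev _ _
  have e : (A ^ 3)⁻¹ • a - (B ^ 3)⁻¹ • b = (A ^ 3)⁻¹ • (a - b) + ((A ^ 3)⁻¹ - (B ^ 3)⁻¹) • b := by
    module
  have e2 : (A ^ 3)⁻¹ - (B ^ 3)⁻¹ = (B - A) * ((A ^ 2 + A * B + B ^ 2) / (A ^ 3 * B ^ 3)) := by
    field_simp; ring
  rw [e]
  have hx : ‖((A ^ 3)⁻¹ - (B ^ 3)⁻¹) • b‖ ≤ 3 * (r ^ 3)⁻¹ * ‖a - b‖ := by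
    rw [e2, norm_smul, norm_mul, Real.norm_eq_abs, Real.norm_eq_abs,
      abs_of_pos (by positivity : 0 < (A ^ 2 + A * B + B ^ 2) / (A ^ 3 * B ^ 3))]
    calc |B - A| * ((A ^ 2 + A * B + B ^ 2) / (A ^ 3 * B ^ 3)) * ‖b‖
        ≤ ‖a - b‖ * ((A ^ 2 + A * B + B ^ 2) / (A ^ 3 * B ^ 3)) * B := by gcongr
      _ = ((A * (B * B))⁻¹ + (A * (A * B))⁻¹ + (A * (A * A))⁻¹) * ‖a - b‖ := by
          field_simp
      _ ≤ ((r * (r * r))⁻¹ + (r * (r * r))⁻¹ + (r * (r * r))⁻¹) * ‖a - b‖ := by gcongr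
      _ = _ := by ring
  have hy : ‖(A ^ 3)⁻¹ • (a - b)‖ ≤ (r ^ 3)⁻¹ * ‖a - b‖ := by
    rw [norm_smul, norm_inv, norm_pow, Real.norm_eq_abs, abs_of_pos hA]
    gcongr
  calc _ ≤ _ := norm_add_le _ _
    _ ≤ (r ^ 3)⁻¹ * ‖a - b‖ + 3 * (r ^ 3)⁻¹ * ‖a - b‖ := add_le_add hy hx
    _ = _ := by ring

lemma ode_exists {E : Type*} [NormedAddCommGroup E] [NormedSpace ℝ E] [CompleteSpace E]
    (v : ℝ → E → E) (K M : NNReal) (hl : ∀ t, LipschitzWith K (v t))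
    (hc : ∀ x, Continuous fun t => v t x) (hb : ∀ t x, ‖v t x‖ ≤ M) (t0 T : ℝ) (hT : t0 ≤ T)
    (x0 : E) : ∃ α : ℝ → E, α t0 = x0 ∧ ∀ t ∈ Icc t0 T, HasDerivAt α (v t (α t)) t := by
  have ht : t0 ∈ Icc (t0 - 1) (T + 1) := ⟨by linarith, by linarith⟩
  have hP : IsPicardLindelof v (⟨t0, ht⟩ : Icc (t0 - 1) (T + 1)) x0
      (M * (T + 1 - t0).toNNReal) 0 M K := by
    constructor
    · intro t _; exact (hl t).lipschitzOnWith
    · intro x _; exact (hc x).continuousOn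
    · intro t _ x _; exact hb t x
    · push_cast
      simp only [sub_zero, sub_sub_cancel]
      rw [max_eq_left (by linarith), Real.coe_toNNReal _ (by linarith)]
  obtain ⟨α, h0, h1⟩ := hP.exists_eq_forall_mem_Icc_hasDerivWithinAt₀
  refine ⟨α, h0, fun t ht => (h1 t ⟨by linarith [ht.1], by linarith [ht.2]⟩).hasDerivAt ?_⟩
  exact Icc_mem_nhds (by linarith [ht.1]) (by linarith [ht.2])

lemma gron {E : Type*} [NormedAddCommGroup E] [NormedSpace ℝ E] (v : E → E) (K : NNReal)
    (hK : 1 ≤ K) (hl : LipschitzWith K v) (f g : ℝ → E) (f' g' : ℝ → E) (a b ε δ B : ℝ)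
    (hB : b - a ≤ B)
    (hf : ∀ t ∈ Icc a b, HasDerivAt f (f' t) t) (hg : ∀ t ∈ Icc a b, HasDerivAt g (g' t) t)
    (hf' : ∀ t ∈ Icc a b, ‖f' t - v (f t)‖ ≤ ε) (hg' : ∀ t ∈ Icc a b, g' t = v (g t))
    (hd : ‖f a - g a‖ ≤ δ) (hε : 0 ≤ ε) :
    ∀ t ∈ Icc a b, ‖f t - g t‖ ≤ Real.exp (K * B) * (δ + ε) := by
  intro t ht
  have hδ : 0 ≤ δ := (norm_nonneg _).trans hd
  have := dist_le_of_approx_trajectories_ODE (v := fun _ => v) (K := K) (f := f) (g := g)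
    (f' := f') (g' := g') (a := a) (b := b) (εf := ε) (εg := 0) (δ := δ)
    (fun _ => hl) (fun s hs => (hf s hs).continuousAt.continuousWithinAt)
    (fun s hs => (hf s ⟨hs.1, hs.2.le⟩).hasDerivWithinAt)
    (fun s hs => by rw [dist_eq_norm]; exact hf' s ⟨hs.1, hs.2.le⟩)
    (fun s hs => (hg s hs).continuousAt.continuousWithinAt)
    (fun s hs => (hg s ⟨hs.1, hs.2.le⟩).hasDerivWithinAt)
    (fun s hs => by rw [dist_eq_norm, hg' s ⟨hs.1, hs.2.le⟩]; simp)
    (by rw [dist_eq_norm]; exact hd) t ht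
  rw [dist_eq_norm] at this
  refine this.trans ?_
  have hK' : (1 : ℝ) ≤ K := by exact_mod_cast hK
  rw [gronwallBound_of_K_ne_0 (by positivity)]
  have h1 : Real.exp (K * (t - a)) ≤ Real.exp (K * B) := by
    apply Real.exp_le_exp.2; gcongr; linarith [ht.2]
  have h2 : 0 ≤ Real.exp (K * (t - a)) - 1 := by
    have := Real.one_le_exp (x := K * (t - a)) (mul_nonneg (by positivity) (by linarith [ht.1]))
    linarith
  have h3 : (ε + 0) / K ≤ ε := by
    rw [add_zero]; exact div_le_self hε hK'
  have h4 := mul_le_mul_of_nonneg_left h1 hδ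
  have h5 := mul_le_mul_of_nonneg_right h3 h2
  calc _ ≤ δ * Real.exp (K * B) + ε * (Real.exp (K * (t - a)) - 1) := add_le_add h4 h5
    _ ≤ δ * Real.exp (K * B) + ε * Real.exp (K * B) := by
        have := mul_le_mul_of_nonneg_left h1 hε
        linarith
    _ = _ := by ring

end RC3

namespace RC3
open Set Filter Topology

noncomputable def kr (n r0 σ s : ℝ) : ℝ :=
  1 / n ^ 2 + (r0 - 1 / n ^ 2) * Real.cos (n * s) + σ / n * Real.sin (n * s)
noncomputable def kt (n r0 σ s : ℝ) : ℝ :=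
  s / n ^ 2 + (r0 - 1 / n ^ 2) * Real.sin (n * s) / n + σ * (1 - Real.cos (n * s)) / n ^ 2
noncomputable def kf (n r0 s : ℝ) : ℝ := 1 - (1 - Real.cos (n * s)) / (n ^ 2 * r0)
noncomputable def kg (n r0 σ s : ℝ) : ℝ :=
  r0 * Real.sin (n * s) / n + σ * (1 - Real.cos (n * s)) / n ^ 2
noncomputable def kf' (n r0 s : ℝ) : ℝ := - Real.sin (n * s) / (n * r0)
noncomputable def kg' (n r0 σ s : ℝ) : ℝ := r0 * Real.cos (n * s) + σ * Real.sin (n * s) / n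
/-- radial momentum `Re (Z conj V)` -/
def sg (Z V : ℂ) : ℝ := Z.re * V.re + Z.im * V.im
noncomputable def kZ (n r0 σ : ℝ) (Z V : ℂ) (s : ℝ) : ℂ := kf n r0 s • Z + kg n r0 σ s • V
noncomputable def kW (n r0 σ : ℝ) (Z V : ℂ) (s : ℝ) : ℂ := kf' n r0 s • Z + kg' n r0 σ s • V
noncomputable def kV (n r0 σ : ℝ) (Z V : ℂ) (s : ℝ) : ℂ := (kr n r0 σ s)⁻¹ • kW n r0 σ Z V s

lemma nsq (a : ℂ) : ‖a‖ ^ 2 = a.re ^ 2 + a.im ^ 2 := by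
  rw [Complex.sq_norm, Complex.normSq_apply]; ring

lemma nsq_comb (f g : ℝ) (Z V : ℂ) :
    ‖f • Z + g • V‖ ^ 2 = f ^ 2 * ‖Z‖ ^ 2 + 2 * f * g * sg Z V + g ^ 2 * ‖V‖ ^ 2 := by
  simp only [nsq, sg, Complex.add_re, Complex.add_im, Complex.smul_re, Complex.smul_im,
    smul_eq_mul]
  ring

lemma kf_deriv (n r0 s : ℝ) (hn : n ≠ 0) (hr : r0 ≠ 0) :
    HasDerivAt (kf n r0) (kf' n r0 s) s := by
  have h1 : HasDerivAt (fun s => n * s) n s := by simpa using (hasDerivAt_id s).const_mul n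
  have := (((h1.cos).const_sub 1).div_const (n ^ 2 * r0)).const_sub 1
  refine this.congr_deriv ?_
  simp only [kf']; field_simp

lemma kg_deriv (n r0 σ s : ℝ) (hn : n ≠ 0) :
    HasDerivAt (kg n r0 σ) (kg' n r0 σ s) s := by
  have h1 : HasDerivAt (fun s => n * s) n s := by simpa using (hasDerivAt_id s).const_mul n
  have := ((h1.sin.const_mul r0).div_const n).add
    (((h1.cos.const_sub 1).const_mul σ).div_const (n ^ 2))
  refine this.congr_deriv ?_
  simp only [kg']; field_simp

lemma kf'_deriv (n r0 s : ℝ) (hn : n ≠ 0) :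
    HasDerivAt (kf' n r0) (- Real.cos (n * s) / r0) s := by
  have h1 : HasDerivAt (fun s => n * s) n s := by simpa using (hasDerivAt_id s).const_mul n
  have := (h1.sin.neg).div_const (n * r0)
  refine this.congr_deriv ?_
  field_simp

lemma kg'_deriv (n r0 σ s : ℝ) (hn : n ≠ 0) :
    HasDerivAt (kg' n r0 σ) (- r0 * n * Real.sin (n * s) + σ * Real.cos (n * s)) s := by
  have h1 : HasDerivAt (fun s => n * s) n s := by simpa using (hasDerivAt_id s).const_mul n
  have := (h1.cos.const_mul r0).add ((h1.sin.const_mul σ).div_const n)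
  refine this.congr_deriv ?_
  field_simp

lemma kr_deriv (n r0 σ s : ℝ) (hn : n ≠ 0) :
    HasDerivAt (kr n r0 σ)
      (- (r0 - 1 / n ^ 2) * n * Real.sin (n * s) + σ * Real.cos (n * s)) s := by
  have h1 : HasDerivAt (fun s => n * s) n s := by simpa using (hasDerivAt_id s).const_mul n
  have := ((h1.cos.const_mul (r0 - 1 / n ^ 2)).const_add (1 / n ^ 2)).add (h1.sin.const_mul (σ / n))
  refine this.congr_deriv ?_
  field_simp

lemma kt_deriv (n r0 σ s : ℝ) (hn : n ≠ 0) :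
    HasDerivAt (kt n r0 σ) (kr n r0 σ s) s := by
  have h1 : HasDerivAt (fun s => n * s) n s := by simpa using (hasDerivAt_id s).const_mul n
  have := (((hasDerivAt_id s).div_const (n ^ 2)).add
    ((h1.sin.const_mul (r0 - 1 / n ^ 2)).div_const n)).add
    (((h1.cos.const_sub 1).const_mul σ).div_const (n ^ 2))
  refine this.congr_deriv ?_
  simp only [kr]; field_simp

lemma kZ_deriv (n r0 σ : ℝ) (Z V : ℂ) (s : ℝ) (hn : n ≠ 0) (hr : r0 ≠ 0) :
    HasDerivAt (kZ n r0 σ Z V) (kW n r0 σ Z V s) s :=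
  ((kf_deriv n r0 s hn hr).smul_const Z).add ((kg_deriv n r0 σ s hn).smul_const V)

lemma kV_deriv (n r0 σ : ℝ) (Z V : ℂ) (s : ℝ) (hn : n ≠ 0) (hr : r0 ≠ 0)
    (hk : kr n r0 σ s ≠ 0) :
    HasDerivAt (kV n r0 σ Z V) (- ((kr n r0 σ s) ^ 2)⁻¹ • kZ n r0 σ Z V s) s := by
  have h := ((kr_deriv n r0 σ s hn).inv hk).smul
    (((kf'_deriv n r0 s hn).smul_const Z).add ((kg'_deriv n r0 σ s hn).smul_const V))
  refine h.congr_deriv ?_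
  have hcs := Real.sin_sq_add_cos_sq (n * s)
  simp only [kZ, Pi.add_apply, Pi.inv_apply]
  have eF : (kr n r0 σ s) * (- Real.cos (n * s) / r0) -
      (- (r0 - 1 / n ^ 2) * n * Real.sin (n * s) + σ * Real.cos (n * s)) * kf' n r0 s
      = - kf n r0 s := by
    simp only [kr, kf', kf]
    field_simp
    linear_combination ( (1 - n^2*r0)) * hcs
  have eG : (kr n r0 σ s) * (- r0 * n * Real.sin (n * s) + σ * Real.cos (n * s)) -
      (- (r0 - 1 / n ^ 2) * n * Real.sin (n * s) + σ * Real.cos (n * s)) * kg' n r0 σ s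
      = - kg n r0 σ s := by
    simp only [kr, kg', kg]
    field_simp
    linear_combination (-σ ) * hcs
  have h1 : kf n r0 s = -((kr n r0 σ s) * (- Real.cos (n * s) / r0) -
      (- (r0 - 1 / n ^ 2) * n * Real.sin (n * s) + σ * Real.cos (n * s)) * kf' n r0 s) := by
    rw [eF]; ring
  have h2 : kg n r0 σ s = -((kr n r0 σ s) * (- r0 * n * Real.sin (n * s) + σ * Real.cos (n * s)) -
      (- (r0 - 1 / n ^ 2) * n * Real.sin (n * s) + σ * Real.cos (n * s)) * kg' n r0 σ s) := by
    rw [eG]; ring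
  rw [h1, h2]
  generalize - Real.cos (n * s) / r0 = x1
  generalize - r0 * n * Real.sin (n * s) + σ * Real.cos (n * s) = x2
  generalize - (r0 - 1 / n ^ 2) * n * Real.sin (n * s) + σ * Real.cos (n * s) = x3
  generalize kr n r0 σ s = x4 at *
  generalize kf' n r0 s = x5
  generalize kg' n r0 σ s = x6
  simp only [smul_add, smul_smul, div_eq_mul_inv]
  have : x4⁻¹ * x1 = (x4 ^ 2)⁻¹ * (x4 * x1) := by field_simp
  rw [this]
  have : x4⁻¹ * x2 = (x4 ^ 2)⁻¹ * (x4 * x2) := by field_simp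
  rw [this]
  module

lemma kZ_norm (n : ℝ) (Z V : ℂ) (s : ℝ) (hn : n ≠ 0) (hr : Z ≠ 0)
    (hE : ‖V‖ ^ 2 = 2 / ‖Z‖ - n ^ 2) :
    ‖kZ n ‖Z‖ (sg Z V) Z V s‖ ^ 2 = kr n ‖Z‖ (sg Z V) s ^ 2 := by
  have hr' : ‖Z‖ ≠ 0 := by simpa using hr
  have hcs := Real.sin_sq_add_cos_sq (n * s)
  rw [kZ, nsq_comb, hE]
  generalize sg Z V = σ
  simp only [kr, kf, kg]
  have : Real.sin (n * s) ^ 2 = 1 - Real.cos (n * s) ^ 2 := by linarith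
  generalize Real.cos (n * s) = c at *
  generalize Real.sin (n * s) = d at *
  field_simp
  ring_nf
  simp only [this]
  ring

lemma kW_norm (n : ℝ) (Z V : ℂ) (s : ℝ) (hn : n ≠ 0) (hr : Z ≠ 0)
    (hE : ‖V‖ ^ 2 = 2 / ‖Z‖ - n ^ 2) :
    ‖kW n ‖Z‖ (sg Z V) Z V s‖ ^ 2 =
      2 * kr n ‖Z‖ (sg Z V) s - n ^ 2 * kr n ‖Z‖ (sg Z V) s ^ 2 := by
  have hr' : ‖Z‖ ≠ 0 := by simpa using hr
  have hcs := Real.sin_sq_add_cos_sq (n * s)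
  rw [kW, nsq_comb, hE]
  generalize sg Z V = σ
  simp only [kr, kf', kg']
  have : Real.sin (n * s) ^ 2 = 1 - Real.cos (n * s) ^ 2 := by linarith
  generalize Real.cos (n * s) = c at *
  generalize Real.sin (n * s) = d at *
  field_simp
  ring_nf
  simp only [this]
  ring


/-- regularised Kepler vector field -/
noncomputable def Kcl (z : ℂ × ℂ) : ℂ × ℂ := (z.2, - gs (1 / 10) z.1)

lemma Kcl_lip : LipschitzWith 4000 Kcl := by
  apply LipschitzWith.of_dist_le_mul
  intro z w
  rw [dist_eq_norm, dist_eq_norm]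
  rw [Prod.norm_def]
  have h1 : ‖z.1 - w.1‖ ≤ ‖z - w‖ := norm_fst_le (z - w)
  have h2 : ‖z.2 - w.2‖ ≤ ‖z - w‖ := norm_snd_le (z - w)
  have h3 := gs_lip (1 / 10) (by norm_num) z.1 w.1
  norm_num at h3
  push_cast
  apply max_le
  · simp only [Kcl, Prod.fst_sub]
    linarith [norm_nonneg (z - w)]
  · simp only [Kcl, Prod.snd_sub]
    rw [← norm_neg]
    have e : -(-gs (1 / 10) z.1 - -gs (1 / 10) w.1) = gs (1 / 10) z.1 - gs (1 / 10) w.1 := by ring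
    rw [e]
    norm_num
    linarith

/-- the region of admissible initial conditions -/
def Nz (z : ℂ × ℂ) (n : ℝ) : Prop :=
  z.1 ≠ 0 ∧ 0 < n ∧ ‖z.2‖ ^ 2 = 2 / ‖z.1‖ - n ^ 2 ∧ 9 / 10 ≤ n ^ 2 ∧ n ^ 2 ≤ 11 / 10 ∧
    (1 - n ^ 2 * ‖z.1‖) ^ 2 + n ^ 2 * sg z.1 z.2 ^ 2 ≤ 7 / 10

lemma kr_bound (z : ℂ × ℂ) (n : ℝ) (h : Nz z n) (s : ℝ) :
    14 / 100 ≤ kr n ‖z.1‖ (sg z.1 z.2) s ∧ kr n ‖z.1‖ (sg z.1 z.2) s ≤ 21 / 10 := by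
  obtain ⟨h1, h2, h3, h4, h5, h6⟩ := h
  generalize ‖z.1‖ = r at *
  generalize sg z.1 z.2 = σ at *
  have hcs := Real.sin_sq_add_cos_sq (n * s)
  have key : (n ^ 2 * kr n r σ s - 1) ^ 2 ≤ 7 / 10 := by
    refine le_trans ?_ h6
    have : n ^ 2 * kr n r σ s - 1 = (n ^ 2 * r - 1) * Real.cos (n * s) +
        (n * σ) * Real.sin (n * s) := by
      simp only [kr]; field_simp; ring
    rw [this]
    nlinarith [sq_nonneg ((n ^ 2 * r - 1) * Real.sin (n * s) - (n * σ) * Real.cos (n * s))]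
  have h7 : |n ^ 2 * kr n r σ s - 1| ≤ 84 / 100 := by
    apply abs_le_of_sq_le_sq _ (by norm_num)
    linarith
  obtain ⟨h8, h9⟩ := abs_le.1 h7
  constructor
  · by_contra hc
    push Not at hc
    nlinarith
  · by_contra hc
    push Not at hc
    nlinarith

structure KepOrb (z : ℂ × ℂ) (P : ℝ) (φ : ℝ → ℂ × ℂ) : Prop where
  zero : φ 0 = z
  deriv : ∀ t, HasDerivAt φ (Kcl (φ t)) t
  per : ∀ t, φ (t + P) = φ t
  bd : ∀ t, ‖Kcl (φ t)‖ ≤ 60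

lemma kepler_exists (z : ℂ × ℂ) (n : ℝ) (h : Nz z n) : ∃ φ, KepOrb z (2 * Real.pi / n ^ 3) φ ∧
    (∀ s, φ (kt n ‖z.1‖ (sg z.1 z.2) s) =
      (kZ n ‖z.1‖ (sg z.1 z.2) z.1 z.2 s, kV n ‖z.1‖ (sg z.1 z.2) z.1 z.2 s)) ∧
    (∀ t, 14 / 100 ≤ ‖(φ t).1‖) ∧ (∀ t, ∃ s, kt n ‖z.1‖ (sg z.1 z.2) s = t) := by
  have hb := kr_bound z n h
  obtain ⟨h1, h2, h3, h4, h5, h6⟩ := h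
  have hr0 : ‖z.1‖ ≠ 0 := by simpa using h1
  set r0 := ‖z.1‖ with hr0d
  set σ := sg z.1 z.2 with hσd
  have hpos : ∀ s, 0 < kr n r0 σ s := fun s => by linarith [(hb s).1]
  obtain ⟨θ, hθ⟩ := inv_fun_exists univ isOpen_univ ordConnected_univ (kt n r0 σ) (kr n r0 σ)
    (fun s _ => kt_deriv n r0 σ s h2.ne') (fun s _ => hpos s)
  have hcont : Continuous (kt n r0 σ) :=
    continuous_iff_continuousAt.2 fun s => (kt_deriv n r0 σ s h2.ne').continuousAt
  have hper : ∀ s, kt n r0 σ (s + 2 * Real.pi / n) = kt n r0 σ s + 2 * Real.pi / n ^ 3 := by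
    intro s
    have : n * (s + 2 * Real.pi / n) = n * s + 2 * Real.pi := by field_simp
    simp only [kt, this, Real.cos_add_two_pi, Real.sin_add_two_pi]
    field_simp
    ring
  have hnear : ∃ M, ∀ s, |kt n r0 σ s - s / n ^ 2| ≤ M := by
    refine ⟨|r0 - 1 / n ^ 2| / n + 2 * |σ| / n ^ 2, fun s => ?_⟩
    have e : kt n r0 σ s - s / n ^ 2 = (r0 - 1 / n ^ 2) * Real.sin (n * s) / n
      + σ * (1 - Real.cos (n * s)) / n ^ 2 := by simp only [kt]; ring
    rw [e]
    refine (abs_add_le _ _).trans ?_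
    rw [abs_div, abs_div, abs_mul, abs_mul, abs_of_pos h2, abs_of_pos (by positivity : 0 < n ^ 2)]
    gcongr ?_ / _ + ?_ / _
    · exact mul_le_of_le_one_right (abs_nonneg _) (Real.abs_sin_le_one _)
    · rw [mul_comm]
      gcongr
      rw [abs_le]
      constructor <;> linarith [Real.cos_le_one (n * s), Real.neg_one_le_cos (n * s)]
  obtain ⟨M, hM⟩ := hnear
  have hsurj : Function.Surjective (kt n r0 σ) := by
    apply hcont.surjective
    · have : Tendsto (fun s : ℝ => s / n ^ 2 - M) atTop atTop :=
        tendsto_atTop_add_const_right _ _ (tendsto_id.atTop_div_const (by positivity))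
      refine tendsto_atTop_mono (fun s => ?_) this
      linarith [(abs_le.1 (hM s)).1]
    · have : Tendsto (fun s : ℝ => s / n ^ 2 + M) atBot atBot :=
        tendsto_atBot_add_const_right _ _ (tendsto_id.atBot_div_const (by positivity))
      refine tendsto_atBot_mono (fun s => ?_) this
      linarith [(abs_le.1 (hM s)).2]
  have hn1 : ∀ s, ‖kZ n r0 σ z.1 z.2 s‖ = kr n r0 σ s := fun s => by
    have := kZ_norm n z.1 z.2 s h2.ne' h1 h3
    rw [← hr0d, ← hσd] at this
    exact (pow_left_inj₀ (norm_nonneg _) (hpos s).le two_ne_zero).1 this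
  have hgs : ∀ s, gs (1 / 10) (kZ n r0 σ z.1 z.2 s) =
      ((kr n r0 σ s) ^ 3)⁻¹ • kZ n r0 σ z.1 z.2 s := fun s => by
    rw [gs_eq, hn1]
    rw [hn1]; linarith [(hb s).1]
  have hV : ∀ s, ‖kV n r0 σ z.1 z.2 s‖ ≤ 60 := fun s => by
    have hw := kW_norm n z.1 z.2 s h2.ne' h1 h3
    rw [← hr0d, ← hσd] at hw
    have : ‖kV n r0 σ z.1 z.2 s‖ ^ 2 ≤ 60 ^ 2 := by
      rw [kV, norm_smul, mul_pow, hw, norm_inv, Real.norm_eq_abs, abs_of_pos (hpos s), inv_pow,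
        inv_mul_le_iff₀ (by have := hpos s; positivity)]
      have := (hb s).1
      nlinarith [mul_nonneg (sq_nonneg n) (sq_nonneg (kr n r0 σ s))]
    exact (le_abs_self _).trans (abs_le_of_sq_le_sq this (by norm_num))
  refine ⟨fun t => (kZ n r0 σ z.1 z.2 (θ t), kV n r0 σ z.1 z.2 (θ t)), ⟨?_, ?_, ?_, ?_⟩, ?_, ?_, ?_⟩
  · have h0 : kt n r0 σ 0 = 0 := by simp [kt]
    have : θ 0 = 0 := by
      have := (hθ 0 trivial).1
      rwa [h0] at this
    simp only [this]
    simp [kZ, kV, kW, kf, kg, kf', kg', kr, hr0]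
  · intro t
    obtain ⟨s, rfl⟩ := hsurj t
    obtain ⟨e1, e2, -⟩ := hθ s trivial
    have d1 := kZ_deriv n r0 σ z.1 z.2 s h2.ne' hr0
    have d2 := kV_deriv n r0 σ z.1 z.2 s h2.ne' hr0 (hpos s).ne'
    rw [← e1] at d1 d2
    have d3 := (d1.scomp _ e2).prodMk (d2.scomp _ e2)
    refine d3.congr_deriv ?_
    simp only [Kcl, e1, hgs]
    congr 1
    rw [smul_smul, ← neg_smul]
    congr 1
    have := (hpos s).ne'
    field_simp
  · intro t
    obtain ⟨s, rfl⟩ := hsurj t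
    rw [← hper, (hθ _ trivial).1, (hθ _ trivial).1]
    have : n * (s + 2 * Real.pi / n) = n * s + 2 * Real.pi := by field_simp
    simp only [kZ, kV, kW, kf, kg, kf', kg', kr, this, Real.cos_add_two_pi, Real.sin_add_two_pi]
  · intro t
    simp only [Kcl, Prod.norm_def]
    apply max_le (hV _)
    rw [norm_neg, hgs, norm_smul, hn1, norm_inv, norm_pow, Real.norm_eq_abs, abs_of_pos (hpos _)]
    have h8 := (hb (θ t)).1
    have h9 := hpos (θ t)
    rw [inv_mul_le_iff₀ (by positivity)]
    generalize kr n r0 σ (θ t) = x at *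
    have : 1 ≤ 60 * x ^ 2 := by nlinarith
    nlinarith
  · intro s
    simp only [(hθ _ trivial).1]
  · intro t
    simp only [hn1]
    exact (hb _).1
  · exact fun t => hsurj t

end RC3

namespace RC3
open Set Filter Topology

noncomputable def nn (z : ℂ × ℂ) : ℝ := Real.sqrt (2 / ‖z.1‖ - ‖z.2‖ ^ 2)
noncomputable def PerF (z : ℂ × ℂ) : ℝ := 2 * Real.pi / nn z ^ 3
noncomputable def vst : ℂ := ⟨4 / 5, 3 / 5⟩
noncomputable def zst : ℂ × ℂ := (1, vst)

lemma vst_norm : ‖vst‖ = 1 := by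
  have : ‖vst‖ ^ 2 = 1 := by rw [nsq]; simp [vst]; norm_num
  exact (pow_eq_one_iff_of_nonneg (norm_nonneg _) two_ne_zero).1 this

lemma nn_zst : nn zst = 1 := by
  simp [nn, zst, vst_norm]
  norm_num

lemma near_zst : ∃ κ > 0, ∃ K : ℝ, 0 ≤ K ∧ (∀ z, ‖z - zst‖ ≤ κ → Nz z (nn z) ∧ 5 ≤ PerF z ∧ PerF z ≤ 8) ∧
    ∀ z w, ‖z - zst‖ ≤ κ → ‖w - zst‖ ≤ κ → |PerF z - PerF w| ≤ K * ‖z - w‖ := by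
  have hv2 : ‖zst.2‖ = 1 := vst_norm
  have hE0 : ContDiffAt ℝ 1 (fun z : ℂ × ℂ => 2 / ‖z.1‖ - ‖z.2‖ ^ 2) zst := by
    apply ContDiffAt.sub
    · apply ContDiffAt.div contDiffAt_const
      · exact ContDiffAt.norm ℝ contDiffAt_fst (by simp [zst])
      · simp [zst]
    · apply ContDiffAt.pow
      refine ContDiffAt.norm ℝ contDiffAt_snd ?_
      intro h; rw [h] at hv2; simp at hv2
  have hv : (2 / ‖zst.1‖ - ‖zst.2‖ ^ 2) = 1 := by rw [hv2]; simp [zst]; norm_num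
  have hnn : ContDiffAt ℝ 1 nn zst := by
    apply ContDiffAt.sqrt hE0
    simp only [hv]; norm_num
  have hP : ContDiffAt ℝ 1 PerF zst := by
    apply ContDiffAt.div contDiffAt_const (hnn.pow 3)
    rw [nn_zst]; norm_num
  obtain ⟨K, t, ht, hK⟩ := hP.exists_lipschitzOnWith
  have c1 : ContinuousAt (fun z : ℂ × ℂ => 2 / ‖z.1‖ - ‖z.2‖ ^ 2) zst := hE0.continuousAt
  have c2 : ContinuousAt (fun z : ℂ × ℂ => ‖z.1‖) zst := by fun_prop
  have c3 : ContinuousAt nn zst := hnn.continuousAt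
  have c4 : ContinuousAt (fun z : ℂ × ℂ => (1 - nn z ^ 2 * ‖z.1‖) ^ 2 + nn z ^ 2 * sg z.1 z.2 ^ 2) zst := by
    unfold sg
    fun_prop
  have e1 : ∀ᶠ z in 𝓝 zst, 0 < 2 / ‖z.1‖ - ‖z.2‖ ^ 2 :=
    c1.eventually_const_lt (by simp only [hv]; norm_num)
  have e2 : ∀ᶠ z in 𝓝 zst, 0 < ‖z.1‖ := c2.eventually_const_lt (by simp [zst])
  have e3 : ∀ᶠ z in 𝓝 zst, 9 / 10 < nn z ^ 2 :=
    (c3.pow 2).eventually_const_lt (by simp only [Pi.pow_apply, nn_zst]; norm_num)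
  have e4 : ∀ᶠ z in 𝓝 zst, nn z ^ 2 < 11 / 10 :=
    (c3.pow 2).eventually_lt_const (by simp only [Pi.pow_apply, nn_zst]; norm_num)
  have e5 : ∀ᶠ z in 𝓝 zst, (1 - nn z ^ 2 * ‖z.1‖) ^ 2 + nn z ^ 2 * sg z.1 z.2 ^ 2 < 7 / 10 :=
    c4.eventually_lt_const (by simp only [nn_zst]; simp [zst, sg, vst]; norm_num)
  have e6 : ∀ᶠ z in 𝓝 zst, 5 < PerF z :=
    hP.continuousAt.eventually_const_lt (by rw [PerF, nn_zst]; linarith [Real.pi_gt_three])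
  have e7 : ∀ᶠ z in 𝓝 zst, PerF z < 8 :=
    hP.continuousAt.eventually_lt_const (by rw [PerF, nn_zst]; linarith [Real.pi_lt_d2])
  have e8 : ∀ᶠ z in 𝓝 zst, z ∈ t := ht
  obtain ⟨ε, hε, hball⟩ := Metric.eventually_nhds_iff.1 (e1.and (e2.and (e3.and (e4.and (e5.and (e6.and (e7.and e8)))))))
  refine ⟨ε / 2, by positivity, K, by positivity, fun z hz => ?_, fun z w hz hw => ?_⟩
  · obtain ⟨a1, a2, a3, a4, a5, a6, a7, a8⟩ := hball (y := z) (by rw [dist_eq_norm]; linarith)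
    refine ⟨⟨by simpa using a2, Real.sqrt_pos.2 a1, ?_, a3.le, a4.le, a5.le⟩, a6.le, a7.le⟩
    rw [nn, Real.sq_sqrt a1.le]; ring
  · obtain ⟨a1, a2, a3, a4, a5, a6, a7, a8⟩ := hball (y := z) (by rw [dist_eq_norm]; linarith)
    obtain ⟨b1, b2, b3, b4, b5, b6, b7, b8⟩ := hball (y := w) (by rw [dist_eq_norm]; linarith)
    have := hK.dist_le_mul z a8 w b8
    rwa [Real.dist_eq, dist_eq_norm] at this

lemma KepOrb.lip {z P φ} (h : KepOrb z P φ) (a b : ℝ) : ‖φ a - φ b‖ ≤ 60 * |a - b| := by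
  have := Convex.norm_image_sub_le_of_norm_hasDerivWithin_le (f := φ) (s := univ)
    (fun x _ => (h.deriv x).hasDerivWithinAt) (fun x _ => h.bd x) convex_univ
    (mem_univ b) (mem_univ a)
  simpa [Real.norm_eq_abs] using this

lemma pert : ∃ κ > 0, ∃ C : ℝ, 1 ≤ C ∧
    (∀ z, ‖z - zst‖ ≤ κ → Nz z (nn z) ∧ 5 ≤ PerF z ∧ PerF z ≤ 8) ∧
    ∀ m : ℕ, ∀ (ζ : ℂ × ℂ) (φ z z' : ℝ → ℂ × ℂ) (T η ε : ℝ), ‖ζ - zst‖ ≤ κ / 2 →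
      KepOrb ζ (PerF ζ) φ → (∀ t ∈ Icc 0 T, HasDerivAt z (z' t) t) →
      (∀ t ∈ Icc 0 T, ‖z' t - Kcl (z t)‖ ≤ ε) → ‖z 0 - ζ‖ ≤ η → T ≤ 5 * m → 0 ≤ ε →
      η + C * m * ε ≤ κ / 2 →
      ∀ t ∈ Icc 0 T, ‖z t - φ t‖ ≤ C * (m + 1) * (η + C * m * ε) := by
  obtain ⟨κ, hκ, K, hK, hN, hL⟩ := near_zst
  set A := Real.exp ((4000 : NNReal) * (8 : ℝ)) with hA
  have hA1 : 1 ≤ A := Real.one_le_exp (by positivity)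
  set C := A + 60 * K + 1 with hC
  have hC1 : 1 ≤ C := by rw [hC]; nlinarith
  refine ⟨κ, hκ, C, hC1, hN, ?_⟩
  intro m
  induction m with
  | zero =>
    intro ζ φ z z' T η ε hζ hφ hz hz' h0 hT hε hs t ht
    have : t = 0 := by
      have := ht.1; have := ht.2; push_cast at hT; linarith
    subst this
    rw [hφ.zero]
    have : 0 ≤ η := (norm_nonneg _).trans h0
    push_cast
    nlinarith
  | succ m ih =>
    intro ζ φ z z' T η ε hζ hφ hz hz' h0 hT hε hs t ht
    have hη : 0 ≤ η := (norm_nonneg _).trans h0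
    have hm : (0 : ℝ) ≤ m := by positivity
    push_cast at hs hT ⊢
    have hCm : 0 ≤ C * (m + 1) * ε := by positivity
    have hz0 : ‖z 0 - zst‖ ≤ κ := by
      calc ‖z 0 - zst‖ = ‖(z 0 - ζ) + (ζ - zst)‖ := by congr 1; abel
        _ ≤ ‖z 0 - ζ‖ + ‖ζ - zst‖ := norm_add_le _ _
        _ ≤ κ := by linarith
    obtain ⟨n0, p1, p2⟩ := hN _ hz0
    set P := PerF (z 0) with hP
    have hsm : η + ε ≤ η + C * (m + 1) * ε := by
      have : 1 * ε ≤ C * (m + 1) * ε := by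
        apply mul_le_mul_of_nonneg_right _ hε
        nlinarith
      linarith
    rcases le_or_gt t P with htP | htP
    · have := gron Kcl 4000 (by norm_num) Kcl_lip z φ z' (fun t => Kcl (φ t)) 0 t ε η 8 (by linarith)
        (fun s hs => hz s ⟨hs.1, hs.2.trans ht.2⟩) (fun s _ => hφ.deriv s)
        (fun s hs => hz' s ⟨hs.1, hs.2.trans ht.2⟩) (fun s _ => rfl) (by rw [hφ.zero]; exact h0) hε
        t ⟨ht.1, le_rfl⟩
      refine this.trans ?_
      rw [← hA]
      have hAC : A ≤ C * (m + 1 + 1) := by nlinarith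
      calc A * (η + ε) ≤ A * (η + C * (m + 1) * ε) := by gcongr
        _ ≤ _ := by gcongr
    · obtain ⟨ψ, hψ, -⟩ := kepler_exists _ _ n0
      have hP0 : 0 ≤ P := by linarith
      have hPT : P ≤ T := htP.le.trans ht.2
      have hret : ‖z P - z 0‖ ≤ A * ε := by
        have := gron Kcl 4000 (by norm_num) Kcl_lip z ψ z' (fun t => Kcl (ψ t)) 0 P ε 0 8 (by linarith)
          (fun s hs => hz s ⟨hs.1, hs.2.trans hPT⟩) (fun s _ => hψ.deriv s)
          (fun s hs => hz' s ⟨hs.1, hs.2.trans hPT⟩) (fun s _ => rfl) (by rw [hψ.zero]; simp) hε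
          P ⟨hP0, le_rfl⟩
        have e : ψ P = z 0 := by
          have := hψ.per 0
          rw [zero_add, hψ.zero] at this
          exact this
        rw [e, zero_add] at this
        exact this
      have h1 := ih ζ φ (fun t => z (P + t)) (fun t => z' (P + t)) (T - P) (η + C * ε) ε hζ hφ
        (fun s hs => (hz (P + s) ⟨by linarith [hs.1], by linarith [hs.2]⟩).comp_const_add P s)
        (fun s hs => hz' (P + s) ⟨by linarith [hs.1], by linarith [hs.2]⟩)
        (by
          simp only [add_zero]
          calc ‖z P - ζ‖ = ‖(z P - z 0) + (z 0 - ζ)‖ := by congr 1; abel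
            _ ≤ ‖z P - z 0‖ + ‖z 0 - ζ‖ := norm_add_le _ _
            _ ≤ A * ε + η := add_le_add hret h0
            _ ≤ _ := by
              have : A * ε ≤ C * ε := by gcongr; nlinarith
              linarith)
        (by linarith) hε (by linarith) (t - P) ⟨by linarith, by linarith [ht.2]⟩
      simp only [add_sub_cancel] at h1
      have h2 : ‖φ (t - P) - φ t‖ ≤ C * η := by
        have e : φ (t - P) = φ (t - P + PerF ζ) := (hφ.per _).symm
        rw [e]
        refine (hφ.lip _ _).trans ?_
        have : t - P + PerF ζ - t = PerF ζ - P := by ring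
        rw [this]
        have h3 := hL ζ (z 0) (by linarith) hz0
        rw [norm_sub_rev] at h3
        have h4 : K * ‖z 0 - ζ‖ ≤ K * η := by gcongr
        have h5 : C * η = A * η + 60 * (K * η) + η := by rw [hC]; ring
        have h6 : 0 ≤ A * η := by positivity
        rw [← hP] at h3
        linarith
      calc ‖z t - φ t‖ = ‖(z t - φ (t - P)) + (φ (t - P) - φ t)‖ := by congr 1; abel
        _ ≤ _ := norm_add_le _ _
        _ ≤ C * (m + 1) * (η + C * ε + C * m * ε) + C * η := add_le_add h1 h2
        _ = C * (m + 1) * (η + C * (m + 1) * ε) + C * η := by ring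
        _ ≤ C * (m + 1) * (η + C * (m + 1) * ε) + C * (η + C * (m + 1) * ε) := by gcongr; linarith
        _ = _ := by ring

end RC3

namespace RC3
open Set Filter Topology ComplexConjugate

noncomputable def Jt (t : ℝ) : ℂ := Complex.exp (t * Complex.I)
noncomputable def Fp (μ t : ℝ) (q : ℂ) : ℂ :=
  (1 - μ) • (Jt t - (‖q + Jt t‖ ^ 3)⁻¹ • (q + Jt t))

lemma Jt_norm (t : ℝ) : ‖Jt t‖ = 1 := Complex.norm_exp_ofReal_mul_I t

lemma Jt_deriv (t : ℝ) : HasDerivAt Jt (Complex.I * Jt t) t := by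
  have h1 : HasDerivAt (fun t : ℝ => (t : ℂ) * Complex.I) Complex.I t := by
    simpa using (Complex.ofRealCLM.hasDerivAt (x := t)).mul_const Complex.I
  have := h1.cexp
  refine this.congr_deriv ?_
  rw [Jt, mul_comm]

lemma Jt_contDiff : ContDiff ℝ 1 Jt := by
  unfold Jt
  have h1 : ContDiff ℝ 1 (fun t : ℝ => (t : ℂ)) := Complex.ofRealCLM.contDiff
  exact (Complex.contDiff_exp (𝕜 := ℝ)).comp (h1.mul contDiff_const)

/-- the regularised vector field -/
noncomputable def lcX (μ : ℝ) (x : ℂ × ℂ × ℝ × ℝ) : ℂ × ℂ × ℝ × ℝ :=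
  (x.2.1, (x.2.2.1 / 2) • x.1 + (Complex.normSq x.1 / 2) • (conj x.1 * Fp μ x.2.2.2 (x.1 ^ 2)),
    2 * (conj (Fp μ x.2.2.2 (x.1 ^ 2)) * (x.1 * x.2.1)).re, Complex.normSq x.1)

lemma normSq_contDiff : ContDiff ℝ 1 (fun z : ℂ => Complex.normSq z) := by
  have : (fun z : ℂ => Complex.normSq z) = fun z => Complex.reCLM z * Complex.reCLM z +
    Complex.imCLM z * Complex.imCLM z := by
    ext z; simp [Complex.normSq_apply]
  rw [this]
  exact (Complex.reCLM.contDiff.mul Complex.reCLM.contDiff).add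
    (Complex.imCLM.contDiff.mul Complex.imCLM.contDiff)

lemma conj_contDiff : ContDiff ℝ 1 (fun z : ℂ => conj z) := Complex.conjCLE.contDiff

lemma lcX_contDiffAt (μ : ℝ) (w0 : ℂ) (h0 : ℝ) : ContDiffAt ℝ 1 (lcX μ) (0, w0, h0, 0) := by
  set x0 : ℂ × ℂ × ℝ × ℝ := (0, w0, h0, 0)
  have c1 : ContDiffAt ℝ 1 (fun x : ℂ × ℂ × ℝ × ℝ => x.1) x0 := contDiffAt_fst
  have c2 : ContDiffAt ℝ 1 (fun x : ℂ × ℂ × ℝ × ℝ => x.2.1) x0 := by fun_prop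
  have c3 : ContDiffAt ℝ 1 (fun x : ℂ × ℂ × ℝ × ℝ => x.2.2.1) x0 := by fun_prop
  have c4 : ContDiffAt ℝ 1 (fun x : ℂ × ℂ × ℝ × ℝ => x.2.2.2) x0 := by fun_prop
  have cJ : ContDiffAt ℝ 1 (fun x : ℂ × ℂ × ℝ × ℝ => Jt x.2.2.2) x0 :=
    Jt_contDiff.contDiffAt.comp x0 c4
  have cA : ContDiffAt ℝ 1 (fun x : ℂ × ℂ × ℝ × ℝ => x.1 ^ 2 + Jt x.2.2.2) x0 :=
    (c1.pow 2).add cJ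
  have hne : x0.1 ^ 2 + Jt x0.2.2.2 ≠ 0 := by simp [x0, Jt]
  have cF : ContDiffAt ℝ 1 (fun x : ℂ × ℂ × ℝ × ℝ => Fp μ x.2.2.2 (x.1 ^ 2)) x0 := by
    have hi := ((cA.norm ℝ hne).pow 3).inv (by simpa using hne)
    exact (cJ.sub (hi.smul cA)).const_smul _
  have cc := conj_contDiff.contDiffAt.comp x0 c1
  have cFc := conj_contDiff.contDiffAt.comp x0 cF
  have cn := normSq_contDiff.contDiffAt.comp x0 c1
  apply c2.prodMk
  apply ContDiffAt.prodMk
  · exact ((c3.div_const 2).smul c1).add ((cn.div_const 2).smul (cc.mul cF))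
  · apply ContDiffAt.prodMk _ cn
    apply contDiffAt_const.mul
    exact Complex.reCLM.contDiff.contDiffAt.comp x0 (cFc.mul (c1.mul c2))

lemma lc_raw (μ : ℝ) (w0 : ℂ) (h0 : ℝ) : ∃ ε > 0, ∃ (u w : ℝ → ℂ) (h τ : ℝ → ℝ),
    u 0 = 0 ∧ w 0 = w0 ∧ h 0 = h0 ∧ τ 0 = 0 ∧ ∀ s ∈ Ioo (-ε) ε,
      HasDerivAt u (w s) s ∧
      HasDerivAt w ((h s / 2) • u s + (Complex.normSq (u s) / 2) •
        (conj (u s) * Fp μ (τ s) (u s ^ 2))) s ∧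
      HasDerivAt h (2 * (conj (Fp μ (τ s) (u s ^ 2)) * (u s * w s)).re) s ∧
      HasDerivAt τ (Complex.normSq (u s)) s := by
  obtain ⟨α, h1, ε, hε, h2⟩ := (lcX_contDiffAt μ w0 h0).exists_forall_mem_closedBall_exists_eq_forall_mem_Ioo_hasDerivAt₀ 0
  refine ⟨ε, hε, fun s => (α s).1, fun s => (α s).2.1, fun s => (α s).2.2.1, fun s => (α s).2.2.2,
    by simp [h1], by simp [h1], by simp [h1], by simp [h1], fun s hs => ?_⟩
  have h3 := h2 s (by simpa using hs)
  exact ⟨h3.fst, h3.snd.fst, h3.snd.snd.fst, h3.snd.snd.snd⟩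

lemma lc_inv (u w : ℝ → ℂ) (h : ℝ → ℝ) (F : ℂ) (s : ℝ)
    (hu : HasDerivAt u (w s) s)
    (hw : HasDerivAt w ((h s / 2) • u s + (Complex.normSq (u s) / 2) • (conj (u s) * F)) s)
    (hh : HasDerivAt h (2 * (conj F * (u s * w s)).re) s) :
    HasDerivAt (fun s => 2 * Complex.normSq (w s) - h s * Complex.normSq (u s)) 0 s := by
  have key : ∀ (f : ℝ → ℂ) (f' : ℂ), HasDerivAt f f' s →
      HasDerivAt (fun s => Complex.normSq (f s)) (2 * ((f s).re * f'.re + (f s).im * f'.im)) s := by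
    intro f f' hf
    have h1 : HasDerivAt (fun s => (f s).re) f'.re s := Complex.reCLM.hasFDerivAt.comp_hasDerivAt s hf
    have h2 : HasDerivAt (fun s => (f s).im) f'.im s := Complex.imCLM.hasFDerivAt.comp_hasDerivAt s hf
    have := (h1.mul h1).add (h2.mul h2)
    refine (this.congr_deriv (by ring)).congr_of_eventuallyEq ?_
    filter_upwards with x
    simp [Complex.normSq_apply]
  have := ((key w _ hw).const_mul 2).sub (hh.mul (key u _ hu))
  refine this.congr_deriv ?_
  simp [Complex.normSq_apply]
  ring

end RC3

namespace RC3
open Set Filter Topology ComplexConjugate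

lemma lc_pos (w : ℝ → ℂ) (u : ℝ → ℂ) (w0 : ℂ) (hw0 : w0 ≠ 0) (ε : ℝ) (hε : 0 < ε)
    (h0 : u 0 = 0) (h1 : w 0 = w0) (hu : ∀ s ∈ Ioo (-ε) ε, HasDerivAt u (w s) s)
    (hw : ContinuousAt w 0) : ∃ ε' > 0, ε' < ε ∧ ∀ s ∈ Ioo 0 ε', u s ≠ 0 := by
  have hd := hu 0 ⟨by linarith, hε⟩
  have h2 : ∀ᶠ s in 𝓝[≠] (0 : ℝ), u s ≠ 0 := by
    have := hd.eventually_ne (c := 0) (by rw [h1]; exact hw0)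
    simpa [h0] using this
  rw [eventually_nhdsWithin_iff, Metric.eventually_nhds_iff] at h2
  obtain ⟨e, he, h3⟩ := h2
  refine ⟨min e (ε / 2), by positivity, ?_, fun s hs => ?_⟩
  · exact (min_le_right _ _).trans_lt (by linarith)
  · apply h3
    · rw [Real.dist_eq, sub_zero, abs_of_pos hs.1]; exact hs.2.trans_le (min_le_left _ _)
    · exact hs.1.ne'

lemma lc_main (μ : ℝ) (hμ : 0 < μ) (v : ℂ) (hv : v ≠ 0) :
    ∃ t0 > 0, ∃ q p : ℝ → ℂ, (∀ t ∈ Ioc 0 t0, q t ≠ 0 ∧ HasDerivAt q (p t) t ∧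
      HasDerivAt p (- (μ / ‖q t‖ ^ 3) • q t + Fp μ t (q t)) t) ∧
      Tendsto q (𝓝[>] 0) (𝓝 0) ∧
      Tendsto (fun t => ‖p t‖ ^ 2 / 2 - μ / ‖q t‖) (𝓝[>] 0) (𝓝 (‖v‖ ^ 2 / 2)) ∧
      Tendsto (fun t => ‖q t‖⁻¹ • q t) (𝓝[>] 0) (𝓝 (‖v‖⁻¹ • v)) ∧
      Tendsto (fun t => conj (q t) * p t) (𝓝[>] 0) (𝓝 0) := by
  obtain ⟨w0, hw0⟩ := IsAlgClosed.exists_pow_nat_eq ((μ / 2 * ‖v‖⁻¹ : ℝ) • v) two_pos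
  have hvn : 0 < ‖v‖ := norm_pos_iff.2 hv
  have hwn : ‖w0‖ ^ 2 = μ / 2 := by
    rw [← norm_pow, hw0, norm_smul, Real.norm_eq_abs, abs_of_pos (by positivity)]
    field_simp
  have hw0n : w0 ≠ 0 := by
    rintro rfl
    simp at hwn; linarith
  obtain ⟨ε, hε, u, w, h, τ, u0, w0', h0, τ0, hd⟩ := lc_raw μ w0 (‖v‖ ^ 2 / 2)
  have h00 : (0 : ℝ) ∈ Ioo (-ε) ε := ⟨by linarith, hε⟩
  obtain ⟨ε', hε', hlt, hne⟩ := lc_pos w u w0 hw0n ε hε u0 w0' (fun s hs => (hd s hs).1)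
    (hd 0 h00).2.1.continuousAt
  have hsub : ∀ s ∈ Ico 0 ε', s ∈ Ioo (-ε) ε := fun s hs => ⟨by linarith [hs.1], hs.2.trans hlt⟩
  have hinv : ∀ s ∈ Ico 0 ε', 2 * ‖w s‖ ^ 2 - h s * ‖u s‖ ^ 2 = μ := by
    intro s hs
    rcases hs.1.eq_or_lt with rfl | hs0
    · rw [w0', u0, hwn]; simp; ring
    have hcst := constant_of_has_deriv_right_zero (a := 0) (b := s) (f := fun s => 2 * Complex.normSq (w s) - h s * Complex.normSq (u s))
      (fun x hx => (lc_inv u w h _ x (hd x (hsub x ⟨hx.1, hx.2.trans_lt hs.2⟩)).1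
        (hd x (hsub x ⟨hx.1, hx.2.trans_lt hs.2⟩)).2.1
        (hd x (hsub x ⟨hx.1, hx.2.trans_lt hs.2⟩)).2.2.1).continuousAt.continuousWithinAt)
      (fun x hx => (lc_inv u w h _ x (hd x (hsub x ⟨hx.1, hx.2.trans hs.2⟩)).1
        (hd x (hsub x ⟨hx.1, hx.2.trans hs.2⟩)).2.1
        (hd x (hsub x ⟨hx.1, hx.2.trans hs.2⟩)).2.2.1).hasDerivWithinAt) s ⟨hs.1, le_rfl⟩
    simp only [u0, w0', Complex.normSq_eq_norm_sq, hwn] at hcst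
    rw [hcst]; simp; ring
  have hIoo : ∀ s ∈ Ioo 0 ε', s ∈ Ioo (-ε) ε := fun s hs => hsub s ⟨hs.1.le, hs.2⟩
  obtain ⟨θ, hθ⟩ := inv_fun_exists (Ioo 0 ε') isOpen_Ioo ordConnected_Ioo τ
    (fun s => Complex.normSq (u s)) (fun s hs => (hd s (hIoo s hs)).2.2.2)
    (fun s hs => Complex.normSq_pos.2 (hne s hs))
  have hτc : ContinuousOn τ (Ico 0 ε') := fun s hs =>
    (hd s (hsub s hs)).2.2.2.continuousAt.continuousWithinAt
  have hτm : StrictMonoOn τ (Ico 0 ε') := by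
    apply strictMonoOn_of_deriv_pos (convex_Ico _ _) hτc
    intro x hx
    rw [interior_Ico] at hx
    rw [(hd x (hIoo x hx)).2.2.2.deriv]
    exact Complex.normSq_pos.2 (hne x hx)
  have hhalf : ε' / 2 ∈ Ico 0 ε' := ⟨by positivity, by linarith⟩
  have hz : (0 : ℝ) ∈ Ico 0 ε' := ⟨le_rfl, hε'⟩
  have ht0 : 0 < τ (ε' / 2) := by
    rw [← τ0]; exact hτm hz hhalf (by positivity)
  have hex : ∀ t ∈ Ioc 0 (τ (ε' / 2)), ∃ s ∈ Ioo 0 ε', τ s = t := by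
    intro t ht
    obtain ⟨s, hs, rfl⟩ := intermediate_value_Icc (by positivity)
      (hτc.mono (Icc_subset_Ico_right hhalf.2)) (show t ∈ Icc (τ 0) (τ (ε' / 2)) from
        ⟨by rw [τ0]; exact ht.1.le, ht.2⟩)
    refine ⟨s, ⟨?_, by linarith [hs.2]⟩, rfl⟩
    rcases hs.1.eq_or_lt with rfl | h1
    · rw [τ0] at ht; exact absurd ht.1 (lt_irrefl _)
    · exact h1
  have hθ0 : Tendsto θ (𝓝[>] 0) (𝓝[>] 0) := by
    rw [tendsto_nhdsWithin_iff]
    have hev : ∀ η > 0, ∀ᶠ t in 𝓝[>] (0 : ℝ), 0 < θ t ∧ θ t < η := by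
      intro η hη
      have hm : min η (ε' / 2) ∈ Ico 0 ε' := ⟨by positivity, (min_le_right _ _).trans_lt hhalf.2⟩
      have hp : 0 < τ (min η (ε' / 2)) := by
        rw [← τ0]; exact hτm hz hm (by positivity)
      filter_upwards [Ioo_mem_nhdsGT (lt_min hp ht0)] with t ht
      obtain ⟨s, hs, rfl⟩ := hex t ⟨ht.1, (ht.2.trans_le (min_le_right _ _)).le⟩
      rw [(hθ s hs).1]
      refine ⟨hs.1, ?_⟩
      have := (hτm.lt_iff_lt ⟨hs.1.le, hs.2⟩ hm).1 (ht.2.trans_le (min_le_left _ _))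
      exact this.trans_le (min_le_left _ _)
    constructor
    · rw [Metric.tendsto_nhds]
      intro η hη
      filter_upwards [hev η hη] with t ht
      rw [Real.dist_eq, sub_zero, abs_of_pos ht.1]; exact ht.2
    · filter_upwards [hev 1 one_pos] with t ht using ht.1
  have hev : ∀ᶠ t in 𝓝[>] (0 : ℝ), θ t ∈ Ioo 0 ε' := hθ0 (Ioo_mem_nhdsGT hε')
  have cu : Tendsto u (𝓝[>] 0) (𝓝 0) := by
    have := (hd 0 h00).1.continuousAt.tendsto; rw [u0] at this
    exact this.mono_left nhdsWithin_le_nhds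
  have cw : Tendsto w (𝓝[>] 0) (𝓝 w0) := by
    have := (hd 0 h00).2.1.continuousAt.tendsto; rw [w0'] at this
    exact this.mono_left nhdsWithin_le_nhds
  have ch : Tendsto h (𝓝[>] 0) (𝓝 (‖v‖ ^ 2 / 2)) := by
    have := (hd 0 h00).2.2.1.continuousAt.tendsto; rw [h0] at this
    exact this.mono_left nhdsWithin_le_nhds
  refine ⟨τ (ε' / 2), ht0, fun t => u (θ t) ^ 2, fun t => 2 * w (θ t) / conj (u (θ t)), ?_, ?_, ?_,
    ?_, ?_⟩
  · intro t ht
    obtain ⟨s, hs, rfl⟩ := hex t ht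
    obtain ⟨e1, e2, -⟩ := hθ s hs
    obtain ⟨du, dw, dh, dτ⟩ := hd s (hIoo s hs)
    have hus := hne s hs
    have hcs : conj (u s) ≠ 0 := by simpa using hus
    have hi := hinv s ⟨hs.1.le, hs.2⟩
    simp only [e1]
    have dc : HasDerivAt (fun s => conj (u s)) (conj (w s)) s :=
      Complex.conjCLE.hasFDerivAt.comp_hasDerivAt s du
    have dq := (du.pow 2)
    have dp := ((dw.const_mul 2).div dc hcs)
    rw [← e1] at dq dp
    have dq2 := dq.scomp _ e2
    have dp2 := dp.scomp _ e2
    simp only [e1] at dq2 dp2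
    have hns : (Complex.normSq (u s) : ℂ) = u s * conj (u s) := (Complex.mul_conj _).symm
    refine ⟨pow_ne_zero 2 hus, dq2.congr_deriv ?_, dp2.congr_deriv ?_⟩
    · rw [Complex.real_smul, Complex.ofReal_inv, hns]
      field_simp
      norm_num
      ring
    · have hww : 2 * (w s * conj (w s)) = μ + h s * (u s * conj (u s)) := by
        rw [Complex.mul_conj, Complex.mul_conj, Complex.normSq_eq_norm_sq, Complex.normSq_eq_norm_sq]
        have : 2 * ‖w s‖ ^ 2 = μ + h s * ‖u s‖ ^ 2 := by linarith
        exact_mod_cast congrArg Complex.ofReal this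
      have hn6 : ((‖u s ^ 2‖ ^ 3 : ℝ) : ℂ) = (u s * conj (u s)) ^ 3 := by
        rw [Complex.mul_conj, Complex.normSq_eq_norm_sq, norm_pow]
        push_cast; ring
      simp only [Complex.real_smul]
      push_cast at hn6 ⊢
      rw [hn6, hns]
      generalize conj (u s) = U at *
      generalize conj (w s) = W at *
      field_simp
      linear_combination (-1) * hww
  · have := (cu.comp hθ0).pow 2
    simpa using this
  · refine (ch.comp hθ0).congr' ?_
    filter_upwards [hev] with t ht
    have := hinv _ ⟨ht.1.le, ht.2⟩
    have hu : ‖u (θ t)‖ ≠ 0 := by simpa using hne _ ht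
    simp only [Function.comp, norm_div, norm_mul, norm_pow, RCLike.norm_conj, Complex.norm_ofNat]
    field_simp
    linear_combination (-1) * this
  · have hsl : Tendsto (fun s : ℝ => s⁻¹ • u s) (𝓝[>] 0) (𝓝 w0) := by
      have := (hd 0 h00).1
      rw [hasDerivAt_iff_tendsto_slope_zero] at this
      simp only [zero_add, u0, sub_zero, w0'] at this
      exact this.mono_left (nhdsWithin_mono _ (fun x hx => ne_of_gt hx))
    have h1 : Tendsto (fun s : ℝ => (‖s⁻¹ • u s‖ ^ 2)⁻¹ • (s⁻¹ • u s) ^ 2) (𝓝[>] 0)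
        (𝓝 ((‖w0‖ ^ 2)⁻¹ • w0 ^ 2)) :=
      ((hsl.norm.pow 2).inv₀ (by simpa using hw0n)).smul (hsl.pow 2)
    have e : (‖w0‖ ^ 2)⁻¹ • w0 ^ 2 = ‖v‖⁻¹ • v := by
      rw [hwn, hw0, smul_smul]
      congr 1
      field_simp
    rw [e] at h1
    refine (h1.comp hθ0).congr' ?_
    filter_upwards [hev] with t ht
    simp only [Function.comp]
    have h2 := ht.1
    rw [norm_smul, norm_pow, norm_inv, Real.norm_eq_abs, abs_of_pos h2, smul_pow, smul_smul]
    congr 1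
    have hu : ‖u (θ t)‖ ≠ 0 := by simpa using hne _ ht
    field_simp
  · have h1 : Tendsto (fun s : ℝ => 2 * conj (u s) * w s) (𝓝[>] 0) (𝓝 (2 * conj (0 : ℂ) * w0)) :=
      (((Complex.continuous_conj.tendsto _).comp cu).const_mul 2).mul cw
    simp only [map_zero, mul_zero, zero_mul] at h1
    refine (h1.comp hθ0).congr' ?_
    filter_upwards [hev] with t ht
    have hcs : conj (u (θ t)) ≠ 0 := by simpa using hne _ ht
    simp only [Function.comp, map_pow]
    field_simp

end RC3

namespace RC3
open Set Filter Topology ComplexConjugate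

lemma mvt0 {E : Type*} [NormedAddCommGroup E] [NormedSpace ℝ E] (f f' : ℝ → E) (B B' : ℝ → ℝ)
    (a : E) (t1 : ℝ) (hf : ∀ t ∈ Ioc 0 t1, HasDerivAt f (f' t) t)
    (hB : ∀ t ∈ Ioc 0 t1, HasDerivAt B (B' t) t) (hb : ∀ t ∈ Ioc 0 t1, ‖f' t‖ ≤ B' t)
    (hl : Tendsto f (𝓝[>] 0) (𝓝 a)) (hB0 : ∀ t ∈ Ioc 0 t1, 0 ≤ B t) :
    ∀ t ∈ Ioc 0 t1, ‖f t - a‖ ≤ B t := by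
  intro t ht
  have h1 : ∀ s ∈ Ioo 0 t, ‖f t - f s‖ ≤ B t := by
    intro s hs
    have hsub : ∀ x ∈ Icc s t, x ∈ Ioc 0 t1 := fun x hx => ⟨hs.1.trans_le hx.1, hx.2.trans ht.2⟩
    have := image_norm_le_of_norm_deriv_right_le_deriv_boundary' (f := fun x => f x - f s) (f' := f')
      (B := fun x => B x - B s) (B' := B') (a := s) (b := t)
      (fun x hx => ((hf x (hsub x hx)).continuousAt.sub continuousAt_const).continuousWithinAt)
      (fun x hx => ((hf x (hsub x ⟨hx.1, hx.2.le⟩)).sub_const _).hasDerivWithinAt) (by simp)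
      (fun x hx => ((hB x (hsub x hx)).continuousAt.sub continuousAt_const).continuousWithinAt)
      (fun x hx => ((hB x (hsub x ⟨hx.1, hx.2.le⟩)).sub_const _).hasDerivWithinAt)
      (fun x hx => hb x (hsub x ⟨hx.1, hx.2.le⟩)) (x := t) ⟨hs.2.le, le_rfl⟩
    have h3 := hB0 s (hsub s ⟨le_rfl, hs.2.le⟩)
    linarith
  have h2 : Tendsto (fun s => ‖f t - f s‖) (𝓝[>] 0) (𝓝 ‖f t - a‖) := (tendsto_const_nhds.sub hl).norm
  apply le_of_tendsto h2
  filter_upwards [Ioo_mem_nhdsGT ht.1] with s hs using h1 s hs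

lemma mvt_low (f f' B B' : ℝ → ℝ) (a b : ℝ) (t1 : ℝ) (hf : ∀ t ∈ Ioc 0 t1, HasDerivAt f (f' t) t)
    (hB : ∀ t ∈ Ioc 0 t1, HasDerivAt B (B' t) t) (hb : ∀ t ∈ Ioc 0 t1, B' t ≤ f' t)
    (hl : Tendsto f (𝓝[>] 0) (𝓝 a)) (hB0 : Tendsto B (𝓝[>] 0) (𝓝 b)) :
    ∀ t ∈ Ioc 0 t1, a - b + B t ≤ f t := by
  intro t ht
  have h1 : ∀ s ∈ Ioo 0 t, f s - B s ≤ f t - B t := by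
    intro s hs
    have hsub : ∀ x ∈ Icc s t, x ∈ Ioc 0 t1 := fun x hx => ⟨hs.1.trans_le hx.1, hx.2.trans ht.2⟩
    have hm : MonotoneOn (fun x => f x - B x) (Icc s t) := by
      apply monotoneOn_of_deriv_nonneg (convex_Icc _ _)
      · exact fun x hx => ((hf x (hsub x hx)).continuousAt.sub
          (hB x (hsub x hx)).continuousAt).continuousWithinAt
      · exact fun x hx => ((hf x (hsub x (interior_subset hx))).sub
          (hB x (hsub x (interior_subset hx)))).differentiableAt.differentiableWithinAt
      · intro x hx
        have hx' := hsub x (interior_subset hx)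
        have := ((hf x hx').sub (hB x hx')).deriv
        have e : deriv (fun x => f x - B x) x = f' x - B' x := this
        rw [e]; linarith [hb x hx']
    exact hm ⟨le_rfl, hs.2.le⟩ ⟨hs.2.le, le_rfl⟩ hs.2.le
  have h2 := hl.sub hB0
  have : a - b ≤ f t - B t := by
    apply le_of_tendsto h2
    filter_upwards [Ioo_mem_nhdsGT ht.1] with s hs using h1 s hs
  linarith

/-- cross product -/
def cr (a b : ℂ) : ℝ := a.re * b.im - a.im * b.re

lemma sg_cr (a b : ℂ) : sg a b ^ 2 + cr a b ^ 2 = ‖a‖ ^ 2 * ‖b‖ ^ 2 := by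
  rw [nsq, nsq, sg, cr]; ring

lemma sg_le (a b : ℂ) : |sg a b| ≤ ‖a‖ * ‖b‖ := by
  apply abs_le_of_sq_le_sq _ (by positivity)
  rw [mul_pow, ← sg_cr]; nlinarith [sq_nonneg (cr a b)]

lemma cr_le (a b : ℂ) : |cr a b| ≤ ‖a‖ * ‖b‖ := by
  apply abs_le_of_sq_le_sq _ (by positivity)
  rw [mul_pow, ← sg_cr]; nlinarith [sq_nonneg (sg a b)]

lemma re_deriv {f : ℝ → ℂ} {f' : ℂ} {t : ℝ} (h : HasDerivAt f f' t) :
    HasDerivAt (fun s => (f s).re) f'.re t := Complex.reCLM.hasFDerivAt.comp_hasDerivAt t h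

lemma im_deriv {f : ℝ → ℂ} {f' : ℂ} {t : ℝ} (h : HasDerivAt f f' t) :
    HasDerivAt (fun s => (f s).im) f'.im t := Complex.imCLM.hasFDerivAt.comp_hasDerivAt t h

lemma sg_deriv {f g : ℝ → ℂ} {f' g' : ℂ} {t : ℝ} (hf : HasDerivAt f f' t) (hg : HasDerivAt g g' t) :
    HasDerivAt (fun s => sg (f s) (g s)) (sg f' (g t) + sg (f t) g') t := by
  have := ((re_deriv hf).mul (re_deriv hg)).add ((im_deriv hf).mul (im_deriv hg))
  refine this.congr_deriv ?_
  simp only [sg]; ring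

lemma cr_deriv {f g : ℝ → ℂ} {f' g' : ℂ} {t : ℝ} (hf : HasDerivAt f f' t) (hg : HasDerivAt g g' t) :
    HasDerivAt (fun s => cr (f s) (g s)) (cr f' (g t) + cr (f t) g') t := by
  have := ((re_deriv hf).mul (im_deriv hg)).sub ((im_deriv hf).mul (re_deriv hg))
  refine this.congr_deriv ?_
  simp only [cr]; ring

lemma normsq_deriv {f : ℝ → ℂ} {f' : ℂ} {t : ℝ} (hf : HasDerivAt f f' t) :
    HasDerivAt (fun s => ‖f s‖ ^ 2) (2 * sg (f t) f') t := by
  have := sg_deriv hf hf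
  refine (this.congr_deriv ?_).congr_of_eventuallyEq ?_
  · simp only [sg]; ring
  · filter_upwards with s
    rw [nsq]; simp only [sg]; ring

lemma norm_deriv {f : ℝ → ℂ} {f' : ℂ} {t : ℝ} (hf : HasDerivAt f f' t) (h0 : f t ≠ 0) :
    HasDerivAt (fun s => ‖f s‖) (sg (f t) f' / ‖f t‖) t := by
  have h1 : ‖f t‖ ≠ 0 := by simpa using h0
  have := (normsq_deriv hf).sqrt (by positivity)
  refine (this.congr_deriv ?_).congr_of_eventuallyEq ?_
  · rw [Real.sqrt_sq (norm_nonneg _)]; field_simp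
  · filter_upwards with s
    rw [Real.sqrt_sq (norm_nonneg _)]

lemma smul_sg (a b : ℂ) (c : ℝ) : sg a (c • b) = c * sg a b := by simp [sg]; ring
lemma sg_add' (a b c : ℂ) : sg a (b + c) = sg a b + sg a c := by simp [sg]; ring
lemma sg_self (a : ℂ) : sg a a = ‖a‖ ^ 2 := by rw [nsq, sg]; ring
lemma sg_comm (a b : ℂ) : sg a b = sg b a := by simp only [sg]; ring

end RC3

namespace RC3
open Set Filter Topology ComplexConjugate

lemma conj_mul_re (a b : ℂ) : (conj a * b).re = sg a b := by simp [sg]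
lemma conj_mul_im (a b : ℂ) : (conj a * b).im = cr a b := by simp [cr]; ring

lemma cr_add' (a b c : ℂ) : cr a (b + c) = cr a b + cr a c := by simp [cr]; ring
lemma cr_smul (a b : ℂ) (c : ℝ) : cr a (c • b) = c * cr a b := by simp [cr]; ring
lemma cr_self (a : ℂ) : cr a a = 0 := by simp [cr]; ring
lemma n_ident (a b : ℂ) (c : ℝ) : ((a.re ^ 2 + a.im ^ 2) * c) • b + (- sg a b * c) • a =
    (cr a b * c) • (Complex.I * a) := by
  apply Complex.ext
  · simp only [Complex.add_re, Complex.smul_re, smul_eq_mul, Complex.mul_re, Complex.I_re, Complex.I_im, sg, cr]; ring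
  · simp only [Complex.add_im, Complex.smul_im, smul_eq_mul, Complex.mul_im, Complex.I_re, Complex.I_im, sg, cr]; ring
lemma mu_div_sqrt (μ t : ℝ) (hμ : 0 < μ) (ht : 0 < t) :
    t * (μ / Real.sqrt (μ * t) / 2) = Real.sqrt (μ * t) / 2 := by
  have h : Real.sqrt (μ * t) * Real.sqrt (μ * t) = μ * t := Real.mul_self_sqrt (by positivity)
  have hs : 0 < Real.sqrt (μ * t) := by positivity
  generalize Real.sqrt (μ * t) = y at *
  field_simp
  linarith

lemma sqrt_mul_deriv (μ t : ℝ) (hμ : 0 < μ) (ht : 0 < t) :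
    HasDerivAt (fun t => Real.sqrt (μ * t)) (μ / Real.sqrt (μ * t) / 2) t := by
  have h1 : HasDerivAt (fun t => μ * t) μ t := by simpa using (hasDerivAt_id t).const_mul μ
  refine (h1.sqrt (by positivity)).congr_deriv ?_
  field_simp

structure LocHyp (μ : ℝ) (v : ℂ) (q p F : ℝ → ℂ) (t1 : ℝ) : Prop where
  hμ : 0 < μ
  hμ1 : μ ≤ 1
  ht1 : t1 ≤ 1
  v1 : 7 / 10 ≤ ‖v‖ ^ 2
  v2 : ‖v‖ ^ 2 ≤ 9 / 10
  ne : ∀ t ∈ Ioc 0 t1, q t ≠ 0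
  dq : ∀ t ∈ Ioc 0 t1, HasDerivAt q (p t) t
  dp : ∀ t ∈ Ioc 0 t1, HasDerivAt p (- (μ / ‖q t‖ ^ 3) • q t + F t) t
  hF : ∀ t ∈ Ioc 0 t1, ‖F t‖ ≤ 3
  lq : Tendsto q (𝓝[>] 0) (𝓝 0)
  lh : Tendsto (fun t => ‖p t‖ ^ 2 / 2 - μ / ‖q t‖) (𝓝[>] 0) (𝓝 (‖v‖ ^ 2 / 2))
  ln : Tendsto (fun t => ‖q t‖⁻¹ • q t) (𝓝[>] 0) (𝓝 (‖v‖⁻¹ • v))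
  lS : Tendsto (fun t => conj (q t) * p t) (𝓝[>] 0) (𝓝 0)
  bq : ∀ t ∈ Ioc 0 t1, ‖q t‖ ≤ 1 / 30
  bh : ∀ t ∈ Ioc 0 t1, |‖p t‖ ^ 2 / 2 - μ / ‖q t‖ - ‖v‖ ^ 2 / 2| ≤ 15 / 100

variable {μ : ℝ} {v : ℂ} {q p F : ℝ → ℂ} {t1 : ℝ}

lemma LocHyp.low (H : LocHyp μ v q p F t1) : ∀ t ∈ Ioc 0 t1,
    3 / 10 * t ≤ sg (q t) (p t) ∧ 3 / 10 * t ^ 2 ≤ ‖q t‖ ^ 2 ∧ t / 2 ≤ ‖q t‖ := by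
  have hS0 : Tendsto (fun t => sg (q t) (p t)) (𝓝[>] 0) (𝓝 0) := by
    have := (Complex.continuous_re.tendsto _).comp H.lS
    simp only [Function.comp_def, conj_mul_re, Complex.zero_re] at this
    exact this
  have h1 := mvt_low (fun t => sg (q t) (p t)) _ (fun t => 3 / 10 * t) (fun _ => 3 / 10) 0 0 t1
    (fun t ht => sg_deriv (H.dq t ht) (H.dp t ht))
    (fun t _ => by simpa using (hasDerivAt_id t).const_mul (3 / 10 : ℝ))
    (fun t ht => by
      have hr : 0 < ‖q t‖ := norm_pos_iff.2 (H.ne t ht)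
      have hh := (abs_le.1 (H.bh t ht)).1
      have e : sg (p t) (p t) + sg (q t) (- (μ / ‖q t‖ ^ 3) • q t + F t) =
          ‖p t‖ ^ 2 - μ / ‖q t‖ + sg (q t) (F t) := by
        rw [sg_add', smul_sg, sg_self, sg_self]; field_simp; ring
      have h2 := (abs_le.1 (sg_le (q t) (F t))).1
      have h3 : ‖q t‖ * ‖F t‖ ≤ 1 / 30 * 3 := by
        have := H.bq t ht; have := H.hF t ht; gcongr
      have h4 : 0 < μ / ‖q t‖ := by have := H.hμ; positivity
      have h5 := H.v1
      rw [e]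
      linarith)
    hS0 (by
      have : Tendsto (fun t : ℝ => 3 / 10 * t) (𝓝 0) (𝓝 (3 / 10 * 0)) := by
        apply Continuous.tendsto; fun_prop
      rw [mul_zero] at this
      exact this.mono_left nhdsWithin_le_nhds)
  have hq0 : Tendsto (fun t => ‖q t‖ ^ 2) (𝓝[>] 0) (𝓝 0) := by
    simpa using H.lq.norm.pow 2
  have h2 := mvt_low (fun t => ‖q t‖ ^ 2) _ (fun t => 3 / 10 * t ^ 2) (fun t => 3 / 10 * (2 * t)) 0 0 t1
    (fun t ht => normsq_deriv (H.dq t ht))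
    (fun t _ => by simpa using (hasDerivAt_pow 2 t).const_mul (3 / 10 : ℝ))
    (fun t ht => by
      have := h1 t ht
      linarith) hq0 (by
      have : Tendsto (fun t : ℝ => 3 / 10 * t ^ 2) (𝓝 0) (𝓝 (3 / 10 * 0 ^ 2)) := by
        apply Continuous.tendsto; fun_prop
      norm_num at this
      exact this.mono_left nhdsWithin_le_nhds)
  intro t ht
  have a1 := h1 t ht
  have a2 := h2 t ht
  simp only [sub_self, zero_add] at a1 a2
  refine ⟨a1, a2, ?_⟩
  have := ht.1
  refine (abs_le_of_sq_le_sq' ?_ (norm_nonneg _)).2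
  nlinarith

lemma LocHyp.hp (H : LocHyp μ v q p F t1) : ∀ t ∈ Ioc 0 t1,
    ‖p t‖ ≤ 11 / 10 + 2 * (μ / Real.sqrt (μ * t)) := by
  intro t ht
  have hμ := H.hμ
  have ht0 := ht.1
  have hr := (H.low t ht).2.2
  have hh := (abs_le.1 (H.bh t ht)).2
  have hv := H.v2
  have hr0 : 0 < ‖q t‖ := by linarith
  have h1 : μ / ‖q t‖ ≤ 2 * (μ / t) := by
    rw [div_le_iff₀ hr0]
    have : 2 * (μ / t) * (t / 2) = μ := by field_simp
    calc μ = 2 * (μ / t) * (t / 2) := this.symm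
      _ ≤ _ := by gcongr
  have h2 : (μ / Real.sqrt (μ * t)) ^ 2 = μ / t := by
    rw [div_pow, Real.sq_sqrt (by positivity)]; field_simp
  have h3 : 0 ≤ μ / Real.sqrt (μ * t) := by positivity
  apply abs_le_of_sq_le_sq' _ (by positivity) |>.2
  nlinarith

lemma sqrt_le' (μ t : ℝ) (hμ : 0 < μ) (ht : 0 < t) : Real.sqrt (μ * t) ≤ (μ + t) / 2 := by
  rw [Real.sqrt_le_left (by positivity)]
  nlinarith [sq_nonneg (μ - t)]

lemma LocHyp.hi (H : LocHyp μ v q p F t1) : ∀ t ∈ Ioc 0 t1,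
    ‖q t‖ ≤ 11 / 10 * t + 4 * Real.sqrt (μ * t) := by
  have := mvt0 q p (fun t => 11 / 10 * t + 4 * Real.sqrt (μ * t))
    (fun t => 11 / 10 + 4 * (μ / Real.sqrt (μ * t) / 2)) 0 t1 H.dq
    (fun t ht => by
      have h1 : HasDerivAt (fun t : ℝ => 11 / 10 * t) (11 / 10) t := by
        simpa using (hasDerivAt_id t).const_mul (11 / 10 : ℝ)
      exact h1.add ((sqrt_mul_deriv μ t H.hμ ht.1).const_mul 4))
    (fun t ht => by have := H.hp t ht; linarith) H.lq
    (fun t ht => by have := ht.1; positivity)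
  simpa using this

lemma LocHyp.hh (H : LocHyp μ v q p F t1) : ∀ t ∈ Ioc 0 t1,
    |‖p t‖ ^ 2 / 2 - μ / ‖q t‖ - ‖v‖ ^ 2 / 2| ≤ 33 / 10 * t + 12 * Real.sqrt (μ * t) := by
  have := mvt0 (fun t => ‖p t‖ ^ 2 / 2 - μ / ‖q t‖) (fun t => sg (p t) (F t))
    (fun t => 33 / 10 * t + 12 * Real.sqrt (μ * t))
    (fun t => 33 / 10 + 12 * (μ / Real.sqrt (μ * t) / 2)) (‖v‖ ^ 2 / 2) t1
    (fun t ht => by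
      have hr : 0 < ‖q t‖ := norm_pos_iff.2 (H.ne t ht)
      have h1 := (normsq_deriv (H.dp t ht)).div_const 2
      have h2 := ((norm_deriv (H.dq t ht) (H.ne t ht)).inv hr.ne').const_mul μ
      have h3 := h1.sub h2
      refine (h3.congr_deriv ?_).congr_of_eventuallyEq ?_
      · rw [sg_add', smul_sg, sg_comm (p t) (q t)]; field_simp; ring
      · filter_upwards with s; simp [div_eq_mul_inv])
    (fun t ht => by
      have h1 : HasDerivAt (fun t : ℝ => 33 / 10 * t) (33 / 10) t := by
        simpa using (hasDerivAt_id t).const_mul (33 / 10 : ℝ)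
      exact h1.add ((sqrt_mul_deriv μ t H.hμ ht.1).const_mul 12))
    (fun t ht => by
      have h1 := H.hp t ht
      have h2 := H.hF t ht
      have h3 := sg_le (p t) (F t)
      rw [Real.norm_eq_abs]
      nlinarith [norm_nonneg (p t), norm_nonneg (F t)]) H.lh
    (fun t ht => by have := ht.1; positivity)
  simpa only [Real.norm_eq_abs] using this

lemma LocHyp.hl (H : LocHyp μ v q p F t1) : ∀ t ∈ Ioc 0 t1,
    |cr (q t) (p t)| ≤ 2 * t ^ 2 + 8 * (t * Real.sqrt (μ * t)) := by
  have hl0 : Tendsto (fun t => cr (q t) (p t)) (𝓝[>] 0) (𝓝 0) := by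
    have := (Complex.continuous_im.tendsto _).comp H.lS
    simp only [Function.comp_def, conj_mul_im, Complex.zero_im] at this
    exact this
  have := mvt0 (fun t => cr (q t) (p t)) (fun t => cr (q t) (F t))
    (fun t => 2 * t ^ 2 + 8 * (t * Real.sqrt (μ * t)))
    (fun t => 2 * (2 * t) + 8 * (1 * Real.sqrt (μ * t) + t * (μ / Real.sqrt (μ * t) / 2))) 0 t1
    (fun t ht => by
      refine (cr_deriv (H.dq t ht) (H.dp t ht)).congr_deriv ?_
      rw [cr_add', cr_smul, cr_self, cr_self]; ring)
    (fun t ht => by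
      have h1 : HasDerivAt (fun t : ℝ => 2 * t ^ 2) (2 * (2 * t)) t := by
        simpa using (hasDerivAt_pow 2 t).const_mul (2 : ℝ)
      exact h1.add (((hasDerivAt_id t).mul (sqrt_mul_deriv μ t H.hμ ht.1)).const_mul 8))
    (fun t ht => by
      have h1 := H.hi t ht
      have h2 := H.hF t ht
      have h3 := cr_le (q t) (F t)
      have hμ := H.hμ
      have ht0 := ht.1
      have hs : 0 < Real.sqrt (μ * t) := by positivity
      have h4 : t * (μ / Real.sqrt (μ * t) / 2) = Real.sqrt (μ * t) / 2 := by
        exact mu_div_sqrt μ t hμ ht0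
      rw [Real.norm_eq_abs, h4]
      nlinarith [norm_nonneg (q t), norm_nonneg (F t)]) hl0
    (fun t ht => by have := ht.1; positivity)
  simpa using this

lemma LocHyp.hn (H : LocHyp μ v q p F t1) : ∀ t ∈ Ioc 0 t1,
    ‖‖q t‖⁻¹ • q t - ‖v‖⁻¹ • v‖ ≤ 7 * t + 54 * Real.sqrt (μ * t) := by
  exact mvt0 (fun t => ‖q t‖⁻¹ • q t) (fun t => (cr (q t) (p t) / ‖q t‖ ^ 3) • (Complex.I * q t))
    (fun t => 7 * t + 54 * Real.sqrt (μ * t))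
    (fun t => 7 + 54 * (μ / Real.sqrt (μ * t) / 2)) (‖v‖⁻¹ • v) t1
    (fun t ht => by
      have hr : 0 < ‖q t‖ := norm_pos_iff.2 (H.ne t ht)
      have h2 := ((norm_deriv (H.dq t ht) (H.ne t ht)).inv hr.ne').smul (H.dq t ht)
      refine h2.congr_deriv ?_
      have hsq := nsq (q t)
      have e : ‖q t‖⁻¹ = ((q t).re ^ 2 + (q t).im ^ 2) * (‖q t‖ ^ 3)⁻¹ := by rw [← hsq]; field_simp
      have e2 : -(sg (q t) (p t) / ‖q t‖) / ‖q t‖ ^ 2 = - sg (q t) (p t) * (‖q t‖ ^ 3)⁻¹ := by field_simp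
      simp only [Pi.inv_apply]
      rw [e2, e, div_eq_mul_inv, ← n_ident])
    (fun t ht => by
      have h1 : HasDerivAt (fun t : ℝ => 7 * t) 7 t := by
        simpa using (hasDerivAt_id t).const_mul (7 : ℝ)
      exact h1.add ((sqrt_mul_deriv μ t H.hμ ht.1).const_mul 54))
    (fun t ht => by
      have hr : 0 < ‖q t‖ := norm_pos_iff.2 (H.ne t ht)
      have h1 := H.hl t ht
      have h2 := (H.low t ht).2.1
      have hμ := H.hμ
      have ht0 := ht.1
      have hs : 0 < Real.sqrt (μ * t) := by positivity
      have h4 : μ / Real.sqrt (μ * t) / 2 * t = Real.sqrt (μ * t) / 2 := by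
        rw [mul_comm]; exact mu_div_sqrt μ t hμ ht0
      have e : ‖(cr (q t) (p t) / ‖q t‖ ^ 3) • (Complex.I * q t)‖ = |cr (q t) (p t)| / ‖q t‖ ^ 2 := by
        rw [norm_smul, norm_mul, Complex.norm_I, norm_div, Real.norm_eq_abs, norm_pow, norm_norm]
        field_simp
      rw [e, div_le_iff₀ (by positivity)]
      refine h1.trans ?_
      set y := μ / Real.sqrt (μ * t) / 2
      have hy : 0 < y := by positivity
      calc 2 * t ^ 2 + 8 * (t * Real.sqrt (μ * t)) = (2 + 16 * y) * t ^ 2 := by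
            linear_combination (-16 * t) * h4
        _ ≤ (7 + 54 * y) * (3 / 10 * t ^ 2) := by
            have : 0 ≤ y * t ^ 2 := by positivity
            nlinarith [sq_nonneg t]
        _ ≤ _ := by gcongr) H.ln
    (fun t ht => by have := ht.1; positivity)

lemma LocHyp.hv (H : LocHyp μ v q p F t1) : ∀ t ∈ Ioc 0 t1, t + μ / t ≤ 1 →
    ‖p t - v‖ ≤ 300 * (t + μ / t) := by
  intro t ht ha
  have hμ := H.hμ
  have ht0 := ht.1
  have ht1 : t ≤ 1 := ht.2.trans H.ht1
  have hs := sqrt_le' μ t hμ ht0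
  have hm : μ ≤ μ / t := by
    rw [le_div_iff₀ ht0]; nlinarith
  have hm0 : 0 < μ / t := by positivity
  have hs0 : 0 ≤ Real.sqrt (μ * t) := Real.sqrt_nonneg _
  obtain ⟨b1, -, b3⟩ := H.low t ht
  have b4 := H.hh t ht
  have b5 := H.hl t ht
  have b6 := H.hn t ht
  have hr : 0 < ‖q t‖ := by linarith
  have hv1 := H.v1
  have hv2 := H.v2
  set a := t + μ / t with hadef
  set r := ‖q t‖ with hrdef
  set s := Real.sqrt (μ * t) with hsdef
  have hsa : s ≤ a / 2 := by linarith
  have hta : t ≤ a := by linarith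
  have ha0 : 0 < a := by positivity
  -- reciprocal bound
  have c1 : μ / r ≤ 2 * (μ / t) := by
    rw [div_le_iff₀ hr]
    have : 2 * (μ / t) * (t / 2) = μ := by field_simp
    calc μ = 2 * (μ / t) * (t / 2) := this.symm
      _ ≤ _ := by gcongr
  have c1' : 0 < μ / r := by positivity
  have c2 : |cr (q t) (p t) / r| ≤ 12 * a := by
    rw [abs_div, abs_of_pos hr, div_le_iff₀ hr]
    have : 12 * a * (t / 2) ≤ 12 * a * r := by gcongr
    have : t * s ≤ t * (a / 2) := by gcongr
    nlinarith
  have c3 : (cr (q t) (p t) / r) ^ 2 ≤ 144 * a := by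
    rw [← sq_abs]
    have := pow_le_pow_left₀ (abs_nonneg _) c2 2
    nlinarith
  have c4 : (sg (q t) (p t) / r) ^ 2 = ‖p t‖ ^ 2 - (cr (q t) (p t) / r) ^ 2 := by
    have := sg_cr (q t) (p t)
    rw [div_pow, div_pow]
    field_simp
    linarith
  have c5 : 0 < sg (q t) (p t) / r := by
    have : 0 < sg (q t) (p t) := by linarith
    positivity
  have hvn : 8 / 10 ≤ ‖v‖ := by
    refine (abs_le_of_sq_le_sq' ?_ (norm_nonneg _)).2
    linarith
  have hvn2 : ‖v‖ ≤ 1 := by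
    refine (abs_le_of_sq_le_sq' ?_ zero_le_one).2
    linarith
  have c6 : |sg (q t) (p t) / r - ‖v‖| ≤ 210 * a := by
    have h1 : |(sg (q t) (p t) / r) ^ 2 - ‖v‖ ^ 2| ≤ 167 * a := by
      rw [c4, abs_le]
      have := abs_le.1 b4
      have := sq_nonneg (cr (q t) (p t) / r)
      constructor <;> linarith
    have h2 : (sg (q t) (p t) / r) ^ 2 - ‖v‖ ^ 2 =
      (sg (q t) (p t) / r - ‖v‖) * (sg (q t) (p t) / r + ‖v‖) := by ring
    rw [h2, abs_mul, abs_of_pos (by linarith : 0 < sg (q t) (p t) / r + ‖v‖)] at h1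
    nlinarith [abs_nonneg (sg (q t) (p t) / r - ‖v‖)]
  have e : p t - v = (sg (q t) (p t) / r - ‖v‖) • (r⁻¹ • q t) +
      (cr (q t) (p t) / r) • (Complex.I * (r⁻¹ • q t)) + ‖v‖ • (r⁻¹ • q t - ‖v‖⁻¹ • v) := by
    have hsq := nsq (q t)
    have hv0 : ‖v‖ ≠ 0 := by linarith
    have e1 : p t = (sg (q t) (p t) / r) • (r⁻¹ • q t) + (cr (q t) (p t) / r) • (Complex.I * (r⁻¹ • q t)) := by
      have : p t = (((q t).re ^ 2 + (q t).im ^ 2) * (r ^ 2)⁻¹) • p t := by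
        rw [← hsq, ← hrdef, mul_inv_cancel₀ (by positivity), one_smul]
      rw [eq_sub_of_add_eq (n_ident (q t) (p t) (r ^ 2)⁻¹)] at this
      have f1 : cr (q t) (p t) * (r ^ 2)⁻¹ = cr (q t) (p t) / r * r⁻¹ := by field_simp
      have f2 : - sg (q t) (p t) * (r ^ 2)⁻¹ = - (sg (q t) (p t) / r * r⁻¹) := by field_simp
      simp only [mul_smul_comm, smul_smul]
      rw [f1, f2, neg_smul] at this
      refine this.trans ?_
      abel
    have e2 : ‖v‖ • (‖v‖⁻¹ • v) = v := by rw [smul_smul, mul_inv_cancel₀ hv0, one_smul]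
    rw [smul_sub, e2, sub_smul]
    nth_rewrite 1 [e1]
    abel
  have hn1 : ‖r⁻¹ • q t‖ = 1 := by
    rw [norm_smul, norm_inv, Real.norm_eq_abs, abs_of_pos hr, ← hrdef, inv_mul_cancel₀ hr.ne']
  rw [e]
  refine (norm_add₃_le).trans ?_
  rw [norm_smul _ (r⁻¹ • q t), norm_smul _ (Complex.I * _), norm_smul ‖v‖, norm_mul, Complex.norm_I, hn1, Real.norm_eq_abs,
    Real.norm_eq_abs, norm_norm]
  have : ‖v‖ * ‖r⁻¹ • q t - ‖v‖⁻¹ • v‖ ≤ 1 * (7 * t + 54 * s) := by gcongr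
  linarith

end RC3

namespace RC3
open Set Filter Topology ComplexConjugate

noncomputable def c1 (R x : ℝ) : ℝ := max (-R) (min R x)
noncomputable def clp (R : ℝ) (w : ℂ) : ℂ := ⟨c1 R w.re, c1 R w.im⟩

lemma c1_lip (R x y : ℝ) : |c1 R x - c1 R y| ≤ |x - y| := by
  unfold c1
  rw [max_comm (-R) _, max_comm (-R) _]
  refine (abs_max_sub_max_le_abs (min R x) (min R y) (-R)).trans ?_
  rw [min_comm R x, min_comm R y]
  exact (abs_min_sub_min_le_max x R y R).trans (by simp)

lemma c1_bd (R x : ℝ) (hR : 0 ≤ R) : |c1 R x| ≤ R := by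
  unfold c1
  rw [abs_le]
  exact ⟨le_max_left _ _, max_le (by linarith) (min_le_left _ _)⟩

lemma c1_id (R x : ℝ) (h : |x| ≤ R) : c1 R x = x := by
  rw [abs_le] at h
  unfold c1
  rw [min_eq_right h.2, max_eq_right h.1]

lemma clp_lip (R : ℝ) (a b : ℂ) : ‖clp R a - clp R b‖ ≤ 2 * ‖a - b‖ := by
  refine (Complex.norm_le_abs_re_add_abs_im _).trans ?_
  have h1 := c1_lip R a.re b.re
  have h2 := c1_lip R a.im b.im
  have h3 := Complex.abs_re_le_norm (a - b)
  have h4 := Complex.abs_im_le_norm (a - b)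
  simp only [clp, Complex.sub_re, Complex.sub_im] at *
  linarith

lemma clp_bd (R : ℝ) (hR : 0 ≤ R) (a : ℂ) : ‖clp R a‖ ≤ 2 * R := by
  refine (Complex.norm_le_abs_re_add_abs_im _).trans ?_
  have h1 := c1_bd R a.re hR
  have h2 := c1_bd R a.im hR
  simp only [clp]
  linarith

lemma clp_id (R : ℝ) (a : ℂ) (h : ‖a‖ ≤ R) : clp R a = a := by
  unfold clp
  rw [c1_id R _ ((Complex.abs_re_le_norm a).trans h), c1_id R _ ((Complex.abs_im_le_norm a).trans h)]

noncomputable def Acc (μ rm t : ℝ) (Z : ℂ) : ℂ :=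
  -((1 - μ) • gs (1 / 10) Z) - μ • gs rm (Z - Jt t) - μ • Jt t

lemma acc_eq (μ rm t : ℝ) (Z : ℂ) (h1 : 1 / 10 ≤ ‖Z‖) (h2 : rm ≤ ‖Z - Jt t‖) :
    Acc μ rm t Z = -(μ / ‖Z - Jt t‖ ^ 3) • (Z - Jt t) + Fp μ t (Z - Jt t) - Jt t := by
  rw [Acc, gs_eq _ _ h1, gs_eq _ _ h2, Fp, sub_add_cancel, div_eq_mul_inv]
  generalize (‖Z - Jt t‖ ^ 3)⁻¹ = a
  generalize (‖Z‖ ^ 3)⁻¹ = b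
  module

lemma cl_exists (μ rm R t0 T : ℝ) (h0 : 0 < μ) (h1 : μ < 1) (hr : 0 < rm) (hR : 0 < R) (hT : t0 ≤ T)
    (x0 : ℂ × ℂ) : ∃ α : ℝ → ℂ × ℂ, α t0 = x0 ∧
      ∀ t ∈ Icc t0 T, HasDerivAt α (clp R (α t).2, Acc μ rm t (α t).1) t := by
  have hr3 : 0 < (rm ^ 3)⁻¹ := by positivity
  have hr2 : 0 < (rm ^ 2)⁻¹ := by positivity
  have hJ := Jt_contDiff.continuous
  refine ode_exists (fun t z => (clp R z.2, Acc μ rm t z.1)) (4002 + 4 * Real.toNNReal (rm ^ 3)⁻¹)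
    (Real.toNNReal (2 * R + 101 + (rm ^ 2)⁻¹)) ?_ ?_ ?_ t0 T hT x0
  · intro t
    apply LipschitzWith.of_dist_le_mul
    intro z w
    have e : ((4002 + 4 * Real.toNNReal (rm ^ 3)⁻¹ : NNReal) : ℝ) = 4002 + 4 * (rm ^ 3)⁻¹ := by
      push_cast; rw [Real.coe_toNNReal _ hr3.le]
    rw [dist_eq_norm, dist_eq_norm, Prod.norm_def, e]
    have h3 : ‖z.1 - w.1‖ ≤ ‖z - w‖ := norm_fst_le (z - w)
    have h4 : ‖z.2 - w.2‖ ≤ ‖z - w‖ := norm_snd_le (z - w)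
    have h5 := norm_nonneg (z - w)
    apply max_le
    · simp only [Prod.fst_sub]
      have := clp_lip R z.2 w.2
      have : 0 ≤ (rm ^ 3)⁻¹ * ‖z - w‖ := by positivity
      linarith
    · simp only [Prod.snd_sub, Acc]
      have e2 : -((1 - μ) • gs (1 / 10) z.1) - μ • gs rm (z.1 - Jt t) - μ • Jt t -
          (-((1 - μ) • gs (1 / 10) w.1) - μ • gs rm (w.1 - Jt t) - μ • Jt t) =
          -((1 - μ) • (gs (1 / 10) z.1 - gs (1 / 10) w.1)) -
            μ • (gs rm (z.1 - Jt t) - gs rm (w.1 - Jt t)) := by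
        rw [smul_sub, smul_sub]; abel
      rw [e2]
      refine (norm_sub_le _ _).trans ?_
      rw [norm_neg, norm_smul, norm_smul, Real.norm_eq_abs, Real.norm_eq_abs, abs_of_pos h0,
        abs_of_pos (by linarith : 0 < 1 - μ)]
      have h6 := gs_lip (1 / 10) (by norm_num) z.1 w.1
      have h7 := gs_lip rm hr (z.1 - Jt t) (w.1 - Jt t)
      rw [sub_sub_sub_cancel_right] at h7
      norm_num at h6
      have h8 : 4 * (rm ^ 3)⁻¹ * ‖z.1 - w.1‖ ≤ 4 * (rm ^ 3)⁻¹ * ‖z - w‖ := by gcongr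
      have h9 := norm_nonneg (gs (1 / 10) z.1 - gs (1 / 10) w.1)
      have h10 := norm_nonneg (gs rm (z.1 - Jt t) - gs rm (w.1 - Jt t))
      norm_num at h9 ⊢
      nlinarith
  · intro x
    have : Continuous fun t => x.1 - Jt t := by fun_prop
    have h3 : Continuous fun t => gs rm (x.1 - Jt t) := by
      unfold gs
      refine Continuous.fun_smul ?_ this
      apply Continuous.inv₀
      · exact ((this.norm.max continuous_const).pow 3)
      · intro t; have := le_max_right ‖x.1 - Jt t‖ rm; positivity
    unfold Acc
    fun_prop
  · intro t x
    rw [Real.coe_toNNReal _ (by positivity), Prod.norm_def]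
    apply max_le
    · have := clp_bd R hR.le x.2
      simp only
      linarith
    · simp only [Acc]
      refine (norm_sub_le _ _).trans ?_
      have h6 := gs_bound (1 / 10) (by norm_num) x.1
      have h7 := gs_bound rm hr (x.1 - Jt t)
      have := norm_sub_le (-((1 - μ) • gs (1 / 10) x.1)) (μ • gs rm (x.1 - Jt t))
      rw [norm_neg, norm_smul, norm_smul, Real.norm_eq_abs, Real.norm_eq_abs, abs_of_pos h0,
        abs_of_pos (by linarith : 0 < 1 - μ)] at this
      rw [norm_smul, Jt_norm, Real.norm_eq_abs, abs_of_pos h0]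
      norm_num at h6 this ⊢
      have h9 := norm_nonneg (gs (1 / 10) x.1)
      have h10 := norm_nonneg (gs rm (x.1 - Jt t))
      norm_num at h9
      nlinarith

lemma LocHyp.strict {μ : ℝ} {v : ℂ} {q p F : ℝ → ℂ} {t : ℝ} (H : LocHyp μ v q p F t)
    (ht : 0 < t) (ht1 : t ≤ 1 / 200) (hμ : μ ≤ 1 / 200) :
    ‖q t‖ < 1 / 30 ∧ |‖p t‖ ^ 2 / 2 - μ / ‖q t‖ - ‖v‖ ^ 2 / 2| < 15 / 100 ∧ t / 2 ≤ ‖q t‖ ∧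
    ‖p t‖ ≤ 11 / 10 + 2 * (μ / Real.sqrt (μ * t)) := by
  have hm : t ∈ Ioc 0 t := ⟨ht, le_rfl⟩
  have h1 := H.hi t hm
  have h2 := H.hh t hm
  have h3 := sqrt_le' μ t H.hμ ht
  exact ⟨by linarith, by linarith, (H.low t hm).2.2, H.hp t hm⟩

lemma Fp_bd (μ t : ℝ) (h0 : 0 < μ) (h1 : μ < 1) (q : ℂ) (hq : ‖q‖ ≤ 1 / 30) : ‖Fp μ t q‖ ≤ 3 := by
  have hJ := Jt_norm t
  have h2 : 29 / 30 ≤ ‖q + Jt t‖ := by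
    have := norm_sub_norm_le (Jt t) (-q)
    rw [norm_neg, sub_neg_eq_add, add_comm] at this
    linarith
  have h3 : 0 < ‖q + Jt t‖ := by linarith
  rw [Fp, norm_smul, Real.norm_eq_abs, abs_of_pos (by linarith : 0 < 1 - μ)]
  have h4 := norm_sub_le (Jt t) ((‖q + Jt t‖ ^ 3)⁻¹ • (q + Jt t))
  rw [norm_smul, norm_inv, norm_pow, norm_norm] at h4
  have h5 : (‖q + Jt t‖ ^ 3)⁻¹ * ‖q + Jt t‖ = (‖q + Jt t‖ ^ 2)⁻¹ := by field_simp
  have h6 : (‖q + Jt t‖ ^ 2)⁻¹ ≤ ((29 / 30 : ℝ) ^ 2)⁻¹ := by gcongr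
  rw [h5] at h4
  norm_num at h6
  have := norm_nonneg (Jt t - (‖q + Jt t‖ ^ 3)⁻¹ • (q + Jt t))
  nlinarith
end RC3

namespace RC3
open Set Filter Topology ComplexConjugate

lemma loc_exists (μ : ℝ) (v : ℂ) (tc T rs : ℝ) (hμ : 0 < μ) (hμ1 : μ ≤ 1 / 200)
    (hv1 : 7 / 10 ≤ ‖v‖ ^ 2) (hv2 : ‖v‖ ^ 2 ≤ 9 / 10) (htc : 0 < tc) (htc1 : tc ≤ 1 / 200)
    (hT : tc ≤ T) (hrs : 0 < rs) :
    ∃ (Z V : ℝ → ℂ) (cl : ℂ → ℂ) (rm : ℝ), 0 < rm ∧ rm ≤ rs ∧ (∀ w, ‖w‖ ≤ 100 → cl w = w) ∧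
      LocHyp μ v (fun t => Z t - Jt t) (fun t => V t - Complex.I * Jt t)
        (fun t => Fp μ t (Z t - Jt t)) tc ∧
      ∀ t ∈ Icc tc T, HasDerivAt Z (cl (V t)) t ∧ HasDerivAt V (Acc μ rm t (Z t)) t := by
  have hv0 : v ≠ 0 := by rintro rfl; norm_num at hv1
  obtain ⟨ta, hta, q0, p0, hsol, lq, lh, ln, lS⟩ := lc_main μ hμ v hv0
  -- choose t0
  have ev1 : ∀ᶠ t in 𝓝[>] (0 : ℝ), ‖q0 t‖ < 1 / 30 := by
    have := lq.norm
    rw [norm_zero] at this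
    exact this.eventually (gt_mem_nhds (by norm_num))
  have ev2 : ∀ᶠ t in 𝓝[>] (0 : ℝ), |‖p0 t‖ ^ 2 / 2 - μ / ‖q0 t‖ - ‖v‖ ^ 2 / 2| < 15 / 100 := by
    have := (lh.sub_const (‖v‖ ^ 2 / 2)).abs
    rw [sub_self, abs_zero] at this
    exact this.eventually (gt_mem_nhds (by norm_num))
  obtain ⟨tb, htb, hev⟩ := mem_nhdsGT_iff_exists_Ioc_subset.1 (ev1.and ev2)
  set t0 := min (min ta tb) tc with ht0d
  have ht0 : 0 < t0 := lt_min (lt_min hta htb) htc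
  have ht0a : t0 ≤ ta := (min_le_left _ _).trans (min_le_left _ _)
  have ht0b : t0 ≤ tb := (min_le_left _ _).trans (min_le_right _ _)
  have ht0c : t0 ≤ tc := min_le_right _ _
  have H0 : LocHyp μ v q0 p0 (fun t => Fp μ t (q0 t)) t0 :=
    { hμ := hμ, hμ1 := by linarith, ht1 := by linarith, v1 := hv1, v2 := hv2
      ne := fun t ht => (hsol t ⟨ht.1, ht.2.trans ht0a⟩).1
      dq := fun t ht => (hsol t ⟨ht.1, ht.2.trans ht0a⟩).2.1
      dp := fun t ht => (hsol t ⟨ht.1, ht.2.trans ht0a⟩).2.2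
      hF := fun t ht => Fp_bd μ t hμ (by linarith) _ (hev ⟨ht.1, ht.2.trans ht0b⟩).1.le
      lq := lq, lh := lh, ln := ln, lS := lS
      bq := fun t ht => (hev ⟨ht.1, ht.2.trans ht0b⟩).1.le
      bh := fun t ht => (hev ⟨ht.1, ht.2.trans ht0b⟩).2.le }
  set rm := min rs (t0 / 4) with hrmd
  have hrm : 0 < rm := lt_min hrs (by linarith)
  have hrm4 : rm ≤ t0 / 4 := min_le_right _ _
  set R := 100 + 2 * (μ / Real.sqrt (μ * t0)) with hRd
  have hR0 : 0 ≤ μ / Real.sqrt (μ * t0) := by positivity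
  obtain ⟨α, hα0, hα⟩ := cl_exists μ rm R t0 T hμ (by linarith) hrm (by linarith) (ht0c.trans hT)
    (q0 t0 + Jt t0, p0 t0 + Complex.I * Jt t0)
  set zz : ℝ → ℂ × ℂ := fun t => if t < t0 then (q0 t + Jt t, p0 t + Complex.I * Jt t) else α t
    with hzz
  have hlt : ∀ t, t ≤ t0 → zz t = (q0 t + Jt t, p0 t + Complex.I * Jt t) := by
    intro t ht
    rcases ht.lt_or_eq with h | h
    · simp [hzz, h]
    · subst h; simp [hzz, hα0]
  have hge : ∀ t, t0 ≤ t → zz t = α t := by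
    intro t ht
    simp [hzz, not_lt.2 ht]
  have hq : ∀ t, t ≤ t0 → (zz t).1 - Jt t = q0 t := fun t ht => by rw [hlt t ht]; simp
  have hp : ∀ t, t ≤ t0 → (zz t).2 - Complex.I * Jt t = p0 t := fun t ht => by rw [hlt t ht]; simp
  -- the generic step: true equation while clamps are inactive
  have hder : ∀ t ∈ Ioc 0 tc, (t0 ≤ t → ‖(zz t).1 - Jt t‖ ≤ 1 / 30 ∧ rm ≤ ‖(zz t).1 - Jt t‖ ∧
      ‖(zz t).2‖ ≤ R) → HasDerivAt zz ((zz t).2, -(μ / ‖(zz t).1 - Jt t‖ ^ 3) • ((zz t).1 - Jt t) +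
        Fp μ t ((zz t).1 - Jt t) - Jt t) t := by
    intro t ht hc
    apply glue'
    · intro h
      obtain ⟨-, d1, d2⟩ := hsol t ⟨ht.1, h.trans ht0a⟩
      rw [hq t h, hlt t h]
      refine ((d1.add (Jt_deriv t)).prodMk (d2.add ((Jt_deriv t).const_mul Complex.I))).congr_deriv ?_
      simp only [Prod.mk.injEq, true_and]
      rw [← mul_assoc, Complex.I_mul_I]; ring
    · intro h
      obtain ⟨b1, b2, b3⟩ := hc h
      have := hα t ⟨h, ht.2.trans hT⟩
      rw [hge t h] at b1 b2 b3 ⊢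
      rw [clp_id R _ b3, acc_eq μ rm t _ _ b2] at this
      · exact this
      · have := norm_sub_norm_le (Jt t) (-((α t).1 - Jt t))
        rw [norm_neg, sub_neg_eq_add, Jt_norm] at this
        have e : Jt t + ((α t).1 - Jt t) = (α t).1 := by ring
        rw [e] at this; linarith
    · exact hα0.symm
  have hJc := Jt_contDiff.continuous
  have near : (fun t => (zz t).1 - Jt t) =ᶠ[𝓝[>] 0] q0 := by
    filter_upwards [Ioo_mem_nhdsGT ht0] with t ht using hq t ht.2.le
  have near' : (fun t => (zz t).2 - Complex.I * Jt t) =ᶠ[𝓝[>] 0] p0 := by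
    filter_upwards [Ioo_mem_nhdsGT ht0] with t ht using hp t ht.2.le
  have mkH : ∀ t ∈ Icc t0 tc, (∀ s ∈ Icc t0 t, ‖(zz s).1 - Jt s‖ ≤ 1 / 30 ∧
      |‖(zz s).2 - Complex.I * Jt s‖ ^ 2 / 2 - μ / ‖(zz s).1 - Jt s‖ - ‖v‖ ^ 2 / 2| ≤ 15 / 100 ∧
      rm ≤ ‖(zz s).1 - Jt s‖ ∧ ‖(zz s).2‖ ≤ R) →
      LocHyp μ v (fun t => (zz t).1 - Jt t) (fun t => (zz t).2 - Complex.I * Jt t)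
        (fun t => Fp μ t ((zz t).1 - Jt t)) t := by
    intro t ht hs
    have hb : ∀ s ∈ Ioc 0 t, ‖(zz s).1 - Jt s‖ ≤ 1 / 30 := by
      intro s hs'
      rcases le_total s t0 with h | h
      · rw [hq s h]; exact H0.bq s ⟨hs'.1, h⟩
      · exact (hs s ⟨h, hs'.2⟩).1
    have hd : ∀ s ∈ Ioc 0 t, HasDerivAt zz ((zz s).2, -(μ / ‖(zz s).1 - Jt s‖ ^ 3) • ((zz s).1 - Jt s) +
        Fp μ s ((zz s).1 - Jt s) - Jt s) s := fun s hs' => hder s ⟨hs'.1, hs'.2.trans ht.2⟩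
      (fun h => ⟨(hs s ⟨h, hs'.2⟩).1, (hs s ⟨h, hs'.2⟩).2.2.1, (hs s ⟨h, hs'.2⟩).2.2.2⟩)
    exact
    { hμ := hμ, hμ1 := by linarith, ht1 := by linarith [ht.2], v1 := hv1, v2 := hv2
      ne := by
        intro s hs'
        rcases le_total s t0 with h | h
        · rw [hq s h]; exact H0.ne s ⟨hs'.1, h⟩
        · have := (hs s ⟨h, hs'.2⟩).2.2.1
          exact norm_pos_iff.1 (hrm.trans_le this)
      dq := by
        intro s hs'
        exact (((hasFDerivAt_fst (𝕜 := ℝ)).comp_hasDerivAt s (hd s hs')).sub (Jt_deriv s))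
      dp := by
        intro s hs'
        refine (((hasFDerivAt_snd (𝕜 := ℝ)).comp_hasDerivAt s (hd s hs')).sub
          ((Jt_deriv s).const_mul Complex.I)).congr_deriv ?_
        simp only [ContinuousLinearMap.coe_snd']
        rw [← mul_assoc, Complex.I_mul_I]; ring
      hF := fun s hs' => Fp_bd μ s hμ (by linarith) _ (hb s hs')
      lq := lq.congr' near.symm
      lh := by
        refine lh.congr' ?_
        filter_upwards [near, near'] with s h1 h2
        rw [h1, h2]
      ln := by
        refine ln.congr' ?_
        filter_upwards [near] with s h1
        rw [h1]
      lS := by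
        refine lS.congr' ?_
        filter_upwards [near, near'] with s h1 h2
        rw [h1, h2]
      bq := hb
      bh := by
        intro s hs'
        rcases le_total s t0 with h | h
        · simp only [hq s h, hp s h]; exact H0.bh s ⟨hs'.1, h⟩
        · exact (hs s ⟨h, hs'.2⟩).2.1 }
  have hzc : ContinuousOn zz (Icc t0 tc) := by
    intro t ht
    have : ContinuousWithinAt α (Icc t0 tc) t :=
      (hα t ⟨ht.1, ht.2.trans hT⟩).continuousAt.continuousWithinAt
    exact this.congr (fun s hs => hge s hs.1) (hge t ht.1)
  have strictR : ∀ t, t0 ≤ t → ∀ x : ℂ, ‖x - Complex.I * Jt t‖ ≤ 11 / 10 + 2 * (μ / Real.sqrt (μ * t)) →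
      ‖x‖ < R := by
    intro t ht x hx
    have h1 : μ / Real.sqrt (μ * t) ≤ μ / Real.sqrt (μ * t0) := by gcongr
    have h2 := norm_sub_norm_le x (Complex.I * Jt t)
    rw [norm_mul, Complex.norm_I, Jt_norm] at h2
    linarith
  have key := boot (fun t => max (max (‖(zz t).1 - Jt t‖ - 1 / 30)
      (|‖(zz t).2 - Complex.I * Jt t‖ ^ 2 / 2 - μ / (max ‖(zz t).1 - Jt t‖ rm) - ‖v‖ ^ 2 / 2| - 15 / 100))
      (max (rm - ‖(zz t).1 - Jt t‖) (‖(zz t).2‖ - R))) t0 tc (by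
        have c1 : ContinuousOn (fun t => (zz t).1 - Jt t) (Icc t0 tc) :=
          (continuous_fst.comp_continuousOn hzc).sub hJc.continuousOn
        have c2 : ContinuousOn (fun t => (zz t).2) (Icc t0 tc) := continuous_snd.comp_continuousOn hzc
        have c3 : ContinuousOn (fun t => (zz t).2 - Complex.I * Jt t) (Icc t0 tc) :=
          c2.sub (continuous_const.mul hJc).continuousOn
        have c4 : ContinuousOn (fun t => max ‖(zz t).1 - Jt t‖ rm) (Icc t0 tc) :=
          c1.norm.sup continuousOn_const
        have c5 : ContinuousOn (fun t => μ / max ‖(zz t).1 - Jt t‖ rm) (Icc t0 tc) :=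
          continuousOn_const.div c4 (fun t _ => (hrm.trans_le (le_max_right _ _)).ne')
        exact ((c1.norm.sub continuousOn_const).sup
          (((((c3.norm.pow 2).div_const 2).sub c5).sub continuousOn_const).abs.sub
            continuousOn_const)).sup
          ((continuousOn_const.sub c1.norm).sup (c2.norm.sub continuousOn_const)))
    (by
      obtain ⟨s1, s2, s3, s4⟩ := H0.strict ht0 (by linarith) hμ1
      have := strictR t0 le_rfl (zz t0).2 (by rw [hp t0 le_rfl]; exact s4)
      have e : max ‖q0 t0‖ rm = ‖q0 t0‖ := max_eq_left (by linarith)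
      simp only [hq t0 le_rfl, hp t0 le_rfl, e]
      exact max_le (max_le (by linarith) (by linarith)) (max_le (by linarith) (by linarith)))
    (by
      intro t ht hs
      have hh : LocHyp μ v (fun t => (zz t).1 - Jt t) (fun t => (zz t).2 - Complex.I * Jt t)
        (fun t => Fp μ t ((zz t).1 - Jt t)) t := by
        apply mkH t ht
        intro s hs'
        have h1 := hs s hs'
        simp only [max_le_iff] at h1
        have e : max ‖(zz s).1 - Jt s‖ rm = ‖(zz s).1 - Jt s‖ := max_eq_left (by linarith [h1.2.1])
        rw [e] at h1
        exact ⟨by linarith [h1.1.1], by linarith [h1.1.2], by linarith [h1.2.1], by linarith [h1.2.2]⟩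
      obtain ⟨s1, s2, s3, s4⟩ := hh.strict (ht0.trans_le ht.1) (ht.2.trans htc1) hμ1
      have h5 := strictR t ht.1 (zz t).2 s4
      have ht1 := ht.1
      have e : max ‖(zz t).1 - Jt t‖ rm = ‖(zz t).1 - Jt t‖ := max_eq_left (by linarith)
      rw [e]
      exact max_lt (max_lt (by linarith) (by linarith)) (max_lt (by linarith) (by linarith)))
  refine ⟨fun t => (zz t).1, fun t => (zz t).2, clp R, rm, hrm, min_le_left _ _, fun w hw =>
    clp_id R w (by linarith), mkH tc ⟨ht0c, le_rfl⟩ ?_, ?_⟩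
  · intro s hs'
    have h1 := key s hs'
    simp only [max_le_iff] at h1
    have e : max ‖(zz s).1 - Jt s‖ rm = ‖(zz s).1 - Jt s‖ := max_eq_left (by linarith [h1.2.1])
    rw [e] at h1
    exact ⟨by linarith [h1.1.1], by linarith [h1.1.2], by linarith [h1.2.1], by linarith [h1.2.2]⟩
  · intro t ht
    have h1 : HasDerivAt zz (clp R (zz t).2, Acc μ rm t (zz t).1) t := by
      rcases (ht0c.trans ht.1).lt_or_eq with h | h
      · rw [hge t h.le]
        apply (hα t ⟨h.le, ht.2⟩).congr_of_eventuallyEq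
        filter_upwards [Ioi_mem_nhds h] with s hs using hge s (le_of_lt hs)
      · have htt : t = t0 := h.symm
        have hc : t0 ≤ t → ‖(zz t).1 - Jt t‖ ≤ 1 / 30 ∧ rm ≤ ‖(zz t).1 - Jt t‖ ∧
            ‖(zz t).2‖ ≤ R := by
          intro _
          have h1 := key t ⟨h.le, by rw [htt]; exact ht0c⟩
          simp only [max_le_iff] at h1
          exact ⟨by linarith [h1.1.1], by linarith [h1.2.1], by linarith [h1.2.2]⟩
        have h3 := hder t ⟨by linarith, by linarith⟩ hc
        obtain ⟨b1, b2, b3⟩ := hc h.le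
        rw [clp_id R _ b3, acc_eq μ rm t _ _ b2]
        · exact h3
        · have := norm_sub_norm_le (Jt t) (-((zz t).1 - Jt t))
          rw [norm_neg, sub_neg_eq_add, Jt_norm] at this
          have e : Jt t + ((zz t).1 - Jt t) = (zz t).1 := by ring
          rw [e] at this; linarith
    have h2 := (hasFDerivAt_fst (𝕜 := ℝ) (p := zz t)).comp_hasDerivAt t h1
    have h3 := (hasFDerivAt_snd (𝕜 := ℝ) (p := zz t)).comp_hasDerivAt t h1
    exact ⟨h2, h3⟩
end RC3

namespace RC3
open Set Filter Topology ComplexConjugate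

noncomputable def AccT (μ t : ℝ) (Z : ℂ) : ℂ :=
  -((1 - μ) • ((‖Z‖ ^ 3)⁻¹ • Z)) - μ • ((‖Z - Jt t‖ ^ 3)⁻¹ • (Z - Jt t)) - μ • Jt t

lemma Acc_AccT (μ rm t : ℝ) (Z : ℂ) (h1 : 1 / 10 ≤ ‖Z‖) (h2 : rm ≤ ‖Z - Jt t‖) :
    Acc μ rm t Z = AccT μ t Z := by
  rw [Acc, gs_eq _ _ h1, gs_eq _ _ h2, AccT]

lemma AccT_eq (μ t : ℝ) (Z : ℂ) :
    AccT μ t Z = -(μ / ‖Z - Jt t‖ ^ 3) • (Z - Jt t) + Fp μ t (Z - Jt t) - Jt t := by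
  rw [AccT, Fp, sub_add_cancel, div_eq_mul_inv]
  generalize (‖Z - Jt t‖ ^ 3)⁻¹ = a
  generalize (‖Z‖ ^ 3)⁻¹ = b
  module

lemma inv_sq_norm (a : ℂ) (d : ℝ) (hd : 0 < d) (h : d ≤ ‖a‖) : ‖(‖a‖ ^ 3)⁻¹ • a‖ ≤ (d ^ 2)⁻¹ := by
  rw [← gs_eq d a h]
  exact gs_bound d hd a

lemma pert_bd (μ t d : ℝ) (Z V : ℂ) (hμ : 0 < μ) (h1 : 1 / 10 ≤ ‖Z‖) (hd : 0 < d) (hd1 : d ≤ 1)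
    (h2 : d ≤ ‖Z - Jt t‖) : ‖((V, AccT μ t Z) : ℂ × ℂ) - Kcl (Z, V)‖ ≤ 102 * (μ / d ^ 2) := by
  have e : ((V, AccT μ t Z) : ℂ × ℂ) - Kcl (Z, V) = (0, μ • ((‖Z‖ ^ 3)⁻¹ • Z) -
      μ • ((‖Z - Jt t‖ ^ 3)⁻¹ • (Z - Jt t)) - μ • Jt t) := by
    rw [Kcl, gs_eq _ _ h1, AccT]
    ext1
    · simp
    · simp only [Prod.snd_sub]
      module
  rw [e, Prod.norm_def]
  simp only [norm_zero]
  apply max_le (by positivity)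
  have a1 : ‖(‖Z‖ ^ 3)⁻¹ • Z‖ ≤ 100 := (inv_sq_norm Z (1 / 10) (by norm_num) h1).trans (by norm_num)
  have a2 := inv_sq_norm (Z - Jt t) d hd h2
  have a3 : 1 ≤ (d ^ 2)⁻¹ := by
    rw [one_le_inv₀ (by positivity)]
    nlinarith
  have := norm_sub_le (μ • ((‖Z‖ ^ 3)⁻¹ • Z) - μ • ((‖Z - Jt t‖ ^ 3)⁻¹ • (Z - Jt t))) (μ • Jt t)
  have := norm_sub_le (μ • ((‖Z‖ ^ 3)⁻¹ • Z)) (μ • ((‖Z - Jt t‖ ^ 3)⁻¹ • (Z - Jt t)))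
  rw [norm_smul μ ((‖Z‖ ^ 3)⁻¹ • Z), norm_smul μ ((‖Z - Jt t‖ ^ 3)⁻¹ • (Z - Jt t)),
    Real.norm_eq_abs, abs_of_pos hμ] at this
  have h3 : ‖μ • Jt t‖ = μ := by rw [norm_smul, Jt_norm, Real.norm_eq_abs, abs_of_pos hμ, mul_one]
  have h4 : μ * ‖(‖Z‖ ^ 3)⁻¹ • Z‖ ≤ μ * 100 := by gcongr
  have h5 : μ * ‖(‖Z - Jt t‖ ^ 3)⁻¹ • (Z - Jt t)‖ ≤ μ * (d ^ 2)⁻¹ := by gcongr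
  have h6 : μ * 1 ≤ μ * (d ^ 2)⁻¹ := by gcongr
  rw [div_eq_mul_inv]
  linarith

lemma KepOrb.energy {z : ℂ × ℂ} {P : ℝ} {φ : ℝ → ℂ × ℂ} (h : KepOrb z P φ)
    (hr : ∀ t, 14 / 100 ≤ ‖(φ t).1‖) (t : ℝ) : nn (φ t) = nn z := by
  have hd : ∀ t, HasDerivAt (fun t => 2 * ‖(φ t).1‖⁻¹ - ‖(φ t).2‖ ^ 2) 0 t := by
    intro t
    have h1 := (hasFDerivAt_fst (𝕜 := ℝ) (p := φ t)).comp_hasDerivAt t (h.deriv t)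
    have h2 := (hasFDerivAt_snd (𝕜 := ℝ) (p := φ t)).comp_hasDerivAt t (h.deriv t)
    have hr0 : 0 < ‖(φ t).1‖ := by linarith [hr t]
    have d1 : HasDerivAt (fun t => (φ t).1) (φ t).2 t := h1
    have d2 : HasDerivAt (fun t => (φ t).2) (-((‖(φ t).1‖ ^ 3)⁻¹) • (φ t).1) t := by
      have := h2
      refine h2.congr_deriv ?_
      simp only [ContinuousLinearMap.coe_snd', Kcl]
      rw [gs_eq _ _ (by linarith [hr t]), neg_smul]
    have d3 := (((norm_deriv d1 (norm_pos_iff.1 hr0)).inv hr0.ne').const_mul 2).sub (normsq_deriv d2)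
    refine d3.congr_deriv ?_
    rw [smul_sg, sg_comm (φ t).2]
    field_simp
    ring
  have := is_const_of_deriv_eq_zero (fun t => (hd t).differentiableAt) (fun t => (hd t).deriv) t 0
  rw [h.zero] at this
  simp only [nn, div_eq_mul_inv] at *
  rw [this]

lemma KepOrb.shift {z : ℂ × ℂ} {φ : ℝ → ℂ × ℂ} (h : KepOrb z (PerF z) φ)
    (hr : ∀ t, 14 / 100 ≤ ‖(φ t).1‖) (a : ℝ) :
    KepOrb (φ a) (PerF (φ a)) (fun t => φ (t + a)) := by
  have e : PerF (φ a) = PerF z := by rw [PerF, PerF, h.energy hr]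
  refine ⟨by simp, fun t => (h.deriv (t + a)).comp_add_const t a, fun t => ?_, fun t => h.bd _⟩
  rw [e, add_right_comm, h.per]

lemma Jt_lip (t : ℝ) (ht : 0 ≤ t) : ‖Jt t - 1‖ ≤ t := by
  have := Convex.norm_image_sub_le_of_norm_hasDerivWithin_le (f := Jt) (s := univ) (C := 1)
    (fun x _ => (Jt_deriv x).hasDerivWithinAt) (fun x _ => by rw [norm_mul, Complex.norm_I, Jt_norm]; norm_num)
    convex_univ (mem_univ 0) (mem_univ t)
  simp only [Jt, Complex.ofReal_zero, zero_mul, Complex.exp_zero, sub_zero, one_mul, Real.norm_eq_abs,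
    abs_of_nonneg ht] at this ⊢
  exact this

/-- closeness at the end of the local phase -/
lemma window {μ tc t1 : ℝ} {w : ℂ} {Z V : ℝ → ℂ} {φ : ℝ → ℂ × ℂ} {P : ℝ}
    (H : LocHyp μ (w - Complex.I) (fun t => Z t - Jt t) (fun t => V t - Complex.I * Jt t)
        (fun t => Fp μ t (Z t - Jt t)) tc) (hφ : KepOrb (1, w) P φ)
    (ht1 : 0 < t1) (htc : t1 ≤ tc) (htc1 : tc ≤ 1 / 200) (ha : μ / t1 ≤ t1) (hb : μ / t1 ^ 2 ≤ t1 / 1000)  :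
    ‖(Z tc, V tc) - φ tc‖ ≤ Real.exp 20 * (1000 * t1) := by
  have hμ := H.hμ
  have hm1 : t1 ∈ Ioc 0 tc := ⟨ht1, htc⟩
  have hμt : μ ≤ t1 := by
    rw [div_le_iff₀ ht1] at ha; nlinarith
  have hZ : ∀ t ∈ Ioc 0 tc, HasDerivAt Z (V t) t := by
    intro t ht
    have := (H.dq t ht).add (Jt_deriv t)
    refine (this.congr_deriv (by ring)).congr_of_eventuallyEq ?_
    filter_upwards with s; simp
  have hV : ∀ t ∈ Ioc 0 tc, HasDerivAt V (AccT μ t (Z t)) t := by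
    intro t ht
    have := (H.dp t ht).add ((Jt_deriv t).const_mul Complex.I)
    refine (this.congr_deriv ?_).congr_of_eventuallyEq ?_
    · rw [AccT_eq, ← mul_assoc, Complex.I_mul_I]; ring
    · filter_upwards with s; simp
  have i1 : ‖(Z t1, V t1) - φ t1‖ ≤ 900 * t1 := by
    have h1 := hφ.lip t1 0
    rw [hφ.zero, sub_zero, abs_of_pos ht1] at h1
    have h2 : ‖(Z t1, V t1) - ((1, w) : ℂ × ℂ)‖ ≤ 700 * t1 := by
      have a1 := H.hi t1 hm1
      have a2 := H.hv t1 hm1 (by linarith)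
      have a3 := sqrt_le' μ t1 hμ ht1
      have a4 := Jt_lip t1 ht1.le
      rw [Prod.norm_def]
      apply max_le
      · simp only [Prod.fst_sub]
        have e : Z t1 - 1 = (Z t1 - Jt t1) + (Jt t1 - 1) := by ring
        rw [e]
        refine (norm_add_le _ _).trans ?_
        linarith
      · simp only [Prod.snd_sub]
        have e : V t1 - w = (V t1 - Complex.I * Jt t1 - (w - Complex.I)) + Complex.I * (Jt t1 - 1) := by ring
        rw [e]
        refine (norm_add_le _ _).trans ?_
        rw [norm_mul, Complex.norm_I]
        linarith
    have e : (Z t1, V t1) - φ t1 = ((Z t1, V t1) - ((1, w) : ℂ × ℂ)) - (φ t1 - (1, w)) := by abel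
    rw [e]
    refine (norm_sub_le _ _).trans ?_
    linarith
  have := gron Kcl 4000 (by norm_num) Kcl_lip (fun t => (Z t, V t)) φ (fun t => (V t, AccT μ t (Z t)))
    (fun t => Kcl (φ t)) t1 tc (t1 / 2) (900 * t1) (1 / 200) (by linarith)
    (fun t ht => (hZ t ⟨ht1.trans_le ht.1, ht.2⟩).prodMk (hV t ⟨ht1.trans_le ht.1, ht.2⟩))
    (fun t _ => hφ.deriv t)
    (fun t ht => by
      have hm : t ∈ Ioc 0 tc := ⟨ht1.trans_le ht.1, ht.2⟩
      have b1 := (H.low t hm).2.2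
      have b2 := H.bq t hm
      have ht' := ht.1
      have b3 : 1 / 10 ≤ ‖Z t‖ := by
        have := norm_sub_norm_le (Jt t) (-(Z t - Jt t))
        rw [norm_neg, sub_neg_eq_add, Jt_norm] at this
        have e : Jt t + (Z t - Jt t) = Z t := by ring
        rw [e] at this; linarith
      have := pert_bd μ t (t1 / 2) (Z t) (V t) hμ b3 (by linarith) (by linarith) (by linarith)
      refine this.trans ?_
      have e : 102 * (μ / (t1 / 2) ^ 2) = 408 * (μ / t1 ^ 2) := by field_simp; norm_num
      rw [e]; linarith)
    (fun t _ => rfl) i1 (by linarith) tc ⟨htc, le_rfl⟩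
  refine this.trans ?_
  norm_num
  have := Real.exp_pos 20
  nlinarith

end RC3

namespace RC3
open Set Filter Topology ComplexConjugate

lemma near_of (w : ℂ) (h : ‖w - vst‖ ≤ 1 / 100) :
    7 / 10 ≤ ‖w - Complex.I‖ ^ 2 ∧ ‖w - Complex.I‖ ^ 2 ≤ 9 / 10 := by
  have h1 := (abs_le.1 ((Complex.abs_re_le_norm (w - vst)).trans h))
  have h2 := (abs_le.1 ((Complex.abs_im_le_norm (w - vst)).trans h))
  rw [nsq]
  simp only [vst, Complex.sub_re, Complex.sub_im, Complex.I_re, Complex.I_im] at *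
  constructor <;> nlinarith

set_option maxHeartbeats 1600000 in
lemma shadow : ∃ tc > 0, tc ≤ 1 / 200 ∧ ∃ κ > 0, ∀ c > 0, c ≤ 1 → ∃ δ0 > 0, ∀ w : ℂ, ‖w - vst‖ ≤ κ → ∀ φ,
    KepOrb (1, w) (PerF (1, w)) φ → (∀ t, 14 / 100 ≤ ‖(φ t).1‖) → ∀ (μ δ T : ℝ) (k : ℕ),
    δ * k = 1 → 0 < δ → δ ≤ δ0 → 0 < μ → μ ≤ 2 ^ 20 * δ ^ 20 → tc ≤ T → T ≤ 16 * k →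
    (∀ t ∈ Icc tc T, c * δ ^ 2 ≤ ‖(φ t).1 - Jt t‖) →
    ∃ Z V : ℝ → ℂ, (∀ t ∈ Ioc 0 T, Z t ≠ 0 ∧ Z t - Jt t ≠ 0 ∧ HasDerivAt Z (V t) t ∧
      HasDerivAt V (AccT μ t (Z t)) t) ∧ Tendsto (fun t => Z t - Jt t) (𝓝[>] 0) (𝓝 0) ∧
      ‖(Z T, V T) - φ T‖ ≤ δ := by
  obtain ⟨κ, hκ, C, hC, -, hpert⟩ := pert
  refine ⟨min (1 / 200) (κ / 240), by positivity, min_le_left _ _, min (1 / 100) (κ / 4), by positivity, ?_⟩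
  set tc := min (1 / 200 : ℝ) (κ / 240) with htcd
  have htc0 : 0 < tc := by positivity
  have htc1 : tc ≤ 1 / 200 := min_le_left _ _
  have htc2 : tc ≤ κ / 240 := min_le_right _ _
  intro c hc hc1
  set C1 := Real.exp 20 * 1000 with hC1
  set C2 := 408 * 2 ^ 20 / c ^ 2 with hC2
  set K := C1 + 4 * C * C2 with hK
  have hC1p : 0 < C1 := by positivity
  have hC2p : 0 < C2 := by positivity
  have hKp : 0 < K := by positivity
  have hC1K : C1 ≤ K := by have : 0 ≤ 4 * C * C2 := by positivity
                           linarith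
  refine ⟨min (min (1 / 64) tc) (min (κ / (2 * K)) (c / (40 * C * K))), by positivity, ?_⟩
  intro w hw φ hφ hφr μ δ T k hδk hδ hδ0 hμ hμδ hT hTk hdist
  have hd1 : δ ≤ 1 / 64 := hδ0.trans ((min_le_left _ _).trans (min_le_left _ _))
  have hd2 : δ ≤ tc := hδ0.trans ((min_le_left _ _).trans (min_le_right _ _))
  have hd3 : δ ≤ κ / (2 * K) := hδ0.trans ((min_le_right _ _).trans (min_le_left _ _))
  have hd4 : δ ≤ c / (40 * C * K) := hδ0.trans ((min_le_right _ _).trans (min_le_right _ _))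
  rw [le_div_iff₀ (by positivity)] at hd3 hd4
  obtain ⟨hv1, hv2⟩ := near_of w (hw.trans (min_le_left _ _))
  -- powers
  have p1 : ∀ n : ℕ, δ ^ (n + 1) ≤ δ := fun n => by
    rw [pow_succ]
    have : δ ^ n ≤ 1 := pow_le_one₀ hδ.le (by linarith)
    nlinarith
  have p5 : δ ^ 5 ≤ tc := (p1 4).trans hd2
  have hs1 : (2 : ℝ) ^ 20 * δ ^ 10 ≤ 1 := by
    have : δ ^ 10 ≤ (1 / 64) ^ 10 := by gcongr
    norm_num at this ⊢; linarith
  have hs2 : (2 : ℝ) ^ 20 * δ ^ 5 ≤ 1 / 1000 := by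
    have : δ ^ 5 ≤ (1 / 64) ^ 5 := by gcongr
    norm_num at this ⊢; linarith
  have hμ200 : μ ≤ 1 / 200 := by
    have : δ ^ 20 ≤ (1 / 64) ^ 20 := by gcongr
    norm_num at this hμδ ⊢; linarith
  have hδ5 : 0 < δ ^ 5 := by positivity
  have ha : μ / δ ^ 5 ≤ δ ^ 5 := by
    rw [div_le_iff₀ hδ5]
    calc μ ≤ 2 ^ 20 * δ ^ 20 := hμδ
      _ = (2 ^ 20 * δ ^ 10) * (δ ^ 5 * δ ^ 5) := by ring
      _ ≤ 1 * (δ ^ 5 * δ ^ 5) := by gcongr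
      _ = _ := one_mul _
  have hb : μ / (δ ^ 5) ^ 2 ≤ δ ^ 5 / 1000 := by
    rw [div_le_iff₀ (by positivity)]
    calc μ ≤ 2 ^ 20 * δ ^ 20 := hμδ
      _ = (2 ^ 20 * δ ^ 5) * (δ ^ 5 * (δ ^ 5) ^ 2) := by ring
      _ ≤ 1 / 1000 * (δ ^ 5 * (δ ^ 5) ^ 2) := by gcongr
      _ = _ := by ring
  set ρ := c * δ ^ 2 with hρ
  have hρ0 : 0 < ρ := by positivity
  have hρδ : ρ ≤ δ := by
    have h1 := p1 1
    have h2 : c * δ ^ 2 ≤ 1 * δ ^ 2 := by gcongr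
    norm_num at h1
    linarith
  obtain ⟨Z, V, cl, rm, hrm, hrms, hcl, H, hsol⟩ := loc_exists μ (w - Complex.I) tc T (ρ / 2) hμ hμ200 hv1 hv2
    htc0 htc1 hT (by positivity)
  have hwin := window H hφ hδ5 p5 htc1 ha hb
  have hwin' : ‖(Z tc, V tc) - φ tc‖ ≤ C1 * δ ^ 5 := by rw [hC1]; linarith
  -- shifted orbit
  have hζ : ‖φ tc - zst‖ ≤ κ / 2 := by
    have h1 := hφ.lip tc 0
    rw [hφ.zero, sub_zero, abs_of_pos htc0] at h1
    have h2 : ‖((1, w) : ℂ × ℂ) - zst‖ ≤ κ / 4 := by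
      rw [zst, Prod.mk_sub_mk, sub_self, Prod.norm_def]
      simp only [norm_zero]
      exact max_le (by positivity) (hw.trans (min_le_right _ _))
    have e : φ tc - zst = (φ tc - (1, w)) + ((1, w) - zst) := by abel
    rw [e]
    refine (norm_add_le _ _).trans ?_
    linarith
  set ε := C2 * δ ^ 16 with hε
  have hm : ((4 * k : ℕ) : ℝ) * δ = 4 := by push_cast; linarith
  have hm1 : (((4 * k : ℕ) : ℝ) + 1) * δ ≤ 5 := by rw [add_mul, hm]; linarith
  have hbig : C1 * δ ^ 5 + C * ((4 * k : ℕ) : ℝ) * ε ≤ K * δ ^ 5 := by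
    have e : C * ((4 * k : ℕ) : ℝ) * ε = C * C2 * δ ^ 15 * (((4 * k : ℕ) : ℝ) * δ) := by rw [hε]; ring
    have : C * C2 * δ ^ 15 ≤ C * C2 * δ ^ 5 := by
      have : δ ^ 15 ≤ δ ^ 5 := pow_le_pow_of_le_one hδ.le (by linarith) (by norm_num)
      gcongr
    rw [e, hm, hK]
    linarith
  have hsm : C1 * δ ^ 5 + C * ((4 * k : ℕ) : ℝ) * ε ≤ κ / 2 := by
    refine hbig.trans ?_
    have h1 := p1 4
    norm_num at h1
    have h2 : K * δ ^ 5 ≤ K * δ := by gcongr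
    linarith
  have hfin : C * (((4 * k : ℕ) : ℝ) + 1) * (C1 * δ ^ 5 + C * ((4 * k : ℕ) : ℝ) * ε) < ρ / 4 := by
    calc _ ≤ C * (((4 * k : ℕ) : ℝ) + 1) * (K * δ ^ 5) := by gcongr
      _ = (((4 * k : ℕ) : ℝ) + 1) * δ * (C * K * δ ^ 4) := by ring
      _ ≤ 5 * (C * K * δ ^ 4) := by gcongr
      _ = (δ * (40 * C * K)) / 8 * (δ * δ ^ 2) := by ring
      _ ≤ c / 8 * (δ * δ ^ 2) := by gcongr
      _ ≤ c / 8 * (1 * δ ^ 2) := by gcongr; linarith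
      _ < ρ / 4 := by rw [hρ]; have : 0 < c * δ ^ 2 := hρ0; linarith
  have clean : ∀ t ∈ Icc tc T, ‖(Z t, V t) - φ t‖ ≤ ρ / 4 → 1 / 10 ≤ ‖Z t‖ ∧ ρ / 2 ≤ ‖Z t - Jt t‖ ∧
      HasDerivAt Z (V t) t ∧ HasDerivAt V (AccT μ t (Z t)) t := by
    intro t ht h
    have f1 : ‖Z t - (φ t).1‖ ≤ ρ / 4 := (norm_fst_le ((Z t, V t) - φ t)).trans h
    have f2 : ‖V t - (φ t).2‖ ≤ ρ / 4 := (norm_snd_le ((Z t, V t) - φ t)).trans h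
    have g1 : 1 / 10 ≤ ‖Z t‖ := by
      have := norm_sub_norm_le (φ t).1 (Z t)
      rw [norm_sub_rev] at this
      linarith [hφr t]
    have g2 : ρ / 2 ≤ ‖Z t - Jt t‖ := by
      have := norm_sub_norm_le ((φ t).1 - Jt t) (Z t - Jt t)
      rw [sub_sub_sub_cancel_right, norm_sub_rev (φ t).1 (Z t)] at this
      linarith [hdist t ht]
    have g3 : ‖V t‖ ≤ 100 := by
      have h1 := norm_sub_norm_le (V t) (φ t).2
      have h2 : ‖(φ t).2‖ ≤ 60 := (norm_fst_le (Kcl (φ t))).trans (hφ.bd t)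
      linarith
    obtain ⟨s1, s2⟩ := hsol t ht
    rw [hcl _ g3] at s1
    rw [Acc_AccT _ _ _ _ g1 (hrms.trans g2)] at s2
    exact ⟨g1, g2, s1, s2⟩
  have key := boot (fun t => ‖(Z t, V t) - φ t‖ - ρ / 4) tc T (by
      apply ContinuousOn.sub _ continuousOn_const
      apply ContinuousOn.norm
      apply ContinuousOn.sub
      · exact fun t ht => ((hsol t ht).1.continuousAt.prodMk (hsol t ht).2.continuousAt).continuousWithinAt
      · exact fun t ht => (hφ.deriv t).continuousAt.continuousWithinAt)
    (by
      have : C1 * δ ^ 5 ≤ C1 * δ ^ 5 + C * ((4 * k : ℕ) : ℝ) * ε := by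
        have : 0 ≤ C * ((4 * k : ℕ) : ℝ) * ε := by positivity
        linarith
      have h2 : C1 * δ ^ 5 + C * ((4 * k : ℕ) : ℝ) * ε ≤
        C * (((4 * k : ℕ) : ℝ) + 1) * (C1 * δ ^ 5 + C * ((4 * k : ℕ) : ℝ) * ε) := by
        apply le_mul_of_one_le_left (by positivity)
        have : (0 : ℝ) ≤ ((4 * k : ℕ) : ℝ) := by positivity
        exact one_le_mul_of_one_le_of_one_le hC (by linarith)
      linarith)
    (by
      intro t ht hs
      have hcl' : ∀ s ∈ Icc 0 (t - tc), 1 / 10 ≤ ‖Z (s + tc)‖ ∧ ρ / 2 ≤ ‖Z (s + tc) - Jt (s + tc)‖ ∧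
          HasDerivAt Z (V (s + tc)) (s + tc) ∧ HasDerivAt V (AccT μ (s + tc) (Z (s + tc))) (s + tc) := by
        intro s hs'
        have hm : s + tc ∈ Icc tc t := ⟨by linarith [hs'.1], by linarith [hs'.2]⟩
        have := hs _ hm
        exact clean _ ⟨hm.1, hm.2.trans ht.2⟩ (by linarith)
      have := hpert (4 * k) (φ tc) (fun s => φ (s + tc)) (fun s => (Z (s + tc), V (s + tc)))
        (fun s => (V (s + tc), AccT μ (s + tc) (Z (s + tc)))) (t - tc) (C1 * δ ^ 5) ε hζ
        (hφ.shift hφr tc)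
        (fun s hs' => by
          obtain ⟨-, -, a, b⟩ := hcl' s hs'
          exact (a.comp_add_const s tc).prodMk (b.comp_add_const s tc))
        (fun s hs' => by
          obtain ⟨a, b, -, -⟩ := hcl' s hs'
          refine (pert_bd μ (s + tc) (ρ / 2) _ _ hμ a (by positivity) (by linarith) b).trans ?_
          calc 102 * (μ / (ρ / 2) ^ 2) ≤ 102 * (2 ^ 20 * δ ^ 20 / (ρ / 2) ^ 2) := by gcongr
            _ = ε := by rw [hε, hC2, hρ]; field_simp; norm_num)
        (by simpa using hwin') (by push_cast; linarith [ht.2]) (by positivity) hsm (t - tc)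
        ⟨by linarith [ht.1], le_rfl⟩
      simp only [sub_add_cancel] at this
      linarith)
  refine ⟨Z, V, ?_, H.lq, ?_⟩
  · intro t ht
    rcases le_total t tc with h | h
    · have hm' : t ∈ Ioc 0 tc := ⟨ht.1, h⟩
      have b2 := H.bq t hm'
      have b3 : 1 / 10 ≤ ‖Z t‖ := by
        have := norm_sub_norm_le (Jt t) (-(Z t - Jt t))
        rw [norm_neg, sub_neg_eq_add, Jt_norm] at this
        have e : Jt t + (Z t - Jt t) = Z t := by ring
        rw [e] at this; linarith
      refine ⟨norm_pos_iff.1 (by linarith), H.ne t hm', ?_, ?_⟩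
      · have := (H.dq t hm').add (Jt_deriv t)
        refine (this.congr_deriv (by ring)).congr_of_eventuallyEq ?_
        filter_upwards with s; simp
      · have := (H.dp t hm').add ((Jt_deriv t).const_mul Complex.I)
        refine (this.congr_deriv ?_).congr_of_eventuallyEq ?_
        · rw [AccT_eq, ← mul_assoc, Complex.I_mul_I]; ring
        · filter_upwards with s; simp
    · have := key t ⟨h, ht.2⟩
      obtain ⟨a, b, d, e⟩ := clean t ⟨h, ht.2⟩ (by linarith)
      exact ⟨norm_pos_iff.1 (by linarith), norm_pos_iff.1 (by linarith), d, e⟩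
  · have := key T ⟨hT, le_rfl⟩
    linarith
end RC3

namespace RC3
open Set Filter Topology ComplexConjugate

lemma sin_near (y κ : ℝ) (h : |Real.sin y| ≤ κ) : ∃ m : ℤ, |y - m * Real.pi| ≤ 2 * κ := by
  have hpi := Real.pi_pos
  refine ⟨round (y / Real.pi), ?_⟩
  set m := round (y / Real.pi) with hm
  have h1 : |y / Real.pi - m| ≤ 1 / 2 := abs_sub_round _
  have h2 : y - m * Real.pi = (y / Real.pi - m) * Real.pi := by field_simp
  have h3 : |y - m * Real.pi| ≤ Real.pi / 2 := by
    rw [h2, abs_mul, abs_of_pos hpi]; nlinarith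
  have h4 := Real.mul_abs_le_abs_sin h3
  have h5 : |Real.sin (y - m * Real.pi)| = |Real.sin y| := by
    rw [Real.sin_sub_int_mul_pi]
    rcases Int.even_or_odd m with he | ho
    · rw [he.neg_one_zpow, one_mul]
    · rw [ho.neg_one_zpow]; simp
  rw [h5] at h4
  have h6 : 1 / 2 ≤ 2 / Real.pi := by
    rw [div_le_div_iff₀ (by norm_num) hpi]; linarith [Real.pi_lt_d2]
  have h7 := mul_le_mul_of_nonneg_right h6 (abs_nonneg (y - m * Real.pi))
  linarith

lemma Jt_sub_one (θ : ℝ) : ‖Jt θ - 1‖ = 2 * |Real.sin (θ / 2)| := by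
  have := Complex.norm_exp_I_mul_ofReal_sub_one (x := θ)
  rw [Jt, mul_comm, this, norm_mul]; simp

lemma Jt_near (θ ε : ℝ) (h : ‖Jt θ - 1‖ ≤ ε) : ∃ m : ℤ, |θ - 2 * Real.pi * m| ≤ 2 * ε := by
  rw [Jt_sub_one] at h
  obtain ⟨m, hm⟩ := sin_near (θ / 2) (ε / 2) (by linarith)
  refine ⟨m, ?_⟩
  rw [show θ - 2 * Real.pi * m = 2 * (θ / 2 - m * Real.pi) by ring, abs_mul]
  norm_num; linarith

lemma Jt_add (a b : ℝ) : Jt (a + b) = Jt a * Jt b := by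
  simp only [Jt]; rw [← Complex.exp_add]; push_cast; ring_nf

lemma Jt_zero : Jt 0 = 1 := by simp [Jt]

lemma ang_per (n s : ℝ) (j : ℤ) (hn : n ≠ 0) :
    n * (s + 2 * Real.pi * j / n) = n * s + j * (2 * Real.pi) := by field_simp

lemma kZ_per (n r σ : ℝ) (Z V : ℂ) (s : ℝ) (j : ℤ) (hn : n ≠ 0) :
    kZ n r σ Z V (s + 2 * Real.pi * j / n) = kZ n r σ Z V s := by
  simp only [kZ, kf, kg, ang_per n s j hn, Real.cos_add_int_mul_two_pi, Real.sin_add_int_mul_two_pi]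

lemma kV_per (n r σ : ℝ) (Z V : ℂ) (s : ℝ) (j : ℤ) (hn : n ≠ 0) :
    kV n r σ Z V (s + 2 * Real.pi * j / n) = kV n r σ Z V s := by
  simp only [kV, kW, kr, kf', kg', ang_per n s j hn, Real.cos_add_int_mul_two_pi,
    Real.sin_add_int_mul_two_pi]

lemma kt_per (n r σ : ℝ) (s : ℝ) (j : ℤ) (hn : n ≠ 0) :
    kt n r σ (s + 2 * Real.pi * j / n) = kt n r σ s + 2 * Real.pi * j / n ^ 3 := by
  simp only [kt, ang_per n s j hn, Real.cos_add_int_mul_two_pi, Real.sin_add_int_mul_two_pi]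
  field_simp; ring

lemma kt_zero (n r σ : ℝ) : kt n r σ 0 = 0 := by simp [kt]
lemma kZ_zero (n r σ : ℝ) (Z V : ℂ) : kZ n r σ Z V 0 = Z := by simp [kZ, kf, kg]

/-- difference to the rotating primary is Lipschitz in the eccentric time -/
lemma D_lip (w : ℂ) (n : ℝ) (h : Nz (1, w) n) (a b : ℝ) :
    ‖(kZ n 1 w.re 1 w a - Jt (kt n 1 w.re a)) - (kZ n 1 w.re 1 w b - Jt (kt n 1 w.re b))‖
      ≤ 4 * |a - b| := by
  have hkr := kr_bound _ n h
  obtain ⟨h1, h2, h3, h4, h5, h6⟩ := h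
  have hd : ∀ s ∈ (univ : Set ℝ), HasDerivWithinAt
      (fun s => kZ n 1 w.re 1 w s - Jt (kt n 1 w.re s))
      (kW n 1 w.re 1 w s - kr n 1 w.re s • (Complex.I * Jt (kt n 1 w.re s))) univ s := by
    intro s _
    exact ((kZ_deriv n 1 w.re 1 w s h2.ne' one_ne_zero).sub
      ((Jt_deriv _).scomp s (kt_deriv n 1 w.re s h2.ne'))).hasDerivWithinAt
  have := Convex.norm_image_sub_le_of_norm_hasDerivWithin_le (C := 4) hd (fun s _ => ?_) convex_univ
    (mem_univ b) (mem_univ a)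
  · simpa [Real.norm_eq_abs] using this
  · have e1 : sg 1 w = w.re := by simp [sg]
    have hw := kW_norm n 1 w s h2.ne' one_ne_zero (by simpa using h3)
    have hb := hkr s
    simp only [e1, norm_one] at hw hb
    set r := kr n 1 w.re s
    have hw1 : ‖kW n 1 w.re 1 w s‖ ≤ 3 / 2 := by
      apply le_of_sq_le_sq _ (by norm_num)
      rw [hw]; nlinarith [sq_nonneg (n ^ 2 * r - 1), sq_nonneg (r - 1)]
    calc _ ≤ ‖kW n 1 w.re 1 w s‖ + ‖r • (Complex.I * Jt (kt n 1 w.re s))‖ := norm_sub_le _ _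
      _ ≤ 3 / 2 + 21 / 10 := by
        rw [norm_smul, norm_mul, Jt_norm, Complex.norm_I, Real.norm_eq_abs, abs_of_pos (by linarith)]
        linarith
      _ ≤ 4 := by norm_num

lemma int_small (a : ℤ) (h : |(a : ℝ)| < 1) : a = 0 := by
  have : |a| < 1 := by exact_mod_cast h
  exact Int.abs_lt_one_iff.1 this

lemma nine_le {n X ε : ℝ} (ha : 9 / 10 ≤ n) (hX : 0 ≤ X) (h : n * X ≤ 8 * ε) : X ≤ 9 * ε := by
  nlinarith
lemma sig_le {n X σ : ℝ} (ha : 9 / 10 ≤ n ^ 2) (hX : 0 ≤ X) (h : X + n ^ 2 * σ ^ 2 ≤ 7 / 10) :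
    σ ≤ 1 := by
  nlinarith
lemma cos_low {a s c : ℝ} (h0 : 0 ≤ a) (ha : a ≤ 1 / 2) (h : a ^ 2 = s ^ 2)
    (h1 : s ^ 2 + c ^ 2 = 1) : (8 / 10 : ℝ) ^ 2 ≤ c ^ 2 := by
  nlinarith
lemma lt_one_of {a X b : ℝ} (ha : 3 ≤ a) (hX : 0 ≤ X) (h : a * X ≤ b) (hb : b < 1) : X < 1 := by
  nlinarith
lemma half_le {a X ε : ℝ} (ha : 1 / 2 ≤ a) (hX : 0 ≤ X) (h : a * X ≤ ε) : X ≤ 2 * ε := by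
  nlinarith
lemma no_big {p m k A e : ℝ} (hp : 3 ≤ p) (h : k + 3 ≤ m) (h1 : A ≤ (k + 1) * (2 * p))
    (h2 : - e ≤ A - 2 * p * m) (he : e < 1) : False := by
  nlinarith

set_option maxHeartbeats 1600000 in
/-- The Kepler orbit stays away from the primary. -/
lemma dist_low (w : ℂ) (n c tc θ : ℝ) (N l : ℤ) (k q : ℕ) (h : Nz (1, w) n)
    (hσ1 : 7 / 10 ≤ w.re) (hχ : |(n ^ 2 - 1) / (n * w.re)| ≤ 1 / 10)
    (hx : 1 / n ^ 3 = N / q) (hq : 0 < q) (hkq : k + 3 ≤ q) (hcop : IsCoprime N (q : ℤ))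
    (hc : 0 < c) (hctc : c ≤ tc / 1000) (htc : tc ≤ 1 / 200)
    (hZB : kZ n 1 w.re 1 w ((Real.pi - 2 * Real.arctan ((n ^ 2 - 1) / (n * w.re))) / n) = Jt θ)
    (htB : kt n 1 w.re ((Real.pi - 2 * Real.arctan ((n ^ 2 - 1) / (n * w.re))) / n) - θ
      = 2 * Real.pi * (l + 1 / 2) / q) (s : ℝ) (hs1 : tc / (21 / 10) ≤ s)
    (hs2 : s ≤ (k + 1) * (2 * Real.pi / n)) :
    c / q ≤ ‖kZ n 1 w.re 1 w s - Jt (kt n 1 w.re s)‖ := by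
  by_contra! hlt
  have hkr := kr_bound _ n h s
  have hD := D_lip w n h
  obtain ⟨h1, h2, h3, h4, h5, h6⟩ := h
  have hpi3 := Real.pi_gt_three
  have hn1 : 9 / 10 ≤ n := by nlinarith
  have hn2 : n ≤ 21 / 20 := by nlinarith
  have hq0 : (0 : ℝ) < q := by exact_mod_cast hq
  have hq1 : (1 : ℝ) ≤ q := by exact_mod_cast hq
  set ε := c / q with hε
  have hεpos : 0 < ε := by positivity
  have hεc : ε ≤ c := div_le_self hc.le hq1
  have e1 : sg 1 w = w.re := by simp [sg]
  have hzn := kZ_norm n 1 w s h2.ne' one_ne_zero (by simpa using h3)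
  simp only [e1, norm_one] at hzn hkr
  have hzn' : ‖kZ n 1 w.re 1 w s‖ = kr n 1 w.re s :=
    (sq_eq_sq₀ (norm_nonneg _) (by linarith)).1 hzn
  have hr1 : |kr n 1 w.re s - 1| ≤ ε := by
    have := abs_norm_sub_norm_le (kZ n 1 w.re 1 w s) (Jt (kt n 1 w.re s))
    rw [hzn', Jt_norm] at this
    linarith
  set σ := w.re with hσ
  have hσ2 : σ ≤ 1 := by
    have : sg 1 w = σ := e1
    simp only [e1] at h6
    exact sig_le h4 (sq_nonneg _) h6
  set χ := (n ^ 2 - 1) / (n * σ) with hχd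
  set β := Real.arctan χ with hβ
  set y := n * s / 2 with hy
  have hσ0 : σ ≠ 0 := by linarith
  have hn0 : n ≠ 0 := h2.ne'
  have hcs := Real.sin_sq_add_cos_sq y
  have hre : kr n 1 σ s - 1 = 2 * (σ / n) * (Real.sin y * (Real.cos y - χ * Real.sin y)) := by
    have hny : n * s = 2 * y := by rw [hy]; ring
    rw [kr, hny, Real.cos_two_mul, Real.sin_two_mul, hχd]
    have : Real.cos y ^ 2 = 1 - Real.sin y ^ 2 := by linarith
    rw [this]
    field_simp
    ring
  have hSF : |Real.sin y| * |Real.cos y - χ * Real.sin y| ≤ ε := by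
    have h7 : 1 ≤ 2 * (σ / n) := by
      rw [← mul_div_assoc, le_div_iff₀ h2]; linarith
    rw [hre, abs_mul, abs_of_pos (by linarith), abs_mul] at hr1
    exact (le_mul_of_one_le_left (mul_nonneg (abs_nonneg _) (abs_nonneg _)) h7).trans hr1
  -- from closeness to a nodal time to closeness of angles
  have key : ∀ (sb : ℝ) (m : ℤ), |n * s - (n * sb + 2 * Real.pi * m)| ≤ 8 * ε →
      ‖kZ n 1 σ 1 w sb - Jt (kt n 1 σ sb + 2 * Real.pi * (m * N / q))‖ ≤ 37 * ε := by
    intro sb m hm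
    have h7 := hD (sb + 2 * Real.pi * m / n) s
    rw [kZ_per _ _ _ _ _ _ _ hn0, kt_per _ _ _ _ _ hn0] at h7
    have h8 : |sb + 2 * Real.pi * m / n - s| ≤ 9 * ε := by
      have : n * s - (n * sb + 2 * Real.pi * m) = - (n * (sb + 2 * Real.pi * m / n - s)) := by
        field_simp; ring
      rw [this, abs_neg, abs_mul, abs_of_pos h2] at hm
      exact nine_le hn1 (abs_nonneg _) hm
    have h9 : 2 * Real.pi * m / n ^ 3 = 2 * Real.pi * (m * N / q) := by
      rw [mul_div_assoc, mul_assoc, div_eq_mul_one_div (m : ℝ), hx, mul_div_assoc, ← mul_assoc]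
    rw [h9] at h7
    set A := kZ n 1 σ 1 w sb - Jt (kt n 1 σ sb + 2 * Real.pi * (m * N / q))
    set B := kZ n 1 σ 1 w s - Jt (kt n 1 σ s)
    have : ‖A‖ ≤ ‖A - B‖ + ‖B‖ := by simpa using norm_add_le (A - B) B
    linarith
  have hsm : 74 * c < 1 := by linarith
  rcases le_total |Real.sin y| (1 / 2) with hc1 | hc1
  · have hF : 1 / 2 ≤ |Real.cos y - χ * Real.sin y| := by
      have a1 : 8 / 10 ≤ |Real.cos y| := by
        apply le_of_sq_le_sq _ (abs_nonneg _)
        rw [sq_abs]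
        have := sq_abs (Real.sin y)
        exact cos_low (abs_nonneg _) hc1 this hcs
      have a2 : |χ * Real.sin y| ≤ 1 / 10 := by
        rw [abs_mul]
        exact (mul_le_of_le_one_right (abs_nonneg _) (by linarith)).trans hχ
      have := abs_sub_abs_le_abs_sub (Real.cos y) (χ * Real.sin y)
      linarith
    have hsin : |Real.sin y| ≤ 2 * ε :=
      half_le hF (abs_nonneg _) (by rw [mul_comm]; exact hSF)
    obtain ⟨m, hm⟩ := sin_near _ _ hsin
    have hm2 : |n * s - (n * 0 + 2 * Real.pi * m)| ≤ 8 * ε := by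
      rw [show n * s - (n * 0 + 2 * Real.pi * m) = 2 * (y - m * Real.pi) by rw [hy]; ring, abs_mul]
      norm_num; linarith
    have h7 := key 0 m hm2
    rw [kZ_zero, kt_zero, zero_add, norm_sub_rev] at h7
    obtain ⟨m', hm'⟩ := Jt_near _ _ h7
    have h8 : m * N - m' * q = 0 := by
      apply int_small
      push_cast
      have : 2 * Real.pi * (m * N / q) - 2 * Real.pi * m' = (2 * Real.pi / q) * (m * N - m' * q) := by
        field_simp
      rw [this, abs_mul, abs_of_pos (by positivity), hε] at hm'
      have h9 : (2 * Real.pi) * |(m * N - m' * q : ℝ)| ≤ 74 * c := by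
        have := mul_le_mul_of_nonneg_left hm' hq0.le
        have e : (q:ℝ) * (2 * Real.pi / q * |(m * N - m' * q : ℝ)|) = (2 * Real.pi) * |(m * N - m' * q : ℝ)| := by
          field_simp
        rw [e] at this
        refine this.trans (le_of_eq ?_)
        field_simp; norm_num
      exact lt_one_of (by linarith) (abs_nonneg _) h9 hsm
    have hdvd : (q : ℤ) ∣ m := by
      have : (q : ℤ) ∣ m * N := ⟨m', by linarith⟩
      exact (hcop.symm).dvd_of_dvd_mul_right this
    rw [abs_le, mul_zero, zero_add] at hm2
    have hm0 : 0 < m := by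
      have : (0 : ℝ) < 2 * Real.pi * m := by
        have : 9 / 10 * (tc / (21 / 10)) ≤ n * s := by
          apply mul_le_mul hn1 hs1 _ h2.le
          have : 0 < tc := by linarith
          positivity
        linarith [hm2.2]
      have : (0 : ℝ) < m := pos_of_mul_pos_right this (by positivity)
      exact_mod_cast this
    have hm1 : m < q := by
      have e2 : n * s ≤ (k + 1) * (2 * Real.pi) := by
        have := mul_le_mul_of_nonneg_left hs2 h2.le
        refine this.trans (le_of_eq ?_)
        field_simp
      have : (m : ℝ) < k + 3 := by
        by_contra! hge
        exact no_big hpi3.le hge e2 hm2.1 (by linarith)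
      have : m < (k + 3 : ℤ) := by exact_mod_cast this
      omega
    have := Int.le_of_dvd hm0 hdvd
    omega
  · have hF : |Real.cos y - χ * Real.sin y| ≤ 2 * ε := by
      exact half_le hc1 (abs_nonneg _) hSF
    have hcosβ : 0 < Real.cos β := Real.cos_arctan_pos χ
    have hcos : Real.sin (y + β - Real.pi / 2) = - (Real.cos β * (Real.cos y - χ * Real.sin y)) := by
      have ht : χ * Real.cos β = Real.sin β := by
        have := Real.tan_arctan χ
        rw [Real.tan_eq_sin_div_cos] at this
        rw [div_eq_iff hcosβ.ne'] at this
        exact this.symm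
      rw [Real.sin_sub_pi_div_two, Real.cos_add, ← ht]; ring
    have hsin : |Real.sin (y + β - Real.pi / 2)| ≤ 2 * ε := by
      rw [hcos, abs_neg, abs_mul, abs_of_pos hcosβ]
      exact (mul_le_of_le_one_left (abs_nonneg _) (Real.cos_le_one β)).trans hF
    obtain ⟨m, hm⟩ := sin_near _ _ hsin
    have hm2 : |n * s - (n * ((Real.pi - 2 * β) / n) + 2 * Real.pi * m)| ≤ 8 * ε := by
      rw [show n * s - (n * ((Real.pi - 2 * β) / n) + 2 * Real.pi * m)
        = 2 * (y + β - Real.pi / 2 - m * Real.pi) by rw [hy]; field_simp; ring, abs_mul]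
      norm_num; linarith
    have h7 := key _ m hm2
    rw [hZB, show kt n 1 σ ((Real.pi - 2 * β) / n) = θ + 2 * Real.pi * (l + 1 / 2) / q by linarith,
      add_assoc, Jt_add, ← mul_one_sub, norm_mul, Jt_norm, one_mul, norm_sub_rev] at h7
    obtain ⟨m', hm'⟩ := Jt_near _ _ h7
    have h8 : 2 * (l + m * N - m' * q) + 1 = 0 := by
      apply int_small
      push_cast
      have : 2 * Real.pi * (l + 1 / 2) / q + 2 * Real.pi * (m * N / q) - 2 * Real.pi * m'
          = (Real.pi / q) * (2 * (l + m * N - m' * q) + 1) := by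
        field_simp; ring
      rw [this, abs_mul, abs_of_pos (by positivity), hε] at hm'
      have h9 : Real.pi * |(2 * (l + m * N - m' * q) + 1 : ℝ)| ≤ 74 * c := by
        have := mul_le_mul_of_nonneg_left hm' hq0.le
        have e : (q:ℝ) * (Real.pi / q * |(2 * (l + m * N - m' * q) + 1 : ℝ)|) = Real.pi * |(2 * (l + m * N - m' * q) + 1 : ℝ)| := by
          field_simp
        rw [e] at this
        refine this.trans (le_of_eq ?_)
        field_simp; norm_num
      exact lt_one_of hpi3.le (abs_nonneg _) h9 hsm
    omega
end RC3

namespace RC3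
open Set Filter Topology ComplexConjugate

section cd
variable {E : Type*} [NormedAddCommGroup E] [NormedSpace ℝ E] {p : E} {n σ s : E → ℝ} {w : E → ℂ}

lemma kt_cd (hn : ContDiffAt ℝ 1 n p) (hσ : ContDiffAt ℝ 1 σ p) (hs : ContDiffAt ℝ 1 s p)
    (h0 : n p ≠ 0) : ContDiffAt ℝ 1 (fun x => kt (n x) 1 (σ x) (s x)) p := by
  unfold kt
  have h2 : n p ^ 2 ≠ 0 := pow_ne_zero _ h0
  fun_prop (disch := assumption)

lemma kr_cd (hn : ContDiffAt ℝ 1 n p) (hσ : ContDiffAt ℝ 1 σ p) (hs : ContDiffAt ℝ 1 s p)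
    (h0 : n p ≠ 0) : ContDiffAt ℝ 1 (fun x => kr (n x) 1 (σ x) (s x)) p := by
  unfold kr
  have h2 : n p ^ 2 ≠ 0 := pow_ne_zero _ h0
  fun_prop (disch := assumption)

lemma kZ_cd (hn : ContDiffAt ℝ 1 n p) (hσ : ContDiffAt ℝ 1 σ p) (hs : ContDiffAt ℝ 1 s p)
    (hw : ContDiffAt ℝ 1 w p)
    (h0 : n p ≠ 0) : ContDiffAt ℝ 1 (fun x => kZ (n x) 1 (σ x) 1 (w x) (s x)) p := by
  unfold kZ kf kg
  have h2 : n p ^ 2 ≠ 0 := pow_ne_zero _ h0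
  have h3 : n p ^ 2 * 1 ≠ 0 := by simpa using h2
  fun_prop (disch := assumption)

lemma kW_cd (hn : ContDiffAt ℝ 1 n p) (hσ : ContDiffAt ℝ 1 σ p) (hs : ContDiffAt ℝ 1 s p)
    (hw : ContDiffAt ℝ 1 w p)
    (h0 : n p ≠ 0) : ContDiffAt ℝ 1 (fun x => kW (n x) 1 (σ x) 1 (w x) (s x)) p := by
  unfold kW kf' kg'
  have h3 : n p * 1 ≠ 0 := by simpa using h0
  fun_prop (disch := assumption)

lemma kV_cd (hn : ContDiffAt ℝ 1 n p) (hσ : ContDiffAt ℝ 1 σ p) (hs : ContDiffAt ℝ 1 s p)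
    (hw : ContDiffAt ℝ 1 w p)
    (h0 : n p ≠ 0) (hr : kr (n p) 1 (σ p) (s p) ≠ 0) :
    ContDiffAt ℝ 1 (fun x => kV (n x) 1 (σ x) 1 (w x) (s x)) p := by
  unfold kV
  exact ((kr_cd hn hσ hs h0).inv hr).smul (kW_cd hn hσ hs hw h0)
end cd

/-- frequency as function of `x = n^{-3}` -/
noncomputable def nx (x : ℝ) : ℝ := x ^ (-(1 / 3) : ℝ)
noncomputable def vr (x L : ℝ) : ℝ := Real.sqrt (2 - nx x ^ 2 - L ^ 2)
noncomputable def wv (x L : ℝ) : ℂ := ⟨vr x L, L⟩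
noncomputable def sB (x L : ℝ) : ℝ :=
  (Real.pi - 2 * Real.arctan ((nx x ^ 2 - 1) / (nx x * vr x L))) / nx x
noncomputable def ZB (x L : ℝ) : ℂ := kZ (nx x) 1 (vr x L) 1 (wv x L) (sB x L)
noncomputable def GB (p : ℝ × ℝ) : ℝ := kt (nx p.1) 1 (vr p.1 p.2) (sB p.1 p.2) - (Complex.log (ZB p.1 p.2)).im

lemma nx_one : nx 1 = 1 := by simp [nx]
lemma vr_ref : vr 1 (3 / 5) = 4 / 5 := by
  rw [vr, nx_one, show (2 - 1 ^ 2 - (3 / 5) ^ 2 : ℝ) = (4 / 5) ^ 2 by norm_num,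
    Real.sqrt_sq (by norm_num)]
lemma wv_ref : wv 1 (3 / 5) = vst := by rw [wv, vr_ref, vst]
lemma wv_eq (x L : ℝ) : wv x L = (vr x L : ℂ) + L * Complex.I := by
  apply Complex.ext <;> simp [wv]

lemma nx_cd : ContDiffAt ℝ 1 nx 1 := Real.contDiffAt_rpow_const_of_ne one_ne_zero

lemma nx_cube (x : ℝ) (h : 0 < x) : 1 / nx x ^ 3 = x := by
  rw [nx, ← Real.rpow_natCast, ← Real.rpow_mul h.le]
  norm_num
  rw [Real.rpow_neg h.le]; simp

lemma vr_cd : ContDiffAt ℝ 1 (fun p : ℝ × ℝ => vr p.1 p.2) (1, 3 / 5) := by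
  unfold vr
  apply ContDiffAt.sqrt
  · have : ContDiffAt ℝ 1 (fun p : ℝ × ℝ => nx p.1) (1, 3 / 5) := nx_cd.comp (1, 3/5) contDiffAt_fst
    fun_prop
  · simp only [nx_one]; norm_num

lemma ofReal_cd : ContDiff ℝ 1 (fun x : ℝ => (x : ℂ)) := Complex.ofRealCLM.contDiff

lemma wv_cd : ContDiffAt ℝ 1 (fun p : ℝ × ℝ => wv p.1 p.2) (1, 3 / 5) := by
  simp only [wv_eq]
  refine (ofReal_cd.contDiffAt.comp (1, 3/5) vr_cd).add ?_
  exact (ofReal_cd.contDiffAt.comp (1, 3/5) contDiffAt_snd).mul contDiffAt_const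

lemma nx_cd' : ContDiffAt ℝ 1 (fun p : ℝ × ℝ => nx p.1) (1, 3 / 5) :=
  nx_cd.comp (1, 3/5) contDiffAt_fst

lemma sB_cd : ContDiffAt ℝ 1 (fun p : ℝ × ℝ => sB p.1 p.2) (1, 3 / 5) := by
  unfold sB
  have h1 := nx_cd'
  have h2 := vr_cd
  refine ContDiffAt.div (contDiffAt_const.sub (contDiffAt_const.mul ?_)) h1 (by simp [nx_one])
  refine Real.contDiff_arctan.contDiffAt.comp (1, 3/5) ?_
  refine ContDiffAt.div (by fun_prop) (h1.mul h2) ?_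
  simp only [nx_one, vr_ref]; norm_num

lemma ZB_cd : ContDiffAt ℝ 1 (fun p : ℝ × ℝ => ZB p.1 p.2) (1, 3 / 5) :=
  kZ_cd nx_cd' vr_cd sB_cd wv_cd (by simp [nx_one])

lemma ZB_one (L : ℝ) : ZB 1 L = -1 + (2 * vr 1 L) • wv 1 L := by
  simp [ZB, kZ, sB, nx_one, kf, kg]
  left
  norm_num
  try ring_nf

lemma ZB_ref : ZB 1 (3 / 5) = ⟨7 / 25, 24 / 25⟩ := by
  rw [ZB_one, vr_ref, wv_ref, vst]
  apply Complex.ext <;> simp <;> norm_num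

lemma GB_cd : ContDiffAt ℝ 1 GB (1, 3 / 5) := by
  unfold GB
  refine (kt_cd nx_cd' vr_cd sB_cd (by simp [nx_one])).sub ?_
  have h1 : ContDiffAt ℝ 1 Complex.log (ZB 1 (3 / 5)) := by
    refine (Complex.contDiffAt_log (n := 1) ?_).restrict_scalars ℝ
    rw [ZB_ref]; simp [Complex.slitPlane]
  exact Complex.imCLM.contDiff.contDiffAt.comp _ (h1.comp (1, 3/5) ZB_cd)

lemma vr1_deriv : HasDerivAt (fun L => vr 1 L) (-(3 / 4)) (3 / 5) := by
  unfold vr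
  have h1 : HasDerivAt (fun L : ℝ => 2 - nx 1 ^ 2 - L ^ 2) (-(2 * (3 / 5))) (3 / 5) := by
    simpa using ((hasDerivAt_id (3 / 5 : ℝ)).pow 2).const_sub (2 - nx 1 ^ 2)
  refine (h1.sqrt ?_).congr_deriv ?_
  · rw [nx_one]; norm_num
  · have := vr_ref
    rw [vr] at this
    rw [this]; norm_num

lemma wv1_deriv : HasDerivAt (fun L => wv 1 L) (⟨-(3 / 4), 1⟩) (3 / 5) := by
  simp only [wv_eq]
  have := (vr1_deriv.ofReal_comp).add ((hasDerivAt_id (3 / 5 : ℝ)).ofReal_comp.mul_const Complex.I)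
  refine this.congr_deriv ?_
  apply Complex.ext <;> simp

lemma GB1_deriv : HasDerivAt (fun L => GB (1, L)) (-4) (3 / 5) := by
  have hZ : HasDerivAt (fun L => ZB 1 L) (⟨-12 / 5, 7 / 10⟩) (3 / 5) := by
    simp only [ZB_one]
    refine (((vr1_deriv.const_mul 2).smul wv1_deriv).const_add (-1)).congr_deriv ?_
    rw [vr_ref, wv_ref, vst]
    apply Complex.ext <;> simp <;> norm_num
  have hl := hZ.clog_real (by rw [ZB_ref]; simp [Complex.slitPlane])
  have hl2 := Complex.imCLM.hasFDerivAt.comp_hasDerivAt (3 / 5 : ℝ) hl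
  have ht : HasDerivAt (fun L => kt (nx 1) 1 (vr 1 L) (sB 1 L)) (2 * (-(3 / 4))) (3 / 5) := by
    have : (fun L => kt (nx 1) 1 (vr 1 L) (sB 1 L)) = fun L => Real.pi + 2 * vr 1 L := by
      ext L; simp [kt, sB, nx_one]; ring
    rw [this]
    exact (vr1_deriv.const_mul 2).const_add _
  refine (ht.sub hl2).congr_deriv ?_
  rw [ZB_ref]
  simp [Complex.div_im, Complex.normSq_apply]
  norm_num

lemma GB_tune : ∃ κ > 0, ∀ x L δ : ℝ, |x - 1| ≤ κ → |L - 3 / 5| ≤ κ → 0 < δ → δ ≤ κ →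
    ContinuousOn (fun t => GB (x, t)) (Icc L (L + δ)) ∧ 3 * δ ≤ GB (x, L) - GB (x, L + δ) := by
  have hs := GB_cd.hasStrictFDerivAt one_ne_zero
  have hd : fderiv ℝ GB (1, 3 / 5) (0, 1) = -4 := by
    have h1 : HasDerivAt (fun L : ℝ => ((1 : ℝ), L)) ((0 : ℝ), (1 : ℝ)) (3 / 5) :=
      (hasDerivAt_const _ _).prodMk (hasDerivAt_id _)
    exact (hs.hasFDerivAt.comp_hasDerivAt (3 / 5 : ℝ) h1).unique GB1_deriv
  have hc : ∀ᶠ y in 𝓝 ((1 : ℝ), (3 / 5 : ℝ)), ContinuousAt GB y :=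
    (GB_cd.eventually (by simp)).mono fun y h => h.continuousAt
  have hb := hs.isLittleO.def (c := 1) one_pos
  rw [nhds_prod_eq] at hb
  obtain ⟨ε1, h1, H1⟩ := Metric.eventually_nhds_iff.1 hc
  rw [← nhds_prod_eq] at hb
  obtain ⟨ε2, h2, H2⟩ := Metric.eventually_nhds_iff.1 hb
  have hm : 0 < min ε1 ε2 := lt_min h1 h2
  have hd1 : ∀ x t : ℝ, |x - 1| ≤ min ε1 ε2 / 4 → |t - 3 / 5| ≤ 2 * (min ε1 ε2 / 4) →
      dist (x, t) ((1 : ℝ), (3 / 5 : ℝ)) < min ε1 ε2 := by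
    intro x t hx ht
    rw [Prod.dist_eq, Real.dist_eq, Real.dist_eq]
    exact max_lt (by simp only; linarith) (by simp only; linarith)
  refine ⟨min ε1 ε2 / 4, by positivity, fun x L δ hx hL hδ hδκ => ?_⟩
  have hin : ∀ t ∈ Icc L (L + δ), |t - 3 / 5| ≤ 2 * (min ε1 ε2 / 4) := by
    intro t ht
    have := abs_le.1 hL
    rw [abs_le]; constructor <;> linarith [ht.1, ht.2]
  constructor
  · intro t ht
    have h3 := H1 ((hd1 x t hx (hin t ht)).trans_le (min_le_left _ _))
    refine ContinuousAt.continuousWithinAt ?_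
    exact ContinuousAt.comp (f := fun t : ℝ => (x, t)) (g := GB) h3 (by fun_prop)
  · have a1 := hd1 x (L + δ) hx (hin _ ⟨by linarith, le_rfl⟩)
    have a2 := hd1 x L hx (hin _ ⟨le_rfl, by linarith⟩)
    have h3 := H2 (y := ((x, L + δ), (x, L))) (by
      rw [Prod.dist_eq]
      exact (max_lt a1 a2).trans_le (min_le_right _ _))
    have e : ((x, L + δ) - (x, L) : ℝ × ℝ) = δ • ((0 : ℝ), (1 : ℝ)) := by
      ext <;> simp
    simp only [e, map_smul, hd, norm_smul] at h3
    rw [Real.norm_eq_abs, Real.norm_eq_abs, abs_of_pos hδ, Prod.norm_mk] at h3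
    simp at h3
    have := (abs_le.1 h3).2
    linarith

lemma ZB_Jt (x L : ℝ) (hn : 0 < nx x) (hv : 0 < vr x L) (hE : 0 ≤ 2 - nx x ^ 2 - L ^ 2) : ZB x L = Jt (Complex.log (ZB x L)).im := by
  have hn0 := hn.ne'
  have hv0 := hv.ne'
  have hs : sg 1 (wv x L) = vr x L := by simp [sg, wv]
  have h1 := kZ_norm (nx x) 1 (wv x L) (sB x L) hn0 one_ne_zero (by
    rw [nsq]; simp only [wv, vr, Real.sq_sqrt hE, norm_one]; ring)
  simp only [hs, norm_one] at h1
  have h2 : kr (nx x) 1 (vr x L) (sB x L) = 1 := by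
    rw [kr, sB]
    set n := nx x
    set v := vr x L
    set χ := (n ^ 2 - 1) / (n * v) with hχ
    have h3 : n * ((Real.pi - 2 * Real.arctan χ) / n) = Real.pi - 2 * Real.arctan χ := by
      field_simp
    rw [h3, Real.cos_pi_sub, Real.sin_pi_sub, Real.cos_two_mul, Real.sin_two_mul]
    have hc := Real.cos_arctan_pos χ
    have ht : Real.sin (Real.arctan χ) = χ * Real.cos (Real.arctan χ) := by
      have := Real.tan_arctan χ
      rw [Real.tan_eq_sin_div_cos, div_eq_iff hc.ne'] at this
      exact this
    rw [ht]
    have hcs := Real.sin_sq_add_cos_sq (Real.arctan χ)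
    have hcc : v * χ * n = n ^ 2 - 1 := by rw [hχ]; field_simp
    have hc2 : v / n * (2 * (χ * Real.cos (Real.arctan χ)) * Real.cos (Real.arctan χ))
      = (v * χ * n) / n ^ 2 * (2 * Real.cos (Real.arctan χ) ^ 2) := by field_simp
    rw [hc2, hcc]
    field_simp
    ring
  have h3 : ‖ZB x L‖ = 1 := by
    have : ‖ZB x L‖ ^ 2 = 1 := by rw [ZB, h1, h2]; norm_num
    exact (pow_eq_one_iff_of_nonneg (norm_nonneg _) two_ne_zero).1 this
  rw [Complex.log_im, Jt]
  have := Complex.norm_mul_exp_arg_mul_I (ZB x L)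
  rw [h3] at this
  simpa using this.symm

lemma ivt_tune (g : ℝ → ℝ) (L δ : ℝ) (q : ℕ) (hq : 0 < q) (hδ : 0 ≤ δ)
    (hc : ContinuousOn g (Icc L (L + δ)))
    (h : 2 * Real.pi / q ≤ g L - g (L + δ)) : ∃ L' ∈ Icc L (L + δ), ∃ l : ℤ,
      g L' = 2 * Real.pi * (l + 1 / 2) / q := by
  have hp := Real.pi_pos
  have hq0 : (0 : ℝ) < q := by exact_mod_cast hq
  set a := q * g (L + δ) / (2 * Real.pi) with ha
  have ha' : g (L + δ) = 2 * Real.pi * a / q := by rw [ha]; field_simp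
  set l : ℤ := ⌈a - 1 / 2⌉ with hl
  have h1 : a - 1 / 2 ≤ l := Int.le_ceil _
  have h2 : (l : ℝ) < a - 1 / 2 + 1 := Int.ceil_lt_add_one _
  have hm : 2 * Real.pi * (l + 1 / 2) / q ∈ Icc (g (L + δ)) (g L) := by
    constructor
    · rw [ha']
      have : a ≤ l + 1 / 2 := by linarith
      gcongr
    · have : 2 * Real.pi * (l + 1 / 2) / q ≤ 2 * Real.pi * (a + 1) / q := by
        have : (l : ℝ) + 1 / 2 ≤ a + 1 := by linarith
        gcongr
      refine this.trans ?_
      rw [mul_add, add_div, ← ha', mul_one]; linarith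
  obtain ⟨L', hL', e⟩ := intermediate_value_Icc' (by linarith) hc hm
  exact ⟨L', hL', l, e⟩
end RC3

namespace RC3
open Set Filter Topology ComplexConjugate

noncomputable def p0 : ℝ × ℝ × ℝ × ℝ := (0, 0, 1, 3 / 5)
noncomputable def ktp (p : ℝ × ℝ × ℝ × ℝ) : ℝ := kt (nx p.2.2.1) 1 (vr p.2.2.1 p.2.2.2) p.1
noncomputable def Psi (p : ℝ × ℝ × ℝ × ℝ) : ℂ × ℂ :=
  (Jt p.2.1 * kZ (nx p.2.2.1) 1 (vr p.2.2.1 p.2.2.2) 1 (wv p.2.2.1 p.2.2.2) p.1,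
   Jt p.2.1 * kV (nx p.2.2.1) 1 (vr p.2.2.1 p.2.2.2) 1 (wv p.2.2.1 p.2.2.2) p.1)

lemma kV_zero (n σ : ℝ) (w : ℂ) : kV n 1 σ 1 w 0 = w := by simp [kV, kr, kW, kf', kg']
lemma kr_zero (n σ : ℝ) : kr n 1 σ 0 = 1 := by simp [kr]

lemma proj_cd : ContDiffAt ℝ 1 (fun p : ℝ × ℝ × ℝ × ℝ => p.2.2) p0 := by fun_prop
lemma nxp_cd : ContDiffAt ℝ 1 (fun p : ℝ × ℝ × ℝ × ℝ => nx p.2.2.1) p0 :=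
  ContDiffAt.comp (g := fun r : ℝ × ℝ => nx r.1) (f := fun p : ℝ × ℝ × ℝ × ℝ => p.2.2) p0 (by exact nx_cd') proj_cd
lemma vrp_cd : ContDiffAt ℝ 1 (fun p : ℝ × ℝ × ℝ × ℝ => vr p.2.2.1 p.2.2.2) p0 :=
  ContDiffAt.comp (g := fun r : ℝ × ℝ => vr r.1 r.2) (f := fun p : ℝ × ℝ × ℝ × ℝ => p.2.2) p0 (by exact vr_cd) proj_cd
lemma wvp_cd : ContDiffAt ℝ 1 (fun p : ℝ × ℝ × ℝ × ℝ => wv p.2.2.1 p.2.2.2) p0 :=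
  ContDiffAt.comp (g := fun r : ℝ × ℝ => wv r.1 r.2) (f := fun p : ℝ × ℝ × ℝ × ℝ => p.2.2) p0 (by exact wv_cd) proj_cd

lemma ktp_cd : ContDiffAt ℝ 1 ktp p0 :=
  kt_cd nxp_cd vrp_cd contDiffAt_fst (by simp [p0, nx_one])

lemma Psi_cd : ContDiffAt ℝ 1 Psi p0 := by
  have hJ : ContDiffAt ℝ 1 (fun p : ℝ × ℝ × ℝ × ℝ => Jt p.2.1) p0 :=
    Jt_contDiff.contDiffAt.comp p0 (by fun_prop)
  refine ContDiffAt.prodMk (hJ.mul ?_) (hJ.mul ?_)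
  · exact kZ_cd nxp_cd vrp_cd contDiffAt_fst wvp_cd (by simp [p0, nx_one])
  · exact kV_cd nxp_cd vrp_cd contDiffAt_fst wvp_cd (by simp [p0, nx_one])
      (by simp only [p0]; rw [kr_zero]; norm_num)

lemma wvx_deriv : HasDerivAt (fun x => wv x (3 / 5)) ((5 / 12 : ℝ) : ℂ) 1 := by
  have hn : HasDerivAt nx (-(1 / 3)) 1 := by
    exact (Real.hasDerivAt_rpow_const (x := 1) (p := -(1 / 3)) (Or.inl one_ne_zero)).congr_deriv
      (by simp)
  have hv : HasDerivAt (fun x => vr x (3 / 5)) (5 / 12) 1 := by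
    unfold vr
    refine ((((hn.pow 2).const_sub 2).sub_const ((3 / 5) ^ 2)).sqrt ?_).congr_deriv ?_
    · simp only [Pi.pow_apply, nx_one]; norm_num
    · have := vr_ref
      rw [vr] at this
      simp only [Pi.pow_apply]
      rw [this, nx_one]; norm_num
  simp only [wv_eq]
  exact (hv.ofReal_comp).add_const _

lemma Psi_surj : ((fderiv ℝ Psi p0 : ℝ × ℝ × ℝ × ℝ →L[ℝ] ℂ × ℂ)).range = ⊤ := by
  have hF := (Psi_cd.differentiableAt one_ne_zero).hasFDerivAt
  set D := fderiv ℝ Psi p0 with hD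
  have c1 : D (1, 0, 0, 0) = (vst, -1) := by
    have hl : HasDerivAt (fun s : ℝ => ((s, 0, 1, 3 / 5) : ℝ × ℝ × ℝ × ℝ)) (1, 0, 0, 0) 0 :=
      (hasDerivAt_id _).prodMk (hasDerivAt_const _ _)
    refine (hF.comp_hasDerivAt (0 : ℝ) hl).unique ?_
    have h1 := kZ_deriv 1 1 (4 / 5) 1 vst 0 one_ne_zero one_ne_zero
    have h2 := kV_deriv 1 1 (4 / 5) 1 vst 0 one_ne_zero one_ne_zero (by rw [kr_zero]; norm_num)
    have e1 : kW 1 1 (4 / 5) 1 vst 0 = vst := by simp [kW, kf', kg']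
    rw [e1] at h1
    rw [kr_zero, kZ_zero] at h2
    have h3 := h1.prodMk h2
    refine (h3.congr_of_eventuallyEq (Eventually.of_forall fun s => ?_)).congr_deriv ?_
    · simp [Psi, nx_one, vr_ref, wv_ref, Jt_zero]
    · simp
  have c2 : D (0, 1, 0, 0) = (Complex.I, Complex.I * vst) := by
    have hl : HasDerivAt (fun s : ℝ => ((0, s, 1, 3 / 5) : ℝ × ℝ × ℝ × ℝ)) (0, 1, 0, 0) 0 :=
      (hasDerivAt_const _ _).prodMk ((hasDerivAt_id _).prodMk (hasDerivAt_const _ _))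
    refine (hF.comp_hasDerivAt (0 : ℝ) hl).unique ?_
    have h3 := (Jt_deriv 0).prodMk ((Jt_deriv 0).mul_const vst)
    refine (h3.congr_of_eventuallyEq (Eventually.of_forall fun s => ?_)).congr_deriv ?_
    · simp [Psi, kZ_zero, kV_zero, wv_ref]
    · simp [Jt_zero]
  have c3 : D (0, 0, 1, 0) = (0, ((5 / 12 : ℝ) : ℂ)) := by
    have hl : HasDerivAt (fun s : ℝ => ((0, 0, s, 3 / 5) : ℝ × ℝ × ℝ × ℝ)) (0, 0, 1, 0) 1 :=
      (hasDerivAt_const _ _).prodMk ((hasDerivAt_const _ _).prodMk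
        ((hasDerivAt_id _).prodMk (hasDerivAt_const _ _)))
    refine (hF.comp_hasDerivAt (1 : ℝ) hl).unique ?_
    have h3 := (hasDerivAt_const (1 : ℝ) (1 : ℂ)).prodMk wvx_deriv
    refine (h3.congr_of_eventuallyEq (Eventually.of_forall fun s => ?_))
    simp [Psi, kZ_zero, kV_zero, Jt_zero]
  have c4 : D (0, 0, 0, 1) = (0, ⟨-(3 / 4), 1⟩) := by
    have hl : HasDerivAt (fun s : ℝ => ((0, 0, 1, s) : ℝ × ℝ × ℝ × ℝ)) (0, 0, 0, 1) (3 / 5) :=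
      (hasDerivAt_const _ _).prodMk ((hasDerivAt_const _ _).prodMk
        ((hasDerivAt_const _ _).prodMk (hasDerivAt_id _)))
    refine (hF.comp_hasDerivAt (3 / 5 : ℝ) hl).unique ?_
    have h3 := (hasDerivAt_const (3 / 5 : ℝ) (1 : ℂ)).prodMk wv1_deriv
    refine (h3.congr_of_eventuallyEq (Eventually.of_forall fun s => ?_))
    simp [Psi, kZ_zero, kV_zero, Jt_zero]
  rw [LinearMap.range_eq_top]
  rintro ⟨a, b⟩
  set s := 5 / 4 * a.re with hs
  set f := a.im - 3 / 5 * s with hf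
  set l := b.im - f * (4 / 5) with hl
  set x := (b.re + s + f * (3 / 5) + 3 / 4 * l) * (12 / 5) with hx
  refine ⟨(s, f, x, l), ?_⟩
  have e : ((s, f, x, l) : ℝ × ℝ × ℝ × ℝ) = s • (1, 0, 0, 0) + f • (0, 1, 0, 0) + x • (0, 0, 1, 0)
      + l • (0, 0, 0, 1) := by simp
  show D (s, f, x, l) = (a, b)
  rw [e, map_add, map_add, map_add, map_smul, map_smul, map_smul, map_smul, c1, c2, c3, c4]
  refine Prod.ext ?_ ?_
  · apply Complex.ext
    · simp [vst]; rw [hs]; ring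
    · simp [vst]; rw [hf]; ring
  · apply Complex.ext
    · simp [vst]; rw [hx]; ring
    · simp [vst]; rw [hl]; ring

lemma Psi_open (ε : ℝ) (hε : 0 < ε) : ∃ U' : Set (ℂ × ℂ), IsOpen U' ∧ U'.Nonempty ∧
    ∀ z ∈ U', ∃ p, ‖p - p0‖ < ε ∧ Psi p = z := by
  have hs := Psi_cd.hasStrictFDerivAt one_ne_zero
  have hm := hs.map_nhds_eq_of_surj Psi_surj
  have h1 : Psi '' Metric.ball p0 ε ∈ 𝓝 (Psi p0) := by
    rw [← hm]; exact image_mem_map (Metric.ball_mem_nhds _ hε)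
  refine ⟨interior (Psi '' Metric.ball p0 ε), isOpen_interior,
    ⟨Psi p0, mem_interior_iff_mem_nhds.2 h1⟩, fun z hz => ?_⟩
  obtain ⟨p, hp, e⟩ := interior_subset hz
  exact ⟨p, by rwa [← dist_eq_norm], e⟩

lemma Psi_lip : ∃ ε > 0, ∃ K : ℝ, 0 ≤ K ∧ ∀ p p', ‖p - p0‖ < ε → ‖p' - p0‖ < ε →
    ‖Psi p - Psi p'‖ ≤ K * ‖p - p'‖ ∧ |ktp p - ktp p'| ≤ K * ‖p - p'‖ := by
  obtain ⟨K1, t1, ht1, h1⟩ := Psi_cd.exists_lipschitzOnWith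
  obtain ⟨K2, t2, ht2, h2⟩ := ktp_cd.exists_lipschitzOnWith
  obtain ⟨ε, hε, hb⟩ := Metric.mem_nhds_iff.1 (inter_mem ht1 ht2)
  refine ⟨ε, hε, K1 + K2, by positivity, fun p p' hp hp' => ?_⟩
  have a := hb (show p ∈ Metric.ball p0 ε by rwa [Metric.mem_ball, dist_eq_norm])
  have b := hb (show p' ∈ Metric.ball p0 ε by rwa [Metric.mem_ball, dist_eq_norm])
  have e1 := h1.dist_le_mul p a.1 p' b.1
  have e2 := h2.dist_le_mul p a.2 p' b.2
  rw [dist_eq_norm, dist_eq_norm] at e1 e2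
  rw [Real.norm_eq_abs] at e2
  have i1 : (0:ℝ) ≤ K1 * ‖p - p'‖ := by positivity
  have i2 : (0:ℝ) ≤ K2 * ‖p - p'‖ := by positivity
  constructor <;> linarith
end RC3

set_option linter.unusedSimpArgs false
namespace RC3
open Set Filter Topology ComplexConjugate

lemma norm2_eq (z : ℂ) : norm2 z.re z.im = ‖z‖ := by
  rw [norm2, ← nsq, Real.sqrt_sq (norm_nonneg _)]

lemma Jt_neg_mul (t : ℝ) : Jt (-t) * Jt t = 1 := by
  rw [← Jt_add]; simp [Jt_zero]

lemma norm2_neg (a b : ℝ) : norm2 a (-b) = norm2 a b := by simp [norm2]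

lemma transl (μ T : ℝ) (Z V : ℝ → ℂ) (hT : 0 < T)
    (hode : ∀ t ∈ Ioc 0 T, HasDerivAt Z (V t) t ∧ HasDerivAt V (AccT μ t (Z t)) t)
    (hlim : Tendsto (fun t => Z t - Jt t) (𝓝[>] 0) (𝓝 0)) :
    IsCollisionOrbit μ ((Jt (-T) * Z T).re - μ, -(Jt (-T) * Z T).im, -(Jt (-T) * V T).re,
      (Jt (-T) * V T).im - μ) := by
  set ξ : ℝ → ℂ := fun t => Jt (-t) * Z t - μ with hξ
  set η : ℝ → ℂ := fun t => Jt (-t) * V t - Complex.I * μ with hη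
  have hJ : ∀ t, HasDerivAt (fun t => Jt (-t)) (-(Complex.I * Jt (-t))) t := by
    intro t
    have := (Jt_deriv (-t)).scomp t (hasDerivAt_neg t)
    refine this.congr_deriv ?_
    rw [neg_one_smul]
  have h1 : ∀ t ∈ Ioc 0 T, HasDerivAt ξ (η t - Complex.I * ξ t) t := by
    intro t ht
    refine (((hJ t).mul (hode t ht).1).sub_const (μ : ℂ)).congr_deriv ?_
    simp only [hξ, hη]; ring
  have h2 : ∀ t ∈ Ioc 0 T, HasDerivAt η (-(Complex.I * η t)
      - ((1 - μ) / ‖ξ t + μ‖ ^ 3) • (ξ t + μ) - (μ / ‖ξ t - (1 - μ)‖ ^ 3) • (ξ t - (1 - μ))) t := by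
    intro t ht
    refine (((hJ t).mul (hode t ht).2).sub_const (Complex.I * μ : ℂ)).congr_deriv ?_
    have e1 : ξ t + μ = Jt (-t) * Z t := by simp [hξ]
    have e2 : ξ t - (1 - μ) = Jt (-t) * (Z t - Jt t) := by
      rw [mul_sub, Jt_neg_mul]; simp only [hξ]; ring
    rw [e1, e2, norm_mul, norm_mul, Jt_norm, one_mul, one_mul]
    simp only [hη, AccT, Complex.real_smul]
    push_cast
    have hI := Complex.I_mul_I
    have hj := Jt_neg_mul t
    linear_combination (-(μ : ℂ)) * hj + (-(μ : ℂ)) * hI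
  have hsub : ∀ t ∈ Ico 0 T, T - t ∈ Ioc 0 T := fun t ht => ⟨by linarith [ht.2], by linarith [ht.1]⟩
  have r1 : ∀ t ∈ Ico 0 T, HasDerivAt (fun t => ξ (T - t)) (-(η (T - t) - Complex.I * ξ (T - t))) t := by
    intro t ht
    have := (h1 _ (hsub t ht)).scomp t ((hasDerivAt_id t).const_sub T)
    refine this.congr_deriv ?_
    rw [neg_one_smul]
  have r2 : ∀ t ∈ Ico 0 T, HasDerivAt (fun t => η (T - t)) (-(-(Complex.I * η (T - t))
      - ((1 - μ) / ‖ξ (T - t) + μ‖ ^ 3) • (ξ (T - t) + μ)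
      - (μ / ‖ξ (T - t) - (1 - μ)‖ ^ 3) • (ξ (T - t) - (1 - μ)))) t := by
    intro t ht
    have := (h2 _ (hsub t ht)).scomp t ((hasDerivAt_id t).const_sub T)
    refine this.congr_deriv ?_
    rw [neg_one_smul]
  have hre : ∀ {f : ℝ → ℂ} {f' : ℂ} {t : ℝ}, HasDerivAt f f' t →
      HasDerivAt (fun t => (f t).re) f'.re t := fun h =>
    (Complex.reCLM.hasFDerivAt.comp_hasDerivAt _ h)
  have him : ∀ {f : ℝ → ℂ} {f' : ℂ} {t : ℝ}, HasDerivAt f f' t →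
      HasDerivAt (fun t => (f t).im) f'.im t := fun h =>
    (Complex.imCLM.hasFDerivAt.comp_hasDerivAt _ h)
  refine ⟨T, fun t => (ξ (T - t)).re, fun t => -(ξ (T - t)).im, fun t => -(η (T - t)).re,
    fun t => (η (T - t)).im, hT, ?_, ?_, Or.inl ?_⟩
  · intro t ht
    have n1 : norm2 ((ξ (T - t)).re - (1 - μ)) (-(ξ (T - t)).im) = ‖ξ (T - t) - (1 - μ)‖ := by
      rw [norm2_neg, ← norm2_eq]; simp
    have n2 : norm2 ((ξ (T - t)).re + μ) (-(ξ (T - t)).im) = ‖ξ (T - t) + μ‖ := by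
      rw [norm2_neg, ← norm2_eq]; simp
    rw [n1, n2]
    refine ⟨(hre (r1 t ht)).congr_deriv ?_, (him (r1 t ht)).neg.congr_deriv ?_,
      (hre (r2 t ht)).neg.congr_deriv ?_, (him (r2 t ht)).congr_deriv ?_⟩
    · simp; ring
    · simp
    · generalize ‖ξ (T - t) - (1 - μ)‖ = a
      generalize ‖ξ (T - t) + μ‖ = b
      simp only [Complex.neg_re, Complex.neg_im, Complex.sub_re, Complex.sub_im, Complex.smul_re,
        Complex.smul_im, Complex.add_re, Complex.add_im, Complex.ofReal_re, Complex.ofReal_im,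
        Complex.one_re, Complex.one_im, Complex.mul_re, Complex.mul_im, Complex.I_re, Complex.I_im,
        smul_eq_mul]
      ring
    · generalize ‖ξ (T - t) - (1 - μ)‖ = a
      generalize ‖ξ (T - t) + μ‖ = b
      simp only [Complex.neg_re, Complex.neg_im, Complex.sub_re, Complex.sub_im, Complex.smul_re,
        Complex.smul_im, Complex.add_re, Complex.add_im, Complex.ofReal_re, Complex.ofReal_im,
        Complex.one_re, Complex.one_im, Complex.mul_re, Complex.mul_im, Complex.I_re, Complex.I_im,
        smul_eq_mul]
      ring
  · simp [hξ, hη]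
  · have l0 : Tendsto (fun t : ℝ => Jt (-t)) (𝓝[>] 0) (𝓝 1) := by
      have : ContinuousAt (fun t : ℝ => Jt (-t)) 0 := (hJ 0).continuousAt
      have h := this.tendsto
      simp only [neg_zero, Jt_zero] at h
      exact h.mono_left nhdsWithin_le_nhds
    have l1 : Tendsto ξ (𝓝[>] 0) (𝓝 (1 - μ)) := by
      have := ((l0.mul hlim).add_const (1 : ℂ)).sub_const (μ : ℂ)
      simp only [mul_zero, zero_add] at this
      refine this.congr fun t => ?_
      rw [mul_sub, Jt_neg_mul]; simp only [hξ]; ring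
    have l2 : Tendsto (fun t => T - t) (𝓝[<] T) (𝓝[>] 0) := by
      refine tendsto_nhdsWithin_iff.2 ⟨?_, ?_⟩
      · have : Tendsto (fun t => T - t) (𝓝 T) (𝓝 (T - T)) := by
          exact (continuous_const.sub continuous_id).tendsto T
        rw [sub_self] at this
        exact this.mono_left nhdsWithin_le_nhds
      · filter_upwards [self_mem_nhdsWithin] with t ht
        have ht' : t < T := ht
        exact sub_pos.2 ht'
    have l3 := l1.comp l2
    refine Tendsto.prodMk_nhds ?_ ?_
    · have := (Complex.continuous_re.tendsto _).comp l3
      simpa [Function.comp_def] using this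
    · have := ((Complex.continuous_im.tendsto _).comp l3).neg
      simpa [Function.comp_def] using this
end RC3

namespace RC3
open Set Filter Topology ComplexConjugate

lemma box (κ : ℝ) (hκ : 0 < κ) : ∃ ε > 0, ∀ x L : ℝ, |x - 1| < ε → |L - 3 / 5| < ε →
    0 < x ∧ 0 < nx x ∧ Nz (1, wv x L) (nx x) ∧ PerF (1, wv x L) = 2 * Real.pi / nx x ^ 3 ∧
    7 / 10 ≤ vr x L ∧ |(nx x ^ 2 - 1) / (nx x * vr x L)| ≤ 1 / 10 ∧ ‖wv x L - vst‖ ≤ κ ∧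
    0 ≤ 2 - nx x ^ 2 - L ^ 2 ∧ 5 ≤ 2 * Real.pi * x ∧ 2 * Real.pi * x ≤ 8 := by
  obtain ⟨κ1, hκ1, K, hK, hN, -⟩ := near_zst
  have c1 := nx_cd'.continuousAt
  have c2 := vr_cd.continuousAt
  have c3 := wv_cd.continuousAt
  have c4 : ContinuousAt (fun p : ℝ × ℝ => (nx p.1 ^ 2 - 1) / (nx p.1 * vr p.1 p.2)) (1, 3 / 5) :=
    ((c1.pow 2).sub continuousAt_const).div (c1.mul c2) (by simp only [nx_one, vr_ref]; norm_num)
  have c5 : ContinuousAt (fun p : ℝ × ℝ => 2 - nx p.1 ^ 2 - p.2 ^ 2) (1, 3 / 5) :=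
    (continuousAt_const.sub (c1.pow 2)).sub (by fun_prop)
  have c6 : ContinuousAt (fun p : ℝ × ℝ => ‖wv p.1 p.2 - vst‖) (1, 3 / 5) :=
    (c3.sub continuousAt_const).norm
  have e1 : ∀ᶠ p : ℝ × ℝ in 𝓝 (1, 3 / 5), 0 < nx p.1 :=
    c1.eventually_const_lt (by simp [nx_one])
  have e2 : ∀ᶠ p : ℝ × ℝ in 𝓝 (1, 3 / 5), 7 / 10 < vr p.1 p.2 :=
    c2.eventually_const_lt (by simp only [vr_ref]; norm_num)
  have e3 : ∀ᶠ p : ℝ × ℝ in 𝓝 (1, 3 / 5), |(nx p.1 ^ 2 - 1) / (nx p.1 * vr p.1 p.2)| < 1 / 10 :=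
    c4.abs.eventually_lt_const (by simp [nx_one])
  have e4 : ∀ᶠ p : ℝ × ℝ in 𝓝 (1, 3 / 5), ‖wv p.1 p.2 - vst‖ < min κ κ1 :=
    c6.eventually_lt_const (by simp only [wv_ref, sub_self, norm_zero]; positivity)
  have e5 : ∀ᶠ p : ℝ × ℝ in 𝓝 (1, 3 / 5), 0 < 2 - nx p.1 ^ 2 - p.2 ^ 2 :=
    c5.eventually_const_lt (by simp only [nx_one]; norm_num)
  have e6 : ∀ᶠ p : ℝ × ℝ in 𝓝 (1, 3 / 5), 0 < p.1 :=
    continuousAt_fst.eventually_const_lt (by norm_num)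
  obtain ⟨ε, hε, H⟩ := Metric.eventually_nhds_iff.1
    (e1.and (e2.and (e3.and (e4.and (e5.and e6)))))
  refine ⟨ε, hε, fun x L hx hL => ?_⟩
  obtain ⟨a1, a2, a3, a4, a5, a6⟩ := H (y := (x, L)) (by
    rw [Prod.dist_eq, Real.dist_eq, Real.dist_eq]; exact max_lt hx hL)
  simp only at a1 a2 a3 a4 a5 a6
  have hz : ‖((1, wv x L) : ℂ × ℂ) - zst‖ ≤ κ1 := by
    rw [zst, Prod.mk_sub_mk, Prod.norm_mk, sub_self, norm_zero]
    exact max_le hκ1.le (a4.le.trans (min_le_right _ _))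
  have hn : nn (1, wv x L) = nx x := by
    rw [nn]
    have : 2 / ‖((1, wv x L) : ℂ × ℂ).1‖ - ‖((1, wv x L) : ℂ × ℂ).2‖ ^ 2 = nx x ^ 2 := by
      rw [nsq]; simp only [wv, vr, Real.sq_sqrt a5.le, norm_one]; ring
    rw [this, Real.sqrt_sq a1.le]
  obtain ⟨b1, b2, b3⟩ := hN _ hz
  have hP : PerF (1, wv x L) = 2 * Real.pi / nx x ^ 3 := by rw [PerF, hn]
  have hP2 : PerF (1, wv x L) = 2 * Real.pi * x := by
    rw [hP, div_eq_mul_one_div, nx_cube x a6]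
  rw [hn] at b1
  rw [hP2] at b2 b3
  exact ⟨a6, a1, b1, hP, a2.le, a3.le, a4.le.trans (min_le_left _ _), a5.le, b2, b3⟩

lemma num (c0 x : ℝ) (k : ℕ) (hk : 0 < k) (he : Even k) : ∃ l m : ℤ, Odd (l + k * m) ∧
    |l - c0 * k| ≤ 1 ∧ |((l + k * m : ℤ) : ℝ) - x * k ^ 2| ≤ k := by
  have hk0 : (0 : ℝ) < k := by exact_mod_cast hk
  set a := ⌊c0 * k / 2⌋ with ha
  have h1 := Int.floor_le (c0 * k / 2)
  have h2 := Int.lt_floor_add_one (c0 * k / 2)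
  rw [← ha] at h1 h2
  set l : ℤ := 2 * a + 1 with hl
  set m : ℤ := round ((x * k ^ 2 - l) / k) with hm
  refine ⟨l, m, ?_, ?_, ?_⟩
  · have h3 : Even ((k : ℤ) * m) := by
      have : Even (k : ℤ) := by exact_mod_cast he
      exact this.mul_right m
    exact Odd.add_even ⟨a, hl⟩ h3
  · rw [hl]; push_cast
    rw [abs_le]; constructor <;> linarith
  · have h3 := abs_sub_round ((x * k ^ 2 - l) / k)
    rw [← hm] at h3
    push_cast
    have : l + k * m - x * k ^ 2 = - (k * ((x * k ^ 2 - l) / k - m)) := by field_simp; ring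
    rw [this, abs_neg, abs_mul, abs_of_pos hk0]
    nlinarith

lemma kt_ranges (w : ℂ) (n : ℝ) (h : Nz (1, w) n) (tc a b : ℝ)
    (h1 : tc ≤ kt n 1 w.re a) (h2 : kt n 1 w.re a ≤ kt n 1 w.re b) :
    tc / (21 / 10) ≤ a ∧ a ≤ b ∨ tc ≤ 0 := by
  by_cases htc : tc ≤ 0
  · exact Or.inr htc
  left
  push Not at htc
  have hb := kr_bound _ n h
  have e1 : sg 1 w = w.re := by simp [sg]
  simp only [e1, norm_one] at hb
  have hn := h.2.1.ne'
  have hd := fun s => kt_deriv n 1 w.re s hn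
  have hm : StrictMono (kt n 1 w.re) := strictMono_of_deriv_pos fun s => by
    rw [(hd s).deriv]; linarith [(hb s).1]
  have hm2 : Monotone (fun s => 21 / 10 * s - kt n 1 w.re s) := by
    have hd2 : ∀ s, HasDerivAt (fun s => 21 / 10 * s - kt n 1 w.re s)
        (21 / 10 * 1 - kr n 1 w.re s) s :=
      fun s => ((hasDerivAt_id s).const_mul _).sub (hd s)
    apply monotone_of_deriv_nonneg (fun s => (hd2 s).differentiableAt)
    intro s; rw [(hd2 s).deriv]; linarith [(hb s).2]
  refine ⟨?_, hm.le_iff_le.1 h2⟩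
  by_contra! hlt
  have a1 := hm hlt
  have a2 := hm2 (show (0 : ℝ) ≤ tc / (21 / 10) by positivity)
  simp only [kt_zero, mul_zero, sub_zero] at a2
  linarith

lemma Jt_int (f : ℝ) (m : ℤ) : Jt (f - 2 * Real.pi * m) = Jt f := by
  rw [Jt, Jt, Complex.exp_eq_exp_iff_exists_int]
  exact ⟨-m, by push_cast; ring⟩
end RC3

namespace RC3
open Set Filter Topology ComplexConjugate

lemma norm4 (a b c d r : ℝ) (ha : |a| ≤ r) (hb : |b| ≤ r) (hc : |c| ≤ r) (hd : |d| ≤ r) :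
    ‖((a, b, c, d) : ℝ × ℝ × ℝ × ℝ)‖ ≤ r := by
  simp only [Prod.norm_mk, Real.norm_eq_abs]
  exact max_le ha (max_le hb (max_le hc hd))

lemma hA (a k : ℝ) (hk : 0 < k) (h : |a| ≤ k) : |a| * k ≤ 1 * k ^ 2 := by nlinarith

lemma hB (K δ ε : ℝ) (hK : 0 ≤ K) (hδ : 0 < δ) (h : (8 + K) * δ ≤ ε / 2) : δ ≤ ε / 2 := by
  nlinarith

lemma hD (δ : ℝ) (h0 : 0 < δ) (h : δ ≤ 1 / 4) : 2 * Real.pi * δ ^ 2 ≤ 3 * δ := by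
  have h1 := Real.pi_lt_d2
  have h2 : 2 * Real.pi * δ ≤ 3 := by nlinarith [Real.pi_pos]
  nlinarith

lemma hE (δ a : ℝ) (h0 : 0 < δ) (h : |a| ≤ 1) : |2 * Real.pi * δ * a| ≤ 7 * δ := by
  have hpi := Real.pi_pos
  rw [abs_mul, abs_of_pos (by positivity)]
  have h1 : 2 * Real.pi * δ ≤ 7 * δ := by nlinarith [Real.pi_lt_d2]
  have h2 : 0 ≤ 2 * Real.pi * δ := by positivity
  nlinarith [abs_nonneg a]

lemma hF (s n ε : ℝ) (hn : 0 < n) (hn2 : n ≤ 2) (h : s < ε / 2) (he : ε ≤ 1) :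
    s ≤ 2 * Real.pi / n := by
  have hpi := Real.pi_gt_three
  rw [le_div_iff₀ hn]
  nlinarith

lemma hH (τ k y tc : ℝ) (hk : 4 ≤ k) (hy : 5 ≤ y) (h : -1 ≤ τ) (ht : tc ≤ 1 / 200) :
    tc ≤ τ + k * y := by nlinarith

lemma hI (τ k y : ℝ) (hk : 4 ≤ k) (hy : y ≤ 8) (h : τ ≤ 1) :
    τ + k * y ≤ 16 * k := by nlinarith

set_option maxHeartbeats 1000000 in
lemma core : ∃ ε > 0, ∃ C : ℝ, 0 ≤ C ∧ ∃ δ1 > 0, ∀ p, ‖p - p0‖ < ε → ∀ (μ δ : ℝ) (e : ℕ),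
    δ * (2 ^ e : ℕ) = 1 → δ ≤ δ1 → 0 < μ → μ ≤ 2 ^ 20 * δ ^ 20 →
    ∃ (T : ℝ) (Z V : ℝ → ℂ), 0 < T ∧
      (∀ t ∈ Ioc 0 T, HasDerivAt Z (V t) t ∧ HasDerivAt V (AccT μ t (Z t)) t) ∧
      Tendsto (fun t => Z t - Jt t) (𝓝[>] 0) (𝓝 0) ∧
      ‖Jt (-T) * Z T - (Psi p).1‖ ≤ C * δ ∧ ‖Jt (-T) * V T - (Psi p).2‖ ≤ C * δ := by
  obtain ⟨tc, htc0, htc1, κs, hκs, hsh⟩ := shadow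
  obtain ⟨δ0, hδ0, hsh⟩ := hsh (tc / 1000) (by positivity) (by linarith)
  obtain ⟨κG, hκG, hG⟩ := GB_tune
  obtain ⟨εb, hεb, hbox⟩ := box κs hκs
  obtain ⟨εL, hεL, K, hK, hlip⟩ := Psi_lip
  obtain ⟨ε1, hε1, i1, i2, i3, i4, i5⟩ : ∃ ε1 > 0, ε1 ≤ κG ∧ ε1 ≤ εb ∧ ε1 ≤ εL ∧ ε1 ≤ 1 ∧
      K * ε1 ≤ 1 := by
    refine ⟨min (min κG εb) (min εL (1 / (K + 1))), by positivity, ?_, ?_, ?_, ?_, ?_⟩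
    · exact (min_le_left _ _).trans (min_le_left _ _)
    · exact (min_le_left _ _).trans (min_le_right _ _)
    · exact (min_le_right _ _).trans (min_le_left _ _)
    · refine ((min_le_right _ _).trans (min_le_right _ _)).trans ?_
      rw [div_le_one (by positivity)]; linarith
    · have : min (min κG εb) (min εL (1 / (K + 1))) ≤ 1 / (K + 1) :=
        (min_le_right _ _).trans (min_le_right _ _)
      refine (mul_le_mul_of_nonneg_left this hK).trans ?_
      rw [mul_one_div, div_le_one (by positivity)]; linarith
  refine ⟨ε1 / 2, by positivity, 1 + K * (7 + K), by positivity,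
    min (min δ0 (1 / 4)) (min κG (ε1 / (2 * (8 + K)))), by positivity, ?_⟩
  rintro ⟨s, f, x, L⟩ hp μ δ e hδk hδ hμ hμδ
  have j1 : δ ≤ δ0 := hδ.trans ((min_le_left _ _).trans (min_le_left _ _))
  have j2 : δ ≤ 1 / 4 := hδ.trans ((min_le_left _ _).trans (min_le_right _ _))
  have j3 : δ ≤ κG := hδ.trans ((min_le_right _ _).trans (min_le_left _ _))
  have j4 : (8 + K) * δ ≤ ε1 / 2 := by
    have : δ ≤ ε1 / (2 * (8 + K)) := hδ.trans ((min_le_right _ _).trans (min_le_right _ _))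
    rw [le_div_iff₀ (by positivity)] at this
    linarith
  set k : ℕ := 2 ^ e with hk
  have hk0 : 0 < k := by positivity
  have hk0' : (0 : ℝ) < k := by exact_mod_cast hk0
  have hδe : δ = 1 / k := by rw [eq_div_iff hk0'.ne', hδk]
  have hδ0' : 0 < δ := by rw [hδe]; positivity
  have hk4' : (4 : ℝ) ≤ k := by
    rw [hδe, div_le_div_iff₀ hk0' (by norm_num)] at j2; linarith
  have hk4 : 4 ≤ k := by exact_mod_cast hk4'
  have hke : Even k := by
    have : e ≠ 0 := by rintro rfl; simp [hk] at hk4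
    exact (Nat.even_pow.2 ⟨even_two, this⟩)
  have hpn := hp
  simp only [p0, Prod.mk_sub_mk, Prod.norm_mk, Real.norm_eq_abs, sub_zero, max_lt_iff] at hpn
  obtain ⟨q1, q2, q3, q4⟩ := hpn
  -- arithmetic choice of the period
  set c0 : ℝ := -(ktp (s, f, x, L) + f) / (2 * Real.pi) with hc0
  obtain ⟨l, m, hodd, hl, hN⟩ := num c0 x k hk0 hke
  set N : ℤ := l + k * m with hNd
  set q : ℕ := k ^ 2 with hq
  have hq0 : 0 < q := by positivity
  have hqr : (q : ℝ) = k ^ 2 := by rw [hq]; push_cast; rfl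
  set x' : ℝ := N / q with hx'
  have hxx : |x' - x| ≤ δ := by
    have : x' - x = (N - x * k ^ 2) / k ^ 2 := by rw [hx', hqr]; field_simp
    rw [this, abs_div, abs_of_pos (show (0 : ℝ) < k ^ 2 by positivity), hδe,
      div_le_div_iff₀ (by positivity) hk0']
    exact hA _ _ hk0' hN
  have hKδ : δ ≤ ε1 / 2 := hB K δ ε1 hK hδ0' j4
  have hx1 : |x' - 1| < ε1 := by
    have := abs_add_le (x' - x) (x - 1)
    rw [show x' - x + (x - 1) = x' - 1 by ring] at this
    linarith
  -- tuning of the angular momentum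
  obtain ⟨hc, hdrop⟩ := hG x' L δ (by linarith) (by linarith) hδ0' j3
  obtain ⟨L', hL', l2, hL2⟩ := ivt_tune (fun t => GB (x', t)) L δ q hq0 hδ0'.le hc (by
    refine le_trans ?_ hdrop
    rw [hqr, show 2 * Real.pi / (k : ℝ) ^ 2 = 2 * Real.pi * δ ^ 2 by rw [hδe]; field_simp]
    exact hD δ hδ0' j2)
  have hLL : |L' - L| ≤ δ := by
    rw [abs_le]; constructor <;> linarith [hL'.1, hL'.2]
  have hL1 : |L' - 3 / 5| < ε1 := by
    have := abs_add_le (L' - L) (L - 3 / 5)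
    rw [show L' - L + (L - 3 / 5) = L' - 3 / 5 by ring] at this
    linarith
  obtain ⟨b1, b2, b3, b4, b5, b6, b7, b8, b9, b10⟩ :=
    hbox x' L' (hx1.trans_le i2) (hL1.trans_le i2)
  set n := nx x' with hn
  set w := wv x' L' with hw
  have hwre : w.re = vr x' L' := rfl
  have hxn : 1 / n ^ 3 = x' := nx_cube x' b1
  -- final phase
  set τ := ktp (s, f, x', L') with hτ
  set f' : ℝ := -(2 * Real.pi * l / k + τ) with hf'
  have hp2 : ‖((s, f, x', L') : ℝ × ℝ × ℝ × ℝ) - (s, f, x, L)‖ ≤ δ := by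
    simp only [Prod.mk_sub_mk]
    apply norm4 <;> simp [hxx, hLL, hδ0'.le]
  have hp3 : ‖((s, f, x', L') : ℝ × ℝ × ℝ × ℝ) - p0‖ < ε1 := by
    have := norm_sub_le_norm_sub_add_norm_sub ((s, f, x', L') : ℝ × ℝ × ℝ × ℝ) (s, f, x, L) p0
    linarith
  have hτd : |τ - ktp (s, f, x, L)| ≤ K * δ :=
    ((hlip _ _ (hp3.trans_le i3) (by linarith)).2).trans (mul_le_mul_of_nonneg_left hp2 hK)
  have hff : |f' - f| ≤ (7 + K) * δ := by
    have hpi := Real.pi_pos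
    have e1 : f' - f = -(2 * Real.pi * δ * (l - c0 * k)) - (τ - ktp (s, f, x, L)) := by
      rw [hf', hδe, hc0]; field_simp; ring
    have e2 : |2 * Real.pi * δ * (l - c0 * k)| ≤ 7 * δ := hE _ _ hδ0' hl
    rw [abs_le] at e2 hτd ⊢
    constructor <;> linarith
  have hKδ0 : 0 ≤ K * δ := by positivity
  have hp5 : ‖((s, f', x', L') : ℝ × ℝ × ℝ × ℝ) - (s, f, x, L)‖ ≤ (7 + K) * δ := by
    simp only [Prod.mk_sub_mk]
    apply norm4
    · simp; positivity
    · exact hff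
    · linarith
    · linarith
  have hp6 : ‖((s, f', x', L') : ℝ × ℝ × ℝ × ℝ) - p0‖ < ε1 := by
    have := norm_sub_le_norm_sub_add_norm_sub ((s, f', x', L') : ℝ × ℝ × ℝ × ℝ) (s, f, x, L) p0
    linarith
  have hPsi := (hlip (s, f', x', L') (s, f, x, L) (by linarith) (by linarith)).1.trans
    (mul_le_mul_of_nonneg_left hp5 hK)
  have hτ1 : |τ| ≤ 1 := by
    have h1 := (hlip (s, f, x', L') p0 (by linarith) (by simpa using hεL)).2
    have h2 : ktp p0 = 0 := by simp [ktp, p0, kt_zero]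
    rw [h2, sub_zero] at h1
    exact h1.trans ((mul_le_mul_of_nonneg_left hp3.le hK).trans i5)
  -- the Kepler orbit
  obtain ⟨φ, hφ, hφs, hφlow, hφex⟩ := kepler_exists (1, w) n b3
  have e1 : sg 1 w = w.re := by simp [sg]
  simp only [e1, norm_one] at hφs hφex
  set T := kt n 1 w.re (s + 2 * Real.pi * (k : ℤ) / n) with hT
  have hTe : T = τ + k * (2 * Real.pi * x') := by
    have h9 : 2 * Real.pi * ((k : ℤ) : ℝ) / n ^ 3 = k * (2 * Real.pi * x') := by
      rw [div_eq_mul_one_div, hxn]; push_cast; ring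
    have h10 : kt n 1 w.re s = τ := rfl
    rw [hT, kt_per _ _ _ _ _ b2.ne', h9, h10]
  have hTl : tc ≤ T := by
    rw [hTe]; exact hH _ _ _ _ hk4' b9 (abs_le.1 hτ1).1 htc1
  have hTu : T ≤ 16 * k := by
    rw [hTe]; exact hI _ _ _ hk4' b10 (abs_le.1 hτ1).2
  have hT0 : 0 < T := by linarith
  have hφT : φ T = (kZ n 1 w.re 1 w s, kV n 1 w.re 1 w s) := by
    rw [hT, hφs, kZ_per _ _ _ _ _ _ _ b2.ne', kV_per _ _ _ _ _ _ _ b2.ne']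
  have hJT : Jt (-T) = Jt f' := by
    have : -T = f' - 2 * Real.pi * m := by
      rw [hTe, hf', hx', hNd, hqr]; push_cast; field_simp; ring
    rw [this, Jt_int]
  have hPsi' : Psi (s, f', x', L') = (Jt (-T) * (φ T).1, Jt (-T) * (φ T).2) := by
    rw [hφT, hJT]; rfl
  have hlow : ∀ t ∈ Icc tc T, tc / 1000 * δ ^ 2 ≤ ‖(φ t).1 - Jt t‖ := by
    intro t ht
    obtain ⟨s1, rfl⟩ := hφex t
    rw [hφs]
    rcases kt_ranges w n b3 tc s1 _ ht.1 ht.2 with ⟨r1, r2⟩ | hbad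
    · have hpi := Real.pi_gt_three
      have hcop : IsCoprime N (q : ℤ) := by
        have h2 : IsCoprime N 2 := by
          obtain ⟨a, ha⟩ := hodd
          exact ⟨1, -a, by rw [ha]; ring⟩
        have : ((q : ℕ) : ℤ) = 2 ^ (e * 2) := by rw [hq, hk]; push_cast; rw [pow_mul]
        rw [this]; exact h2.pow_right
      have hb := dist_low w n (tc / 1000) tc (Complex.log (ZB x' L')).im N l2 k q b3 b5 b6
        (by rw [hxn]) hq0 (by rw [hq]; nlinarith) hcop (by positivity) le_rfl htc1
        (ZB_Jt x' L' b2 (by linarith) b8) hL2 s1 r1 (by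
          refine r2.trans ?_
          have hn2 : n ≤ 2 := by have := b3.2.2.2.2.1; nlinarith
          have h2 : s ≤ 2 * Real.pi / n := by
            exact hF s n ε1 b2 hn2 (abs_lt.1 q1).2 i4
          rw [add_mul, one_mul, add_comm]
          push_cast
          have : 2 * Real.pi * (k : ℝ) / n = k * (2 * Real.pi / n) := by field_simp
          linarith)
      refine le_trans (le_of_eq ?_) hb
      rw [hδe, hqr]; field_simp
    · linarith
  obtain ⟨Z, V, hZV, hlim, hend⟩ := hsh w b7 φ (by rw [b4]; exact hφ) hφlow μ δ T k hδk hδ0' j1 hμ hμδ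
    hTl hTu hlow
  refine ⟨T, Z, V, hT0, fun t ht => ⟨(hZV t ht).2.2.1, (hZV t ht).2.2.2⟩, hlim, ?_, ?_⟩
  · have h1 : ‖Z T - (φ T).1‖ ≤ δ := (norm_fst_le ((Z T, V T) - φ T)).trans hend
    have h2 := (norm_fst_le (Psi (s, f', x', L') - Psi (s, f, x, L))).trans hPsi
    rw [Prod.fst_sub, hPsi'] at h2
    have h3 : ‖Jt (-T) * Z T - Jt (-T) * (φ T).1‖ ≤ δ := by
      rw [← mul_sub, norm_mul, Jt_norm, one_mul]; exact h1
    have h4 := norm_sub_le_norm_sub_add_norm_sub (Jt (-T) * Z T) (Jt (-T) * (φ T).1)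
      (Psi (s, f, x, L)).1
    refine h4.trans ((add_le_add h3 h2).trans (le_of_eq (by ring)))
  · have h1 : ‖V T - (φ T).2‖ ≤ δ := (norm_snd_le ((Z T, V T) - φ T)).trans hend
    have h2 := (norm_snd_le (Psi (s, f', x', L') - Psi (s, f, x, L))).trans hPsi
    rw [Prod.snd_sub, hPsi'] at h2
    have h3 : ‖Jt (-T) * V T - Jt (-T) * (φ T).2‖ ≤ δ := by
      rw [← mul_sub, norm_mul, Jt_norm, one_mul]; exact h1
    have h4 := norm_sub_le_norm_sub_add_norm_sub (Jt (-T) * V T) (Jt (-T) * (φ T).2)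
      (Psi (s, f, x, L)).2
    refine h4.trans ((add_le_add h3 h2).trans (le_of_eq (by ring)))
end RC3

namespace RC3
open Set Filter Topology ComplexConjugate

lemma pick (δ1 : ℝ) (μ : ℝ) (h0 : 0 < μ) (h1 : μ < 1) (h2 : μ < δ1 ^ 20) (hd : 0 < δ1) :
    ∃ (δ : ℝ) (e : ℕ), δ * (2 ^ e : ℕ) = 1 ∧ δ ≤ δ1 ∧ μ ≤ 2 ^ 20 * δ ^ 20 ∧
      δ ≤ μ ^ ((1 : ℝ) / 20) ∧ μ ≤ μ ^ ((1 : ℝ) / 20) := by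
  set r := μ ^ ((1 : ℝ) / 20) with hr
  have hr0 : 0 < r := Real.rpow_pos_of_pos h0 _
  have hr20 : r ^ 20 = μ := by
    rw [hr, ← Real.rpow_natCast, ← Real.rpow_mul h0.le]; norm_num
  have hr1 : r ≤ 1 := Real.rpow_le_one h0.le h1.le (by norm_num)
  have hrd : r ≤ δ1 := by
    by_contra h
    push Not at h
    have := pow_lt_pow_left₀ h hd.le (n := 20) (by norm_num)
    linarith
  obtain ⟨n, hn1, hn2⟩ := exists_nat_pow_near_of_lt_one hr0 hr1
    (show (0 : ℝ) < 1 / 2 by norm_num) (by norm_num)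
  refine ⟨(1 / 2) ^ (n + 1), n + 1, ?_, hn1.le.trans hrd, ?_, hn1.le, ?_⟩
  · push_cast; rw [← mul_pow]; norm_num
  · rw [← hr20, ← mul_pow]
    apply pow_le_pow_left₀ hr0.le
    rw [pow_succ]; linarith
  · rw [← hr20]
    exact pow_le_of_le_one hr0.le hr1 (by norm_num)

lemma sq4 (a b c d r : ℝ) (ha : |a| ≤ r) (hb : |b| ≤ r) (hc : |c| ≤ r) (hd : |d| ≤ r) :
    Real.sqrt (a ^ 2 + b ^ 2 + c ^ 2 + d ^ 2) ≤ 2 * r := by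
  have hr : 0 ≤ r := (abs_nonneg a).trans ha
  rw [Real.sqrt_le_left (by positivity)]
  have := sq_le_sq' (abs_le.1 ha).1 (abs_le.1 ha).2
  have := sq_le_sq' (abs_le.1 hb).1 (abs_le.1 hb).2
  have := sq_le_sq' (abs_le.1 hc).1 (abs_le.1 hc).2
  have := sq_le_sq' (abs_le.1 hd).1 (abs_le.1 hd).2
  linarith

def gm (P : ℝ × ℝ × ℝ × ℝ) : ℂ × ℂ := (⟨P.1, -P.2.1⟩, ⟨-P.2.2.1, P.2.2.2⟩)

lemma gm_cont : Continuous gm := by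
  have : gm = fun P : ℝ × ℝ × ℝ × ℝ => (Complex.equivRealProdCLM.symm (P.1, -P.2.1),
      Complex.equivRealProdCLM.symm (-P.2.2.1, P.2.2.2)) := by
    funext P
    apply Prod.ext <;> apply Complex.ext <;> simp [gm]
  rw [this]
  fun_prop

theorem final :
    ∃ (U : Set (ℝ × ℝ × ℝ × ℝ)) (C μ₀ : ℝ),
      IsOpen U ∧ U.Nonempty ∧ 0 < C ∧ 0 < μ₀ ∧
      ∀ μ ∈ Set.Ioo (0 : ℝ) μ₀, ∀ P ∈ U, ∃ Q : ℝ × ℝ × ℝ × ℝ,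
        dist4 Q P ≤ C * μ ^ ((1 : ℝ) / 20) ∧ IsCollisionOrbit μ Q := by
  obtain ⟨ε, hε, C, hC, δ1, hδ1, hcore⟩ := core
  obtain ⟨U', hU', ⟨z, hz⟩, hsurj⟩ := Psi_open ε hε
  refine ⟨gm ⁻¹' U', 2 * (C + 1), min 1 (δ1 ^ 20), hU'.preimage gm_cont,
    ⟨(z.1.re, -z.1.im, -z.2.re, z.2.im), ?_⟩, by positivity, by positivity, ?_⟩
  · have : gm (z.1.re, -z.1.im, -z.2.re, z.2.im) = z := by simp [gm]
    rw [mem_preimage, this]; exact hz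
  rintro μ ⟨hμ0, hμ1⟩ P hP
  obtain ⟨p, hp, hpz⟩ := hsurj _ hP
  obtain ⟨δ, e, g1, g2, g3, g4, g5⟩ := pick δ1 μ hμ0 (hμ1.trans_le (min_le_left _ _))
    (hμ1.trans_le (min_le_right _ _)) hδ1
  obtain ⟨T, Z, V, hT, hode, hlim, e1, e2⟩ := hcore p hp μ δ e g1 g2 hμ0 g3
  refine ⟨_, ?_, transl μ T Z V hT hode hlim⟩
  rw [hpz] at e1 e2
  set r := μ ^ ((1 : ℝ) / 20)
  have hC2 : C * δ ≤ C * r := mul_le_mul_of_nonneg_left g4 hC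
  have a1 := (Complex.abs_re_le_norm _).trans (e1.trans hC2)
  have a2 := (Complex.abs_im_le_norm _).trans (e1.trans hC2)
  have a3 := (Complex.abs_re_le_norm _).trans (e2.trans hC2)
  have a4 := (Complex.abs_im_le_norm _).trans (e2.trans hC2)
  rw [Complex.sub_re] at a1 a3
  rw [Complex.sub_im] at a2 a4
  simp only [gm] at a1 a2 a3 a4
  rw [dist4, mul_assoc]
  rw [abs_le] at a1 a2 a3 a4
  apply sq4 <;> rw [abs_le] <;> constructor <;> dsimp only <;> linarith
end RC3

/-- In a fixed nonempty open set `U` of the phase space, independent of `μ`, the initial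
conditions leading to collision are `O(μ^{1/20})`-dense as `μ → 0`. -/
theorem collision_orbits_asymptotically_dense :
    ∃ (U : Set (ℝ × ℝ × ℝ × ℝ)) (C μ₀ : ℝ),
      IsOpen U ∧ U.Nonempty ∧ 0 < C ∧ 0 < μ₀ ∧
      ∀ μ ∈ Set.Ioo (0 : ℝ) μ₀, ∀ P ∈ U, ∃ Q : ℝ × ℝ × ℝ × ℝ,
        dist4 Q P ≤ C * μ ^ ((1 : ℝ) / 20) ∧ IsCollisionOrbit μ Q := by
  exact RC3.final
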